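/- Let u be a smooth solution to the special Lagrangian equation ∑_{i=1}^n arctan λᵢ(x) = c on ℝⁿ satisfying 3 + (1−ε)λᵢ(x)² + 2λᵢ(x)λⱼ(x) ≥ 0 for all indices i, j, all x, and some fixed ε > 0. Then the Jacobi-type inequality Δ_g ln V ≥ (ε/n) |∇_g ln V|²_g holds at every point of ℝⁿ. -/

import Mathlib

noncomputable section

/-- The Hessian matrix `D²u(x)`, with entries `∂ᵢ∂ⱼ u (x)`. -/
def Hess {n : ℕ} (u : EuclideanSpace ℝ (Fin n) → ℝ) (x : EuclideanSpace ℝ (Fin n)) :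
    Matrix (Fin n) (Fin n) ℝ :=
  Matrix.of fun i j =>
    iteratedFDeriv ℝ 2 u x ![EuclideanSpace.single i 1, EuclideanSpace.single j 1]

/-- The induced metric `g = I + D²u · D²u` on the gradient graph `(x, ∇u(x))`. -/
def gMat {n : ℕ} (u : EuclideanSpace ℝ (Fin n) → ℝ) (x : EuclideanSpace ℝ (Fin n)) :
    Matrix (Fin n) (Fin n) ℝ :=
  1 + Hess u x * Hess u x

/-- The Laplace–Beltrami operator `Δ_g v = ∑ g^{ij} ∂ᵢ∂ⱼ v` of the induced metric. -/
def lapg {n : ℕ} (u v : EuclideanSpace ℝ (Fin n) → ℝ) (x : EuclideanSpace ℝ (Fin n)) : ℝ :=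
  ∑ i, ∑ j, (gMat u x)⁻¹ i j *
    iteratedFDeriv ℝ 2 v x ![EuclideanSpace.single i 1, EuclideanSpace.single j 1]

/-- The squared metric gradient norm `|∇_g v|²_g = ∑ g^{ij} ∂ᵢv ∂ⱼv`. -/
def gradSq {n : ℕ} (u v : EuclideanSpace ℝ (Fin n) → ℝ) (x : EuclideanSpace ℝ (Fin n)) : ℝ :=
  ∑ i, ∑ j, (gMat u x)⁻¹ i j * fderiv ℝ v x (EuclideanSpace.single i 1) *
    fderiv ℝ v x (EuclideanSpace.single j 1)

/-- The volume element `V = √(det g)`. -/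
def Vol {n : ℕ} (u : EuclideanSpace ℝ (Fin n) → ℝ) (x : EuclideanSpace ℝ (Fin n)) : ℝ :=
  Real.sqrt ((gMat u x).det)

end

section

open Matrix Finset
open scoped ContDiff

noncomputable section SLag

/-- Partial derivative in the `i`-th coordinate direction. -/
def pd {n : ℕ} {F : Type*} [NormedAddCommGroup F] [NormedSpace ℝ F] (i : Fin n)
    (f : EuclideanSpace ℝ (Fin n) → F) : EuclideanSpace ℝ (Fin n) → F :=
  fun x => fderiv ℝ f x (EuclideanSpace.single i 1)

section basics
variable {n : ℕ} {F : Type*} [NormedAddCommGroup F] [NormedSpace ℝ F]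

lemma pd_smooth (i : Fin n) {f : EuclideanSpace ℝ (Fin n) → F} (hf : ContDiff ℝ ∞ f) :
    ContDiff ℝ ∞ (pd i f) := by
  unfold pd
  have := hf.fderiv_right (m := ∞) (by simp)
  exact this.clm_apply contDiff_const

lemma iter2_eq {f : EuclideanSpace ℝ (Fin n) → F} (hf : ContDiff ℝ ∞ f)
    (x : EuclideanSpace ℝ (Fin n)) (i j : Fin n) :
    iteratedFDeriv ℝ 2 f x ![EuclideanSpace.single i 1, EuclideanSpace.single j 1]
      = pd i (pd j f) x := by
  rw [iteratedFDeriv_two_apply]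
  unfold pd
  have h : DifferentiableAt ℝ (fderiv ℝ f) x :=
    ((hf.fderiv_right (m := ∞) (by simp)).differentiable (by simp)) x
  rw [fderiv_clm_apply h (differentiableAt_const _)]
  simp

lemma pd_comm {f : EuclideanSpace ℝ (Fin n) → F} (hf : ContDiff ℝ ∞ f) (i j : Fin n) :
    pd i (pd j f) = pd j (pd i f) := by
  funext x
  rw [← iter2_eq hf, ← iter2_eq hf, iteratedFDeriv_two_apply, iteratedFDeriv_two_apply]
  have : IsSymmSndFDerivAt ℝ f x := hf.contDiffAt.isSymmSndFDerivAt (by simp; exact WithTop.coe_le_coe.2 (le_top : (2 : ℕ∞) ≤ ⊤))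
  simpa using this.eq _ _

lemma pd_line {f : EuclideanSpace ℝ (Fin n) → F} {x : EuclideanSpace ℝ (Fin n)}
    (hf : DifferentiableAt ℝ f x) (i : Fin n) :
    HasDerivAt (fun t : ℝ => f (x + t • EuclideanSpace.single i 1)) (pd i f x) 0 :=
  hf.hasFDerivAt.hasLineDerivAt _

lemma pd_line' {f : EuclideanSpace ℝ (Fin n) → F} (hf : ContDiff ℝ ∞ f)
    (x : EuclideanSpace ℝ (Fin n)) (i : Fin n) :
    HasDerivAt (fun t : ℝ => f (x + t • EuclideanSpace.single i 1)) (pd i f x) 0 :=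
  pd_line (hf.differentiable (by simp) x) i

lemma pd_eq {f : EuclideanSpace ℝ (Fin n) → F} {x : EuclideanSpace ℝ (Fin n)}
    (hf : DifferentiableAt ℝ f x) {i : Fin n} {f' : F}
    (h : HasDerivAt (fun t : ℝ => f (x + t • EuclideanSpace.single i 1)) f' 0) :
    pd i f x = f' := (pd_line hf i).unique h

lemma Hess_apply {u : EuclideanSpace ℝ (Fin n) → ℝ} (hu : ContDiff ℝ ∞ u)
    (x : EuclideanSpace ℝ (Fin n)) (i j : Fin n) : Hess u x i j = pd i (pd j u) x := by
  unfold Hess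
  simp only [Matrix.of_apply]
  exact iter2_eq hu x i j

lemma Hess_symm {u : EuclideanSpace ℝ (Fin n) → ℝ} (hu : ContDiff ℝ ∞ u)
    (x : EuclideanSpace ℝ (Fin n)) (i j : Fin n) : Hess u x i j = Hess u x j i := by
  rw [Hess_apply hu, Hess_apply hu, pd_comm hu]

lemma Hess_smooth {u : EuclideanSpace ℝ (Fin n) → ℝ} (hu : ContDiff ℝ ∞ u)
    (i j : Fin n) : ContDiff ℝ ∞ (fun x => Hess u x i j) := by
  have : (fun x => Hess u x i j) = pd i (pd j u) := funext fun x => Hess_apply hu x i j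
  rw [this]; exact pd_smooth _ (pd_smooth _ hu)

/-- derivative of a determinant along a curve of matrices -/
lemma hasDerivAt_det {A : ℝ → Matrix (Fin n) (Fin n) ℂ} {A' : Matrix (Fin n) (Fin n) ℂ} {t : ℝ}
    (h : ∀ i j, HasDerivAt (fun s => A s i j) (A' i j) t) :
    HasDerivAt (fun s => (A s).det) ((A t).adjugate * A').trace t := by
  have h1 : HasDerivAt (fun s => ∑ σ : Equiv.Perm (Fin n),
      ((Equiv.Perm.sign σ : ℤ) : ℂ) * ∏ i, A s (σ i) i)
      (∑ σ : Equiv.Perm (Fin n), ((Equiv.Perm.sign σ : ℤ) : ℂ) *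
        ∑ i, (∏ j ∈ univ.erase i, A t (σ j) j) • A' (σ i) i) t := by
    apply HasDerivAt.fun_sum
    intro σ _
    apply HasDerivAt.const_mul
    exact HasDerivAt.fun_finsetProd (fun i _ => h (σ i) i)
  have h2 : (fun s => (A s).det) = fun s => ∑ σ : Equiv.Perm (Fin n),
      ((Equiv.Perm.sign σ : ℤ) : ℂ) * ∏ i, A s (σ i) i := by
    funext s; rw [Matrix.det_apply']
  rw [h2]
  convert h1 using 1
  rw [Matrix.trace]
  have : ∀ i, ((A t).adjugate * A').diag i = ((A t).updateCol i (A'.col i)).det := by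
    intro i
    rw [← Matrix.cramer_apply, Matrix.cramer_eq_adjugate_mulVec]
    simp [Matrix.mul_apply, Matrix.mulVec, dotProduct]
  simp_rw [this, Matrix.det_apply', mul_sum]
  rw [sum_comm]
  refine sum_congr rfl fun σ _ => sum_congr rfl fun i _ => ?_
  congr 1
  rw [← mul_prod_erase univ _ (mem_univ i), mul_comm]
  simp only [updateCol_self, Matrix.col_apply, smul_eq_mul]
  congr 1
  refine prod_congr rfl fun j hj => ?_
  rw [updateCol_ne (ne_of_mem_erase hj)]

lemma contDiff_det {A : EuclideanSpace ℝ (Fin n) → Matrix (Fin n) (Fin n) ℂ}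
    (h : ∀ i j, ContDiff ℝ ∞ (fun x => A x i j)) : ContDiff ℝ ∞ (fun x => (A x).det) := by
  simp_rw [Matrix.det_apply']
  refine ContDiff.sum fun σ _ => contDiff_const.mul (contDiff_prod fun i _ => h _ _)

lemma contDiff_detR {A : EuclideanSpace ℝ (Fin n) → Matrix (Fin n) (Fin n) ℝ}
    (h : ∀ i j, ContDiff ℝ ∞ (fun x => A x i j)) : ContDiff ℝ ∞ (fun x => (A x).det) := by
  simp_rw [Matrix.det_apply']
  refine ContDiff.sum fun σ _ => contDiff_const.mul (contDiff_prod fun i _ => h _ _)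

lemma contDiff_adj {A : EuclideanSpace ℝ (Fin n) → Matrix (Fin n) (Fin n) ℂ}
    (h : ∀ i j, ContDiff ℝ ∞ (fun x => A x i j)) (i j : Fin n) :
    ContDiff ℝ ∞ (fun x => (A x).adjugate i j) := by
  simp_rw [Matrix.adjugate_apply]
  apply contDiff_det
  intro a b
  by_cases hb : a = j
  · subst hb; simp [contDiff_const]
  · simp only [updateRow_apply, hb, if_false]; exact h a b

end basics
end SLag

end

section

open Matrix Finset
open scoped ContDiff

noncomputable section SLag2

/-- `I + √-1 D²u` -/
def Mc {n : ℕ} (u : EuclideanSpace ℝ (Fin n) → ℝ) (x : EuclideanSpace ℝ (Fin n)) :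
    Matrix (Fin n) (Fin n) ℂ :=
  1 + Complex.I • (Hess u x).map Complex.ofReal

/-- `√-1 (I + √-1 D²u)⁻¹` -/
def Wc {n : ℕ} (u : EuclideanSpace ℝ (Fin n) → ℝ) (x : EuclideanSpace ℝ (Fin n)) :
    Matrix (Fin n) (Fin n) ℂ :=
  Complex.I • (Mc u x)⁻¹

/-- derivative of the Hessian in direction `k` -/
def Tk {n : ℕ} (u : EuclideanSpace ℝ (Fin n) → ℝ) (k : Fin n) (x : EuclideanSpace ℝ (Fin n)) :
    Matrix (Fin n) (Fin n) ℝ :=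
  Matrix.of fun i j => pd k (pd i (pd j u)) x

/-- log volume -/
def bV {n : ℕ} (u : EuclideanSpace ℝ (Fin n) → ℝ) (x : EuclideanSpace ℝ (Fin n)) : ℝ :=
  Real.log (Vol u x)

/-- complexification of a real matrix -/
abbrev cx {n : ℕ} (A : Matrix (Fin n) (Fin n) ℝ) : Matrix (Fin n) (Fin n) ℂ :=
  A.map Complex.ofReal

section
variable {n : ℕ} {u : EuclideanSpace ℝ (Fin n) → ℝ}

lemma cx_mul (A B : Matrix (Fin n) (Fin n) ℝ) : cx (A * B) = cx A * cx B := by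
  ext i j; simp [cx, Matrix.mul_apply]

lemma cx_one : cx (1 : Matrix (Fin n) (Fin n) ℝ) = 1 := by
  ext i j; simp [cx, Matrix.one_apply]; split_ifs <;> simp

lemma spec {A : Matrix (Fin n) (Fin n) ℝ} (hA : A.IsHermitian) :
    ∃ O : Matrix (Fin n) (Fin n) ℝ, Oᵀ * O = 1 ∧ O * Oᵀ = 1 ∧
      A = O * diagonal hA.eigenvalues * Oᵀ := by
  refine ⟨hA.eigenvectorUnitary, ?_, ?_, ?_⟩
  · have := Unitary.coe_star_mul_self hA.eigenvectorUnitary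
    simpa [Matrix.star_eq_conjTranspose] using this
  · have := Unitary.coe_mul_star_self hA.eigenvectorUnitary
    simpa [Matrix.star_eq_conjTranspose] using this
  · conv_lhs => rw [hA.spectral_theorem]
    simp [Unitary.conjStarAlgAut_apply, Matrix.star_eq_conjTranspose]

lemma gMat_eq {O : Matrix (Fin n) (Fin n) ℝ} {l : Fin n → ℝ} {x : EuclideanSpace ℝ (Fin n)}
    (h1 : Oᵀ * O = 1) (h2 : O * Oᵀ = 1) (hH : Hess u x = O * diagonal l * Oᵀ) :
    gMat u x = O * diagonal (fun i => 1 + l i ^ 2) * Oᵀ := by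
  unfold gMat
  rw [hH]
  have : O * diagonal l * Oᵀ * (O * diagonal l * Oᵀ) = O * (diagonal l * diagonal l) * Oᵀ := by
    calc _ = O * diagonal l * (Oᵀ * O) * diagonal l * Oᵀ := by simp only [Matrix.mul_assoc]
      _ = _ := by rw [h1]; simp only [Matrix.mul_assoc, Matrix.one_mul]
  rw [this, ← h2, diagonal_mul_diagonal]
  have h3 : diagonal (fun i => 1 + l i ^ 2) = 1 + diagonal (fun i => l i * l i) := by
    rw [← diagonal_one, diagonal_add]; congr 1; ext i; ring
  rw [h3, Matrix.mul_add, Matrix.add_mul, Matrix.mul_one]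

lemma det_conj {O : Matrix (Fin n) (Fin n) ℝ} (h2 : O * Oᵀ = 1) (d : Fin n → ℝ) :
    (O * diagonal d * Oᵀ).det = ∏ i, d i := by
  have := congrArg Matrix.det h2
  simp only [det_mul, det_one] at this
  rw [det_mul, det_mul, det_diagonal]
  linear_combination (∏ i, d i) * this

lemma det_conjc {O : Matrix (Fin n) (Fin n) ℝ} (h2 : O * Oᵀ = 1) (d : Fin n → ℂ) :
    (cx O * diagonal d * cx Oᵀ).det = ∏ i, d i := by
  have := congrArg Matrix.det (congrArg cx h2)
  simp only [cx_mul, cx_one, det_mul, det_one] at this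
  rw [det_mul, det_mul, det_diagonal]
  linear_combination (∏ i, d i) * this

lemma Mc_eq {O : Matrix (Fin n) (Fin n) ℝ} {l : Fin n → ℝ} {x : EuclideanSpace ℝ (Fin n)}
    (h2 : O * Oᵀ = 1) (hH : Hess u x = O * diagonal l * Oᵀ) :
    Mc u x = cx O * diagonal (fun i => 1 + Complex.I * (l i : ℂ)) * cx Oᵀ := by
  unfold Mc
  change 1 + Complex.I • cx (Hess u x) = _
  rw [hH, cx_mul, cx_mul, ← cx_one, ← h2, cx_mul]
  have h3 : diagonal (fun i => 1 + Complex.I * (l i : ℂ))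
      = 1 + Complex.I • cx (diagonal l) := by
    ext i j
    by_cases hij : i = j
    · subst hij; simp
    · simp [hij]
  rw [h3, Matrix.mul_add, Matrix.add_mul, Matrix.mul_one]
  simp

lemma det_gMat {O : Matrix (Fin n) (Fin n) ℝ} {l : Fin n → ℝ} {x : EuclideanSpace ℝ (Fin n)}
    (h1 : Oᵀ * O = 1) (h2 : O * Oᵀ = 1) (hH : Hess u x = O * diagonal l * Oᵀ) :
    (gMat u x).det = ∏ i, (1 + l i ^ 2) := by
  rw [gMat_eq h1 h2 hH, det_conj h2]

lemma det_gMat_ge (hsym : ∀ x, (Hess u x).IsHermitian) (x : EuclideanSpace ℝ (Fin n)) :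
    1 ≤ (gMat u x).det := by
  obtain ⟨O, h1, h2, hH⟩ := spec (hsym x)
  rw [det_gMat h1 h2 hH]
  have := Finset.prod_le_prod (s := univ) (f := fun _ : Fin n => (1 : ℝ))
    (g := fun i => 1 + (hsym x).eigenvalues i ^ 2) (fun i _ => zero_le_one)
    (fun i _ => by nlinarith [sq_nonneg ((hsym x).eigenvalues i)])
  simpa using this

lemma Vol_ge (hsym : ∀ x, (Hess u x).IsHermitian) (x : EuclideanSpace ℝ (Fin n)) :
    1 ≤ Vol u x := by
  unfold Vol; exact Real.one_le_sqrt.2 (det_gMat_ge hsym x)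

lemma one_add_I_mul (t : ℝ) : (1 + Complex.I * (t : ℂ)) =
    ((Real.sqrt (1 + t ^ 2) : ℝ) : ℂ) * Complex.exp ((Real.arctan t : ℝ) * Complex.I) := by
  have hs : 0 < Real.sqrt (1 + t ^ 2) := Real.sqrt_pos.2 (by positivity)
  rw [Complex.exp_mul_I, ← Complex.ofReal_cos, ← Complex.ofReal_sin, Real.cos_arctan,
    Real.sin_arctan]
  apply Complex.ext <;> simp <;> field_simp

lemma det_Mc (hsym : ∀ x, (Hess u x).IsHermitian) {c : ℝ}
    (hsol : ∀ x, ∑ i, Real.arctan ((hsym x).eigenvalues i) = c) (x : EuclideanSpace ℝ (Fin n)) :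
    (Mc u x).det = (Vol u x : ℂ) * Complex.exp (c * Complex.I) := by
  obtain ⟨O, h1, h2, hH⟩ := spec (hsym x)
  rw [Mc_eq h2 hH, det_conjc h2]
  simp_rw [one_add_I_mul]
  rw [prod_mul_distrib, ← Complex.exp_sum, ← sum_mul]
  unfold Vol
  rw [det_gMat h1 h2 hH, Real.sqrt_eq_rpow, ← Real.finsetProd_rpow _ _ (fun i _ => by positivity)]
  rw [← hsol x]
  push_cast
  simp_rw [Real.sqrt_eq_rpow]

lemma gMat_smooth (hu : ContDiff ℝ ∞ u) (i j : Fin n) : ContDiff ℝ ∞ (fun x => gMat u x i j) := by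
  unfold gMat
  simp only [Matrix.add_apply, Matrix.mul_apply]
  exact contDiff_const.add (ContDiff.sum fun k _ => (Hess_smooth hu i k).mul (Hess_smooth hu k j))

lemma Vol_smooth (hu : ContDiff ℝ ∞ u) (hsym : ∀ x, (Hess u x).IsHermitian) :
    ContDiff ℝ ∞ (Vol u) := by
  unfold Vol
  exact (contDiff_detR (gMat_smooth hu)).sqrt (fun x => by have := det_gMat_ge hsym x; positivity)

lemma bV_smooth (hu : ContDiff ℝ ∞ u) (hsym : ∀ x, (Hess u x).IsHermitian) :
    ContDiff ℝ ∞ (bV u) :=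
  (Vol_smooth hu hsym).log (fun x => by have := Vol_ge hsym x; positivity)

lemma Mc_smooth (hu : ContDiff ℝ ∞ u) (i j : Fin n) : ContDiff ℝ ∞ (fun x => Mc u x i j) := by
  unfold Mc
  simp only [Matrix.add_apply, Matrix.smul_apply, Matrix.map_apply, smul_eq_mul]
  exact contDiff_const.add (contDiff_const.mul
    (Complex.ofRealCLM.contDiff.comp (Hess_smooth hu i j)))

lemma det_Mc_ne (hsym : ∀ x, (Hess u x).IsHermitian) (x : EuclideanSpace ℝ (Fin n)) :
    (Mc u x).det ≠ 0 := by
  obtain ⟨O, h1, h2, hH⟩ := spec (hsym x)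
  rw [Mc_eq h2 hH, det_conjc h2, prod_ne_zero_iff]
  intro i _ h
  have := congrArg Complex.re h
  simp at this

lemma Wc_smooth (hu : ContDiff ℝ ∞ u) (hsym : ∀ x, (Hess u x).IsHermitian) (i j : Fin n) :
    ContDiff ℝ ∞ (fun x => Wc u x i j) := by
  unfold Wc
  simp only [Matrix.smul_apply, Matrix.inv_def, Ring.inverse_eq_inv', smul_eq_mul]
  exact contDiff_const.mul (((contDiff_det (Mc_smooth hu)).inv (det_Mc_ne hsym)).mul
    (contDiff_adj (Mc_smooth hu) i j))

lemma Hess_line (hu : ContDiff ℝ ∞ u) (x : EuclideanSpace ℝ (Fin n)) (k i j : Fin n) :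
    HasDerivAt (fun t : ℝ => Hess u (x + t • EuclideanSpace.single k 1) i j) (Tk u k x i j) 0 := by
  have := pd_line' (Hess_smooth hu i j) x k
  have e : (fun y => Hess u y i j) = pd i (pd j u) := funext fun y => Hess_apply hu y i j
  have e2 : Tk u k x i j = pd k (fun y => Hess u y i j) x := by rw [e]; rfl
  rw [e2]; exact this

lemma Mc_line (hu : ContDiff ℝ ∞ u) (x : EuclideanSpace ℝ (Fin n)) (k i j : Fin n) :
    HasDerivAt (fun t : ℝ => Mc u (x + t • EuclideanSpace.single k 1) i j)
      ((Complex.I • cx (Tk u k x)) i j) 0 := by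
  unfold Mc
  simp only [Matrix.add_apply, Matrix.smul_apply, Matrix.map_apply, smul_eq_mul]
  exact ((Hess_line hu x k i j).ofReal_comp.const_mul Complex.I).const_add _

/-- first derivative of `ln V` -/
lemma pd_bV (hu : ContDiff ℝ ∞ u) (hsym : ∀ x, (Hess u x).IsHermitian) {c : ℝ}
    (hsol : ∀ x, ∑ i, Real.arctan ((hsym x).eigenvalues i) = c) (x : EuclideanSpace ℝ (Fin n))
    (k : Fin n) : ((pd k (bV u) x : ℝ) : ℂ) = (Wc u x * cx (Tk u k x)).trace := by
  have h1 := hasDerivAt_det (A := fun t : ℝ => Mc u (x + t • EuclideanSpace.single k 1))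
    (t := 0) (Mc_line hu x k)
  simp only [zero_smul, add_zero] at h1
  have h2 : (fun t : ℝ => (Mc u (x + t • EuclideanSpace.single k 1)).det) =
      fun t : ℝ => ((Real.exp (bV u (x + t • EuclideanSpace.single k 1)) : ℝ) : ℂ)
        * Complex.exp (c * Complex.I) := by
    funext t
    rw [det_Mc hsym hsol, bV, Real.exp_log]
    have := Vol_ge hsym (x + t • EuclideanSpace.single k 1); positivity
  rw [h2] at h1
  have h3 := ((pd_line' (bV_smooth hu hsym) x k).exp.ofReal_comp).mul_const
    (Complex.exp (c * Complex.I))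
  have h4 := h3.unique h1
  simp only [zero_smul, add_zero] at h4
  have hx : ((Real.exp (bV u x) : ℝ) : ℂ) * Complex.exp (c * Complex.I) = (Mc u x).det := by
    rw [det_Mc hsym hsol, bV, Real.exp_log]
    have := Vol_ge hsym x; positivity
  have hne := det_Mc_ne hsym x
  have h5 : (Mc u x).adjugate = (Mc u x).det • (Mc u x)⁻¹ := by
    rw [Matrix.inv_def, smul_smul, Ring.inverse_eq_inv', mul_inv_cancel₀ hne, one_smul]
  rw [h5] at h4
  unfold Wc
  simp only [Matrix.smul_mul, Matrix.mul_smul, Matrix.trace_smul, smul_eq_mul] at h4 ⊢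
  rw [← hx] at h4 hne
  apply mul_left_cancel₀ hne
  push_cast at h4 ⊢
  rw [← mul_assoc] at h4 ⊢
  linear_combination h4

lemma Wc_line (hu : ContDiff ℝ ∞ u) (hsym : ∀ x, (Hess u x).IsHermitian)
    (x : EuclideanSpace ℝ (Fin n)) (l i j : Fin n) :
    HasDerivAt (fun t : ℝ => Wc u (x + t • EuclideanSpace.single l 1) i j)
      (-(Wc u x * cx (Tk u l x) * Wc u x) i j) 0 := by
  set W' : Matrix (Fin n) (Fin n) ℂ := Matrix.of fun a b => pd l (fun y => Wc u y a b) x with hW'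
  have hW : ∀ a b, HasDerivAt (fun t : ℝ => Wc u (x + t • EuclideanSpace.single l 1) a b)
      (W' a b) 0 := fun a b => pd_line' (Wc_smooth hu hsym a b) x l
  have hWM : ∀ y, Wc u y * Mc u y = Complex.I • 1 := by
    intro y
    unfold Wc
    rw [Matrix.smul_mul, Matrix.nonsing_inv_mul _ (Ne.isUnit (det_Mc_ne hsym y))]
  have h1 : W' * Mc u x + Wc u x * (Complex.I • cx (Tk u l x)) = 0 := by
    ext a b
    have h : HasDerivAt (fun t : ℝ => (Wc u (x + t • EuclideanSpace.single l 1) *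
        Mc u (x + t • EuclideanSpace.single l 1)) a b)
        (∑ k, (W' a k * Mc u x k b + Wc u x a k * (Complex.I • cx (Tk u l x)) k b)) 0 := by
      simp only [Matrix.mul_apply]
      apply HasDerivAt.fun_sum
      intro k _
      have := (hW a k).fun_mul (Mc_line hu x l k b)
      simpa using this
    simp only [hWM] at h
    have := h.unique (hasDerivAt_const _ _)
    rw [sum_add_distrib] at this
    simpa only [Matrix.add_apply, Matrix.mul_apply, Matrix.zero_apply] using this
  have h2 : W' = -(Wc u x * cx (Tk u l x) * Wc u x) := by
    have h3 := congrArg (fun Z => Z * (Mc u x)⁻¹) h1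
    simp only [Matrix.add_mul, Matrix.mul_assoc, Matrix.zero_mul] at h3
    rw [Matrix.mul_nonsing_inv _ (Ne.isUnit (det_Mc_ne hsym x)), Matrix.mul_one] at h3
    rw [eq_neg_of_add_eq_zero_left h3, Matrix.mul_assoc]
    congr 2
    conv_rhs => rw [Wc]
    simp
  rw [← Matrix.neg_apply, ← h2]
  exact hW i j

/-- second derivative of `ln V` -/
lemma pd2_bV (hu : ContDiff ℝ ∞ u) (hsym : ∀ x, (Hess u x).IsHermitian) {c : ℝ}
    (hsol : ∀ x, ∑ i, Real.arctan ((hsym x).eigenvalues i) = c) (x : EuclideanSpace ℝ (Fin n))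
    (k l : Fin n) : ((pd l (pd k (bV u)) x : ℝ) : ℂ) =
      ∑ i, ∑ j, Wc u x i j * ((pd l (pd k (pd j (pd i u))) x : ℝ) : ℂ)
      - (Wc u x * cx (Tk u l x) * Wc u x * cx (Tk u k x)).trace := by
  have h1 : HasDerivAt (fun t : ℝ => ((pd k (bV u) (x + t • EuclideanSpace.single l 1) : ℝ) : ℂ))
      ((pd l (pd k (bV u)) x : ℝ) : ℂ) 0 :=
    (pd_line' (pd_smooth k (bV_smooth hu hsym)) x l).ofReal_comp
  simp only [pd_bV hu hsym hsol] at h1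
  have h2 : HasDerivAt (fun t : ℝ => (Wc u (x + t • EuclideanSpace.single l 1) *
      cx (Tk u k (x + t • EuclideanSpace.single l 1))).trace)
      (∑ i, ∑ j, (-(Wc u x * cx (Tk u l x) * Wc u x) i j * cx (Tk u k x) j i +
        Wc u x i j * ((pd l (pd k (pd j (pd i u))) x : ℝ) : ℂ))) 0 := by
    simp only [Matrix.trace, Matrix.diag_apply]
    simp only [Matrix.mul_apply (M := Wc u _) (N := cx (Tk u k _))]
    apply HasDerivAt.fun_sum
    intro i _
    apply HasDerivAt.fun_sum
    intro j _
    have h3 : HasDerivAt (fun t : ℝ => cx (Tk u k (x + t • EuclideanSpace.single l 1)) j i)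
        ((pd l (pd k (pd j (pd i u))) x : ℝ) : ℂ) 0 :=
      (pd_line' (pd_smooth k (pd_smooth j (pd_smooth i hu))) x l).ofReal_comp
    have := (Wc_line hu hsym x l i j).fun_mul h3
    simpa using this
  rw [h1.unique h2]
  simp only [sum_add_distrib]
  rw [add_comm, sub_eq_add_neg]
  congr 1
  rw [Matrix.trace, ← sum_neg_distrib]
  refine sum_congr rfl fun i _ => ?_
  rw [Matrix.diag_apply, Matrix.mul_apply, ← sum_neg_distrib]
  refine sum_congr rfl fun j _ => ?_
  ring

end
end SLag2

end

section

open Matrix Finset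
open scoped ContDiff

noncomputable section SLag3

/-- third derivatives in the frame `O` (first two slots) -/
def S2 {n : ℕ} (u : EuclideanSpace ℝ (Fin n) → ℝ) (O : Matrix (Fin n) (Fin n) ℝ)
    (x : EuclideanSpace ℝ (Fin n)) (k a b : Fin n) : ℝ := (Oᵀ * Tk u k x * O) a b

/-- third derivatives in the frame `O` -/
def T3 {n : ℕ} (u : EuclideanSpace ℝ (Fin n) → ℝ) (O : Matrix (Fin n) (Fin n) ℝ)
    (x : EuclideanSpace ℝ (Fin n)) (a b c : Fin n) : ℝ := ∑ k, O k c * S2 u O x k a b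

section
variable {n : ℕ} {u : EuclideanSpace ℝ (Fin n) → ℝ}

lemma Tk_symm12 (hu : ContDiff ℝ ∞ u) (x : EuclideanSpace ℝ (Fin n)) (k i j : Fin n) :
    Tk u k x i j = Tk u k x j i := by
  simp only [Tk, Matrix.of_apply]; rw [pd_comm hu]

lemma Tk_symm13 (hu : ContDiff ℝ ∞ u) (x : EuclideanSpace ℝ (Fin n)) (k i j : Fin n) :
    Tk u k x i j = Tk u i x k j := by
  simp only [Tk, Matrix.of_apply]; rw [pd_comm (pd_smooth j hu)]

lemma T3_expand (O : Matrix (Fin n) (Fin n) ℝ) (x : EuclideanSpace ℝ (Fin n)) (a b c : Fin n) :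
    T3 u O x a b c = ∑ k, ∑ i, ∑ j, O k c * O i a * O j b * Tk u k x i j := by
  unfold T3 S2
  refine sum_congr rfl fun k _ => ?_
  simp only [Matrix.mul_apply, Matrix.transpose_apply, mul_sum, sum_mul]
  rw [sum_comm]
  refine sum_congr rfl fun i _ => sum_congr rfl fun j _ => ?_
  ring

lemma T3_symm12 (hu : ContDiff ℝ ∞ u) (O : Matrix (Fin n) (Fin n) ℝ)
    (x : EuclideanSpace ℝ (Fin n)) (a b c : Fin n) : T3 u O x a b c = T3 u O x b a c := by
  rw [T3_expand, T3_expand]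
  refine sum_congr rfl fun k _ => ?_
  rw [sum_comm]
  refine sum_congr rfl fun i _ => sum_congr rfl fun j _ => ?_
  rw [Tk_symm12 hu]; ring

lemma T3_symm13 (hu : ContDiff ℝ ∞ u) (O : Matrix (Fin n) (Fin n) ℝ)
    (x : EuclideanSpace ℝ (Fin n)) (a b c : Fin n) : T3 u O x a b c = T3 u O x c b a := by
  rw [T3_expand, T3_expand, sum_comm]
  refine sum_congr rfl fun k _ => sum_congr rfl fun i _ => sum_congr rfl fun j _ => ?_
  rw [Tk_symm13 hu]; ring

lemma gInv_eq {O : Matrix (Fin n) (Fin n) ℝ} {l : Fin n → ℝ} {x : EuclideanSpace ℝ (Fin n)}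
    (h1 : Oᵀ * O = 1) (h2 : O * Oᵀ = 1) (hH : Hess u x = O * diagonal l * Oᵀ) :
    (gMat u x)⁻¹ = O * diagonal (fun i => (1 + l i ^ 2)⁻¹) * Oᵀ := by
  apply Matrix.inv_eq_right_inv
  rw [gMat_eq h1 h2 hH]
  calc _ = O * diagonal (fun i => 1 + l i ^ 2) * (Oᵀ * O) * diagonal (fun i => (1 + l i ^ 2)⁻¹) * Oᵀ := by
        simp only [Matrix.mul_assoc]
    _ = O * (diagonal (fun i => 1 + l i ^ 2) * diagonal (fun i => (1 + l i ^ 2)⁻¹)) * Oᵀ := by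
        rw [h1]; simp only [Matrix.mul_assoc, Matrix.one_mul]
    _ = 1 := by
        rw [diagonal_mul_diagonal]
        have : (fun i => (1 + l i ^ 2) * (1 + l i ^ 2)⁻¹) = fun _ => 1 := by
          funext i; exact mul_inv_cancel₀ (by positivity)
        rw [this, diagonal_one, Matrix.mul_one, h2]

/-- eigenvalues of `Wc` -/
def wc (l : ℝ) : ℂ := ((l : ℂ) + Complex.I) * ((1 + l ^ 2)⁻¹ : ℝ)

lemma Wc_eq {O : Matrix (Fin n) (Fin n) ℝ} {l : Fin n → ℝ} {x : EuclideanSpace ℝ (Fin n)}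
    (h1 : Oᵀ * O = 1) (h2 : O * Oᵀ = 1) (hH : Hess u x = O * diagonal l * Oᵀ) :
    Wc u x = cx O * diagonal (fun i => wc (l i)) * cx Oᵀ := by
  have key : (Mc u x)⁻¹ = cx O * diagonal (fun i => -Complex.I * wc (l i)) * cx Oᵀ := by
    apply Matrix.inv_eq_right_inv
    rw [Mc_eq h2 hH]
    have h1' : cx Oᵀ * cx O = 1 := by rw [← cx_mul, h1, cx_one]
    have h2' : cx O * cx Oᵀ = 1 := by rw [← cx_mul, h2, cx_one]
    calc _ = cx O * diagonal (fun i => 1 + Complex.I * (l i : ℂ)) * (cx Oᵀ * cx O) *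
          diagonal (fun i => -Complex.I * wc (l i)) * cx Oᵀ := by
          simp only [Matrix.mul_assoc]
      _ = cx O * (diagonal (fun i => 1 + Complex.I * (l i : ℂ)) *
          diagonal (fun i => -Complex.I * wc (l i))) * cx Oᵀ := by
          rw [h1']; simp only [Matrix.mul_assoc, Matrix.one_mul]
      _ = 1 := by
          rw [diagonal_mul_diagonal]
          have : (fun i => (1 + Complex.I * (l i : ℂ)) * (-Complex.I * wc (l i))) = fun _ => 1 := by
            funext i
            have hne : (1 + (l i : ℂ) ^ 2) ≠ 0 := by
              have : (0 : ℝ) < 1 + l i ^ 2 := by positivity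
              exact_mod_cast this.ne'
            unfold wc
            push_cast
            field_simp
            linear_combination (-(1 + (l i : ℂ) ^ 2) - Complex.I * (l i : ℂ)) * Complex.I_sq
          rw [this, diagonal_one, Matrix.mul_one, h2']
  unfold Wc
  rw [key, ← Matrix.smul_mul, ← Matrix.mul_smul, ← diagonal_smul]
  congr 3
  funext i
  simp only [Pi.smul_apply, smul_eq_mul]
  rw [← mul_assoc]; simp

lemma gInv_apply {O : Matrix (Fin n) (Fin n) ℝ} {l : Fin n → ℝ} {x : EuclideanSpace ℝ (Fin n)}
    (h1 : Oᵀ * O = 1) (h2 : O * Oᵀ = 1) (hH : Hess u x = O * diagonal l * Oᵀ) (i j : Fin n) :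
    (gMat u x)⁻¹ i j = ∑ a, (1 + l a ^ 2)⁻¹ * (O i a * O j a) := by
  rw [gInv_eq h1 h2 hH, Matrix.mul_apply]
  refine sum_congr rfl fun a _ => ?_
  simp; ring

lemma Wc_apply {O : Matrix (Fin n) (Fin n) ℝ} {l : Fin n → ℝ} {x : EuclideanSpace ℝ (Fin n)}
    (h1 : Oᵀ * O = 1) (h2 : O * Oᵀ = 1) (hH : Hess u x = O * diagonal l * Oᵀ) (i j : Fin n) :
    Wc u x i j = ∑ a, wc (l a) * ((O i a * O j a : ℝ) : ℂ) := by
  rw [Wc_eq h1 h2 hH, Matrix.mul_apply]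
  refine sum_congr rfl fun a _ => ?_
  simp; ring

lemma wc_re (t : ℝ) : (wc t).re = t * (1 + t ^ 2)⁻¹ := by
  unfold wc; rw [Complex.re_mul_ofReal]; simp
lemma wc_im (t : ℝ) : (wc t).im = (1 + t ^ 2)⁻¹ := by
  unfold wc; rw [Complex.im_mul_ofReal]; simp

lemma Wc_im (hsym : ∀ x, (Hess u x).IsHermitian) (x : EuclideanSpace ℝ (Fin n)) (i j : Fin n) :
    (Wc u x i j).im = (gMat u x)⁻¹ i j := by
  obtain ⟨O, h1, h2, hH⟩ := spec (hsym x)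
  rw [Wc_apply h1 h2 hH, gInv_apply h1 h2 hH, Complex.im_sum]
  simp only [Complex.im_mul_ofReal, wc_im]

lemma trace_W {O : Matrix (Fin n) (Fin n) ℝ} {l : Fin n → ℝ} {x : EuclideanSpace ℝ (Fin n)}
    (h1 : Oᵀ * O = 1) (h2 : O * Oᵀ = 1) (hH : Hess u x = O * diagonal l * Oᵀ) (k : Fin n) :
    (Wc u x * cx (Tk u k x)).trace = ∑ a, wc (l a) * (S2 u O x k a a : ℂ) := by
  rw [Wc_eq h1 h2 hH]
  rw [Matrix.mul_assoc, Matrix.trace_mul_comm]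
  have : cx Oᵀ * cx (Tk u k x) * (cx O * diagonal (fun i => wc (l i)))
      = cx (Oᵀ * Tk u k x * O) * diagonal (fun i => wc (l i)) := by
    simp only [cx_mul, Matrix.mul_assoc]
  rw [this, Matrix.trace]
  refine sum_congr rfl fun a _ => ?_
  simp only [diag_apply, mul_diagonal, Matrix.map_apply, S2]; ring

lemma trace_WW (hu : ContDiff ℝ ∞ u)
    {O : Matrix (Fin n) (Fin n) ℝ} {l : Fin n → ℝ} {x : EuclideanSpace ℝ (Fin n)}
    (h1 : Oᵀ * O = 1) (h2 : O * Oᵀ = 1) (hH : Hess u x = O * diagonal l * Oᵀ) (k m : Fin n) :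
    (Wc u x * cx (Tk u m x) * Wc u x * cx (Tk u k x)).trace =
      ∑ a, ∑ b, wc (l a) * wc (l b) * ((S2 u O x m a b * S2 u O x k a b : ℝ) : ℂ) := by
  rw [Wc_eq h1 h2 hH]
  set D := diagonal (fun i => wc (l i))
  have : cx O * D * cx Oᵀ * cx (Tk u m x) * (cx O * D * cx Oᵀ) * cx (Tk u k x)
      = cx O * (D * cx (Oᵀ * Tk u m x * O) * D * (cx Oᵀ * cx (Tk u k x))) := by
    simp only [cx_mul, Matrix.mul_assoc]
  rw [this, Matrix.trace_mul_comm]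
  have : D * cx (Oᵀ * Tk u m x * O) * D * (cx Oᵀ * cx (Tk u k x)) * cx O
      = (D * cx (Oᵀ * Tk u m x * O)) * (D * cx (Oᵀ * Tk u k x * O)) := by
    simp only [cx_mul, Matrix.mul_assoc]
  rw [this, Matrix.trace]
  refine sum_congr rfl fun a _ => ?_
  rw [diag_apply, Matrix.mul_apply]
  refine sum_congr rfl fun b _ => ?_
  simp only [D, diagonal_mul, Matrix.map_apply]
  have hs : (Oᵀ * Tk u k x * O) b a = S2 u O x k a b := by
    unfold S2
    have ht : (Tk u k x)ᵀ = Tk u k x := by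
      ext i j; rw [Matrix.transpose_apply, Tk_symm12 hu]
    have : (Oᵀ * Tk u k x * O)ᵀ = Oᵀ * Tk u k x * O := by
      simp only [Matrix.transpose_mul, Matrix.transpose_transpose, ht, Matrix.mul_assoc]
    conv_rhs => rw [← this]
    rfl
  rw [hs]
  change _ * ((S2 u O x m a b : ℝ) : ℂ) * _ = _
  push_cast; ring

/-- minimality: trace of third derivatives vanishes -/
lemma gtrace_zero (hu : ContDiff ℝ ∞ u) (hsym : ∀ x, (Hess u x).IsHermitian) {c : ℝ}
    (hsol : ∀ x, ∑ i, Real.arctan ((hsym x).eigenvalues i) = c) (x : EuclideanSpace ℝ (Fin n))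
    (k : Fin n) : ∑ i, ∑ j, (gMat u x)⁻¹ i j * Tk u k x i j = 0 := by
  have h := congrArg Complex.im (pd_bV hu hsym hsol x k)
  simp only [Complex.ofReal_im, Matrix.trace, diag_apply, Matrix.mul_apply, Complex.im_sum,
    Matrix.map_apply, Complex.im_mul_ofReal, Wc_im hsym] at h
  rw [h]
  refine sum_congr rfl fun i _ => sum_congr rfl fun j _ => ?_
  rw [Tk_symm12 hu]

lemma pd_bV_real (hu : ContDiff ℝ ∞ u) (hsym : ∀ x, (Hess u x).IsHermitian) {c : ℝ}
    (hsol : ∀ x, ∑ i, Real.arctan ((hsym x).eigenvalues i) = c) {x : EuclideanSpace ℝ (Fin n)}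
    {O : Matrix (Fin n) (Fin n) ℝ} {l : Fin n → ℝ}
    (h1 : Oᵀ * O = 1) (h2 : O * Oᵀ = 1) (hH : Hess u x = O * diagonal l * Oᵀ)
    (k : Fin n) : pd k (bV u) x = ∑ a, l a * (1 + l a ^ 2)⁻¹ * S2 u O x k a a := by
  have h := congrArg Complex.re (pd_bV hu hsym hsol x k)
  rw [trace_W h1 h2 hH, Complex.ofReal_re, Complex.re_sum] at h
  simpa only [Complex.re_mul_ofReal, wc_re] using h

lemma pd4_comm (hu : ContDiff ℝ ∞ u) (i j k l : Fin n) :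
    pd l (pd k (pd j (pd i u))) = pd j (pd i (pd l (pd k u))) := by
  rw [pd_comm (pd_smooth i hu) k j, pd_comm (pd_smooth k (pd_smooth i hu)) l j,
    pd_comm hu k i, pd_comm (pd_smooth k hu) l i]

/-- generic contraction -/
lemma contract {O : Matrix (Fin n) (Fin n) ℝ} (d : Fin n → ℝ) (τ : Fin n → Fin n → ℝ) :
    ∑ i, ∑ j, (∑ a, d a * (O i a * O j a)) * τ i j =
      ∑ a, d a * ∑ i, ∑ j, O i a * O j a * τ i j := by
  simp only [sum_mul, mul_sum]
  conv_lhs => enter [2, i]; rw [sum_comm]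
  rw [sum_comm]
  refine sum_congr rfl fun a _ => sum_congr rfl fun i _ => sum_congr rfl fun j _ => ?_
  ring

lemma contract_S (O : Matrix (Fin n) (Fin n) ℝ) (x : EuclideanSpace ℝ (Fin n))
    (q : Fin n → Fin n → ℝ) (c : Fin n) :
    ∑ i, ∑ j, O i c * O j c * (∑ a, ∑ b, q a b * (S2 u O x j a b * S2 u O x i a b)) =
      ∑ a, ∑ b, q a b * T3 u O x a b c ^ 2 := by
  have : ∀ a b, q a b * T3 u O x a b c ^ 2 =
      ∑ i, ∑ j, O i c * O j c * (q a b * (S2 u O x j a b * S2 u O x i a b)) := by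
    intro a b
    unfold T3
    rw [sq, sum_mul_sum, mul_sum]
    refine sum_congr rfl fun i _ => ?_
    rw [mul_sum]
    refine sum_congr rfl fun j _ => ?_
    ring
  simp_rw [this, mul_sum]
  conv_lhs => enter [2, i]; rw [sum_comm]
  rw [sum_comm]
  refine sum_congr rfl fun a _ => ?_
  conv_rhs => rw [sum_comm]
  refine sum_congr rfl fun i _ => ?_
  rw [sum_comm]

lemma lapg_pd {v : EuclideanSpace ℝ (Fin n) → ℝ} (hv : ContDiff ℝ ∞ v)
    (x : EuclideanSpace ℝ (Fin n)) :
    lapg u v x = ∑ i, ∑ j, (gMat u x)⁻¹ i j * pd i (pd j v) x := by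
  unfold lapg
  simp only [iter2_eq hv]

lemma lap_formula0 (hu : ContDiff ℝ ∞ u) (hsym : ∀ x, (Hess u x).IsHermitian) {c : ℝ}
    (hsol : ∀ x, ∑ i, Real.arctan ((hsym x).eigenvalues i) = c) {x : EuclideanSpace ℝ (Fin n)}
    {O : Matrix (Fin n) (Fin n) ℝ} {l : Fin n → ℝ}
    (h1 : Oᵀ * O = 1) (h2 : O * Oᵀ = 1) (hH : Hess u x = O * diagonal l * Oᵀ) :
    lapg u (bV u) x = ∑ c, ∑ a, ∑ b, (1 + l c * l a + l c * l b - l a * l b) *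
      ((1 + l a ^ 2)⁻¹ * (1 + l b ^ 2)⁻¹ * (1 + l c ^ 2)⁻¹ * T3 u O x a b c ^ 2) := by
  rw [lapg_pd (bV_smooth hu hsym)]
  have hre : ∀ k m, pd m (pd k (bV u)) x = ∑ i, ∑ j, (∑ c, l c * (1 + l c ^ 2)⁻¹ * (O i c * O j c))
      * pd m (pd k (pd j (pd i u))) x
      - ∑ a, ∑ b, (wc (l a) * wc (l b)).re * (S2 u O x m a b * S2 u O x k a b) := by
    intro k m
    have h := congrArg Complex.re (pd2_bV hu hsym hsol x k m)
    rw [trace_WW hu h1 h2 hH, Complex.ofReal_re, Complex.sub_re] at h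
    simp only [Complex.re_sum, Complex.re_mul_ofReal, Wc_apply h1 h2 hH, wc_re] at h
    exact h
  have him : ∀ k m, ∑ i, ∑ j, (gMat u x)⁻¹ i j * pd m (pd k (pd j (pd i u))) x
      = ∑ a, ∑ b, (wc (l a) * wc (l b)).im * (S2 u O x m a b * S2 u O x k a b) := by
    intro k m
    have h := congrArg Complex.im (pd2_bV hu hsym hsol x k m)
    rw [trace_WW hu h1 h2 hH, Complex.ofReal_im, Complex.sub_im] at h
    simp only [Complex.im_sum, Complex.im_mul_ofReal, Wc_im hsym] at h
    linarith
  have e1 : ∑ m, ∑ k, (gMat u x)⁻¹ m k * pd m (pd k (bV u)) x =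
      ∑ i, ∑ j, (∑ c, l c * (1 + l c ^ 2)⁻¹ * (O i c * O j c)) *
        (∑ a, ∑ b, (wc (l a) * wc (l b)).im * (S2 u O x j a b * S2 u O x i a b))
      - ∑ i, ∑ j, (∑ c, (1 + l c ^ 2)⁻¹ * (O i c * O j c)) *
        (∑ a, ∑ b, (wc (l a) * wc (l b)).re * (S2 u O x j a b * S2 u O x i a b)) := by
    have e2 : ∀ i j, (∑ a, ∑ b, (wc (l a) * wc (l b)).re * (S2 u O x j a b * S2 u O x i a b))
      = ∑ a, ∑ b, (wc (l a) * wc (l b)).re * (S2 u O x i a b * S2 u O x j a b) := by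
      intro i j
      refine sum_congr rfl fun a _ => sum_congr rfl fun b _ => ?_
      ring
    have e3 : ∑ i, ∑ j, (∑ c, (1 + l c ^ 2)⁻¹ * (O i c * O j c)) *
        (∑ a, ∑ b, (wc (l a) * wc (l b)).re * (S2 u O x j a b * S2 u O x i a b)) =
        ∑ i, ∑ j, (∑ c, (1 + l c ^ 2)⁻¹ * (O i c * O j c)) *
        (∑ a, ∑ b, (wc (l a) * wc (l b)).re * (S2 u O x i a b * S2 u O x j a b)) :=
      sum_congr rfl fun i _ => sum_congr rfl fun j _ => by rw [e2 i j]
    rw [e3]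
    simp_rw [← him, hre, ← gInv_apply h1 h2 hH, mul_sub, sum_sub_distrib]
    congr 1
    simp_rw [mul_sum]
    calc _ = ∑ i, ∑ m, ∑ k, ∑ j, (gMat u x)⁻¹ m k * ((∑ c, l c * (1 + l c ^ 2)⁻¹ * (O i c * O j c)) *
              pd m (pd k (pd j (pd i u))) x) := by
            conv_lhs => enter [2, m]; rw [sum_comm]
            rw [sum_comm]
      _ = ∑ i, ∑ j, ∑ m, ∑ k, (gMat u x)⁻¹ m k * ((∑ c, l c * (1 + l c ^ 2)⁻¹ * (O i c * O j c)) *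
              pd m (pd k (pd j (pd i u))) x) := by
            refine sum_congr rfl fun i _ => ?_
            conv_lhs => enter [2, m]; rw [sum_comm]
            rw [sum_comm]
      _ = _ := by
            refine sum_congr rfl fun i _ => sum_congr rfl fun j _ => ?_
            refine sum_congr rfl fun m _ => sum_congr rfl fun k _ => ?_
            rw [pd4_comm hu, pd_comm hu m k]
            ring
  rw [e1, contract (O := O), contract (O := O)]
  rw [← sum_sub_distrib]
  have k1 := contract_S (u := u) O x (fun a b => (wc (l a) * wc (l b)).im)
  have k2 := contract_S (u := u) O x (fun a b => (wc (l a) * wc (l b)).re)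
  simp only [k1, k2]
  simp only [mul_sum, ← sum_sub_distrib]
  refine sum_congr rfl fun c _ => sum_congr rfl fun a _ => sum_congr rfl fun b _ => ?_
  rw [Complex.mul_re, Complex.mul_im, wc_re, wc_re, wc_im, wc_im]
  ring

lemma lap_formula (hu : ContDiff ℝ ∞ u) (hsym : ∀ x, (Hess u x).IsHermitian) {c : ℝ}
    (hsol : ∀ x, ∑ i, Real.arctan ((hsym x).eigenvalues i) = c) {x : EuclideanSpace ℝ (Fin n)}
    {O : Matrix (Fin n) (Fin n) ℝ} {l : Fin n → ℝ}
    (h1 : Oᵀ * O = 1) (h2 : O * Oᵀ = 1) (hH : Hess u x = O * diagonal l * Oᵀ) :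
    3 * lapg u (bV u) x = ∑ c, ∑ a, ∑ b, (3 + l a * l b + l b * l c + l c * l a) *
      ((1 + l a ^ 2)⁻¹ * (1 + l b ^ 2)⁻¹ * (1 + l c ^ 2)⁻¹ * T3 u O x a b c ^ 2) := by
  rw [lap_formula0 hu hsym hsol h1 h2 hH]
  set X : Fin n → Fin n → Fin n → ℝ := fun a b c =>
    ((1 + l a ^ 2)⁻¹ * (1 + l b ^ 2)⁻¹ * (1 + l c ^ 2)⁻¹ * T3 u O x a b c ^ 2) with hX
  have s12 : ∀ a b c, X a b c = X b a c := by
    intro a b c; simp only [hX]; rw [T3_symm12 hu]; ring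
  have s13 : ∀ a b c, X a b c = X c b a := by
    intro a b c; simp only [hX]; rw [T3_symm13 hu]; ring
  have A : ∑ c, ∑ a, ∑ b, l c * l a * X a b c = ∑ c, ∑ a, ∑ b, l c * l b * X a b c := by
    refine sum_congr rfl fun c _ => ?_
    rw [sum_comm]
    refine sum_congr rfl fun a _ => sum_congr rfl fun b _ => ?_
    rw [s12]
  have B : ∑ c, ∑ a, ∑ b, l a * l b * X a b c = ∑ c, ∑ a, ∑ b, l c * l b * X a b c := by
    rw [sum_comm]
    refine sum_congr rfl fun c _ => sum_congr rfl fun a _ => sum_congr rfl fun b _ => ?_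
    rw [s13]
  have L : ∑ c, ∑ a, ∑ b, (1 + l c * l a + l c * l b - l a * l b) * X a b c
      = ∑ c, ∑ a, ∑ b, X a b c + ∑ c, ∑ a, ∑ b, l c * l a * X a b c
        + ∑ c, ∑ a, ∑ b, l c * l b * X a b c - ∑ c, ∑ a, ∑ b, l a * l b * X a b c := by
    simp only [← sum_add_distrib, ← sum_sub_distrib]
    refine sum_congr rfl fun c _ => sum_congr rfl fun a _ => sum_congr rfl fun b _ => ?_
    ring
  have R : ∑ c, ∑ a, ∑ b, (3 + l a * l b + l b * l c + l c * l a) * X a b c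
      = 3 * ∑ c, ∑ a, ∑ b, X a b c + ∑ c, ∑ a, ∑ b, l c * l a * X a b c
        + ∑ c, ∑ a, ∑ b, l c * l b * X a b c + ∑ c, ∑ a, ∑ b, l a * l b * X a b c := by
    simp only [mul_sum, ← sum_add_distrib]
    refine sum_congr rfl fun c _ => sum_congr rfl fun a _ => sum_congr rfl fun b _ => ?_
    ring
  rw [L, R]; linarith

lemma grad_formula (hu : ContDiff ℝ ∞ u) (hsym : ∀ x, (Hess u x).IsHermitian) {c : ℝ}
    (hsol : ∀ x, ∑ i, Real.arctan ((hsym x).eigenvalues i) = c) {x : EuclideanSpace ℝ (Fin n)}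
    {O : Matrix (Fin n) (Fin n) ℝ} {l : Fin n → ℝ}
    (h1 : Oᵀ * O = 1) (h2 : O * Oᵀ = 1) (hH : Hess u x = O * diagonal l * Oᵀ) :
    gradSq u (bV u) x = ∑ c, (1 + l c ^ 2)⁻¹ *
      (∑ a, l a * (1 + l a ^ 2)⁻¹ * T3 u O x a a c) ^ 2 := by
  have : gradSq u (bV u) x = ∑ i, ∑ j, (gMat u x)⁻¹ i j * (pd i (bV u) x * pd j (bV u) x) := by
    unfold gradSq pd
    simp only [mul_assoc]
  rw [this]
  simp_rw [gInv_apply h1 h2 hH, contract]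
  refine sum_congr rfl fun c _ => ?_
  congr 1
  have : ∑ a, l a * (1 + l a ^ 2)⁻¹ * T3 u O x a a c = ∑ k, O k c * pd k (bV u) x := by
    simp_rw [pd_bV_real hu hsym hsol h1 h2 hH, mul_sum]
    rw [sum_comm]
    refine sum_congr rfl fun a _ => ?_
    unfold T3
    rw [mul_sum]
    refine sum_congr rfl fun k _ => ?_
    ring
  rw [this, sq, sum_mul_sum]
  refine sum_congr rfl fun i _ => sum_congr rfl fun j _ => ?_
  ring

end
end SLag3

end

section

open Matrix Finset
open scoped ContDiff

noncomputable section SLag4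

lemma triple_core {x y z : ℝ} (hy : 0 ≤ y) (hxy : y ≤ x) (hz : z ≤ 0)
    (h1 : 0 ≤ 3 + z ^ 2 + 2 * z * x) (h2 : 0 ≤ 3 + x ^ 2 + 2 * x * z) :
    0 ≤ 3 + x * y + y * z + z * x := by
  rcases le_total (-z) y with h | h
  · nlinarith [mul_nonneg (sub_nonneg.2 (h.trans hxy)) (sub_nonneg.2 h),
      mul_nonneg (neg_nonneg.2 hz) (sub_nonneg.2 (h.trans hxy))]
  · rcases le_total (-z) x with h' | h'
    · nlinarith [mul_nonneg hy (sub_nonneg.2 h'), mul_nonneg (neg_nonneg.2 hz) (sub_nonneg.2 h')]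
    · nlinarith [mul_nonneg (sub_nonneg.2 hxy) (sub_nonneg.2 h')]

lemma triple_core2 {x y z : ℝ} (hx : 0 ≤ x) (hy : 0 ≤ y)
    (h1 : 0 ≤ 3 + z ^ 2 + 2 * z * x) (h2 : 0 ≤ 3 + x ^ 2 + 2 * x * z)
    (h3 : 0 ≤ 3 + z ^ 2 + 2 * z * y) (h4 : 0 ≤ 3 + y ^ 2 + 2 * y * z) :
    0 ≤ 3 + x * y + y * z + z * x := by
  rcases le_total 0 z with hz | hz
  · positivity
  rcases le_total y x with h | h
  · exact triple_core hy h hz h1 h2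
  · have := triple_core hx h hz h3 h4
    linarith

lemma triple_core3 {x y z : ℝ} (hxy : 0 ≤ x * y)
    (h1 : 0 ≤ 3 + z ^ 2 + 2 * z * x) (h2 : 0 ≤ 3 + x ^ 2 + 2 * x * z)
    (h3 : 0 ≤ 3 + z ^ 2 + 2 * z * y) (h4 : 0 ≤ 3 + y ^ 2 + 2 * y * z) :
    0 ≤ 3 + x * y + y * z + z * x := by
  rcases mul_nonneg_iff.1 hxy with ⟨hx, hy⟩ | ⟨hx, hy⟩
  · exact triple_core2 hx hy h1 h2 h3 h4
  · have := triple_core2 (x := -x) (y := -y) (z := -z) (by linarith) (by linarith)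
      (by linarith) (by linarith) (by linarith) (by linarith)
    linarith

lemma triple {ι : Type*} {l : ι → ℝ} (h : ∀ i j, 0 ≤ 3 + l i ^ 2 + 2 * l i * l j) (a b c : ι) :
    0 ≤ 3 + l a * l b + l b * l c + l c * l a := by
  by_cases hab : 0 ≤ l a * l b
  · exact triple_core3 hab (h _ _) (h _ _) (h _ _) (h _ _)
  by_cases hbc : 0 ≤ l b * l c
  · have := triple_core3 hbc (h a b) (h _ _) (h a c) (h _ _)
    linarith
  have hca : 0 ≤ l c * l a := by
    by_contra hca
    push Not at *
    have h3 : (l a * l b) * (l b * l c) > 0 := mul_pos_of_neg_of_neg hab hbc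
    have := mul_neg_of_pos_of_neg h3 hca
    nlinarith [sq_nonneg (l a * l b * l c)]
  have := triple_core3 hca (h b c) (h _ _) (h b a) (h _ _)
  linarith

section
variable {n : ℕ} {u : EuclideanSpace ℝ (Fin n) → ℝ}

lemma case_small (hn : 2 ≤ n) (hu : ContDiff ℝ ∞ u) (hsym : ∀ x, (Hess u x).IsHermitian) {c : ℝ}
    (hsol : ∀ x, ∑ i, Real.arctan ((hsym x).eigenvalues i) = c)
    (ε : ℝ) (hε : 0 < ε) (hε1 : ε ≤ 1)
    (hcond : ∀ x, ∀ i j : Fin n,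
      0 ≤ 3 + (1 - ε) * ((hsym x).eigenvalues i) ^ 2 +
        2 * (hsym x).eigenvalues i * (hsym x).eigenvalues j) (x : EuclideanSpace ℝ (Fin n)) :
    (ε / n) * gradSq u (bV u) x ≤ lapg u (bV u) x := by
  obtain ⟨O, h1, h2, hH⟩ := spec (hsym x)
  have hL := lap_formula hu hsym hsol h1 h2 hH
  have hG := grad_formula hu hsym hsol h1 h2 hH
  have hc := hcond x
  set l := (hsym x).eigenvalues with hl
  have h0 : ∀ i j, 0 ≤ 3 + l i ^ 2 + 2 * l i * l j := fun i j => by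
    nlinarith [hc i j, mul_nonneg hε.le (sq_nonneg (l i))]
  have htr := triple h0
  set X : Fin n → Fin n → Fin n → ℝ := fun a b c =>
    ((1 + l a ^ 2)⁻¹ * (1 + l b ^ 2)⁻¹ * (1 + l c ^ 2)⁻¹ * T3 u O x a b c ^ 2) with hX
  have Xn : ∀ a b c, 0 ≤ X a b c := fun a b c => by simp only [hX]; positivity
  have s12 : ∀ a b c, X a b c = X b a c := by
    intro a b c; simp only [hX]; rw [T3_symm12 hu]; ring
  have s13 : ∀ a b c, X a b c = X c b a := by
    intro a b c; simp only [hX]; rw [T3_symm13 hu]; ring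
  have key : ∑ c, ∑ a, ∑ b, ((if a = b then ε * l a ^ 2 else 0) + (if b = c then ε * l b ^ 2 else 0)
      + (if c = a then ε * l c ^ 2 else 0)) * X a b c ≤ 3 * lapg u (bV u) x := by
    rw [hL]
    refine sum_le_sum fun c _ => sum_le_sum fun a _ => sum_le_sum fun b _ => ?_
    refine mul_le_mul_of_nonneg_right ?_ (Xn a b c)
    by_cases hab : a = b
    · subst hab
      by_cases hac : a = c
      · subst hac
        simp only [if_true]
        nlinarith [sq_nonneg (l a)]
      · rw [if_pos rfl, if_neg hac, if_neg (Ne.symm hac)]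
        nlinarith [hc a c]
    · rw [if_neg hab]
      by_cases hbc : b = c
      · subst hbc
        rw [if_pos rfl, if_neg (Ne.symm hab)]
        nlinarith [hc b a]
      · rw [if_neg hbc]
        by_cases hca : c = a
        · subst hca
          rw [if_pos rfl]
          nlinarith [hc c b]
        · rw [if_neg hca]
          linarith [htr a b c]
  have e0 : ∑ c, ∑ a, ∑ b, ((if a = b then ε * l a ^ 2 else 0) + (if b = c then ε * l b ^ 2 else 0)
      + (if c = a then ε * l c ^ 2 else 0)) * X a b c = 3 * (ε * ∑ c, ∑ a, l a ^ 2 * X a a c) := by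
    simp only [add_mul, sum_add_distrib, ite_mul, zero_mul]
    have A1 : ∑ c, ∑ a, ∑ b, (if a = b then ε * l a ^ 2 * X a b c else 0)
        = ε * ∑ c, ∑ a, l a ^ 2 * X a a c := by
      simp only [sum_ite_eq, mem_univ, if_true, mul_sum, mul_assoc]
    have A2 : ∑ c, ∑ a, ∑ b, (if b = c then ε * l b ^ 2 * X a b c else 0)
        = ε * ∑ c, ∑ a, l a ^ 2 * X a a c := by
      simp only [sum_ite_eq', mem_univ, if_true, mul_sum, mul_assoc]
      rw [sum_comm]
      refine sum_congr rfl fun a _ => sum_congr rfl fun b _ => ?_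
      rw [s13 a b b, s12]
    have A3 : ∑ c, ∑ a, ∑ b, (if c = a then ε * l c ^ 2 * X a b c else 0)
        = ε * ∑ c, ∑ a, l a ^ 2 * X a a c := by
      conv_lhs => enter [2, c]; rw [sum_comm]
      simp only [sum_ite_eq, mem_univ, if_true, mul_sum, mul_assoc]
      rw [sum_comm]
      refine sum_congr rfl fun a _ => sum_congr rfl fun b _ => ?_
      rw [s12 b a b, s13 a b b]
    rw [A1, A2, A3]; ring
  have hg : gradSq u (bV u) x ≤ n * ∑ c, ∑ a, l a ^ 2 * X a a c := by
    rw [hG, mul_sum]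
    refine sum_le_sum fun c _ => ?_
    have := sq_sum_le_card_mul_sum_sq (s := univ) (f := fun a => l a * (1 + l a ^ 2)⁻¹ * T3 u O x a a c)
    rw [card_univ, Fintype.card_fin] at this
    calc (1 + l c ^ 2)⁻¹ * (∑ a, l a * (1 + l a ^ 2)⁻¹ * T3 u O x a a c) ^ 2
        ≤ (1 + l c ^ 2)⁻¹ * ((n : ℝ) * ∑ a, (l a * (1 + l a ^ 2)⁻¹ * T3 u O x a a c) ^ 2) :=
          mul_le_mul_of_nonneg_left this (by positivity)
      _ = _ := by
        simp only [mul_sum, hX]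
        refine sum_congr rfl fun a _ => ?_
        ring
  have hn0 : (0 : ℝ) < n := by exact_mod_cast (by omega : 0 < n)
  calc (ε / n) * gradSq u (bV u) x ≤ (ε / n) * (n * ∑ c, ∑ a, l a ^ 2 * X a a c) :=
        mul_le_mul_of_nonneg_left hg (by positivity)
    _ = ε * ∑ c, ∑ a, l a ^ 2 * X a a c := by field_simp
    _ ≤ _ := by linarith

lemma orth_sq {O : Matrix (Fin n) (Fin n) ℝ} (h2 : O * Oᵀ = 1) (v : Fin n → ℝ) :
    ∑ a, (∑ i, O i a * v i) ^ 2 = ∑ i, v i ^ 2 := by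
  have h : ∀ i j, ∑ a, O i a * O j a = if i = j then 1 else 0 := by
    intro i j
    have := congrFun (congrFun h2 i) j
    simpa [Matrix.mul_apply, Matrix.one_apply] using this
  calc ∑ a, (∑ i, O i a * v i) ^ 2 = ∑ a, ∑ i, ∑ j, v i * v j * (O i a * O j a) := by
        refine sum_congr rfl fun a _ => ?_
        rw [sq, sum_mul_sum]
        refine sum_congr rfl fun i _ => sum_congr rfl fun j _ => ?_
        ring
    _ = ∑ i, ∑ j, v i * v j * ∑ a, (O i a * O j a) := by
        rw [sum_comm]
        refine sum_congr rfl fun i _ => ?_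
        rw [sum_comm]
        simp only [mul_sum]
    _ = _ := by
        simp only [h, mul_ite, mul_one, mul_zero, sum_ite_eq, mem_univ, if_true, sq]

/-- `|D³u|²` -/
def D3 (u : EuclideanSpace ℝ (Fin n) → ℝ) (x : EuclideanSpace ℝ (Fin n)) : ℝ :=
  ∑ k, ∑ i, ∑ j, Tk u k x i j ^ 2

lemma D3_eq {O : Matrix (Fin n) (Fin n) ℝ} (h2 : O * Oᵀ = 1) (x : EuclideanSpace ℝ (Fin n)) :
    ∑ c, ∑ a, ∑ b, T3 u O x a b c ^ 2 = D3 u x := by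
  have e : ∀ a b c, T3 u O x a b c = ∑ k, O k c * ∑ i, O i a * ∑ j, O j b * Tk u k x i j := by
    intro a b c
    rw [T3_expand]
    simp only [mul_sum]
    refine sum_congr rfl fun k _ => sum_congr rfl fun i _ => sum_congr rfl fun j _ => ?_
    ring
  unfold D3
  simp only [e]
  calc _ = ∑ a, ∑ b, ∑ c, (∑ k, O k c * ∑ i, O i a * ∑ j, O j b * Tk u k x i j) ^ 2 := by
        rw [sum_comm]
        refine sum_congr rfl fun a _ => ?_
        rw [sum_comm]
    _ = ∑ k, ∑ b, ∑ a, (∑ i, O i a * ∑ j, O j b * Tk u k x i j) ^ 2 := by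
        simp only [orth_sq h2]
        rw [sum_comm]
        conv_lhs => enter [2, b]; rw [sum_comm]
        rw [sum_comm]
        simp only [orth_sq h2]
    _ = ∑ k, ∑ i, ∑ b, (∑ j, O j b * Tk u k x i j) ^ 2 := by
        simp only [orth_sq h2]
        refine sum_congr rfl fun k _ => ?_
        rw [sum_comm]
        simp only [orth_sq h2]
    _ = _ := by
        simp only [orth_sq h2]

lemma prod_ge {ε x y : ℝ} (hε : 1 < ε) (h1 : 0 ≤ 3 + (1 - ε) * x ^ 2 + 2 * x * y)
    (h2 : 0 ≤ 3 + (1 - ε) * y ^ 2 + 2 * y * x) : -(3 / (ε + 1)) ≤ x * y := by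
  rw [← neg_div, div_le_iff₀ (by linarith)]
  nlinarith [mul_nonneg (sub_nonneg.2 hε.le) (sq_nonneg (x + y))]

lemma triple_ge {ι : Type*} {ε : ℝ} (hε : 1 < ε) {l : ι → ℝ}
    (h : ∀ i j, 0 ≤ 3 + (1 - ε) * l i ^ 2 + 2 * l i * l j) (a b c : ι) :
    3 * (ε - 1) / (ε + 1) ≤ 3 + l a * l b + l b * l c + l c * l a := by
  have p := fun i j => prod_ge hε (h i j) (h j i)
  have e : 3 * (ε - 1) / (ε + 1) = 3 - 2 * (3 / (ε + 1)) := by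
    have : ε + 1 ≠ 0 := by linarith
    field_simp; ring
  rw [e]
  have := p a b; have := p b c; have := p c a
  by_cases hab : 0 ≤ l a * l b
  · linarith
  by_cases hbc : 0 ≤ l b * l c
  · linarith
  have hca : 0 ≤ l c * l a := by
    by_contra hca
    push Not at *
    have h3 : (l a * l b) * (l b * l c) > 0 := mul_pos_of_neg_of_neg hab hbc
    have := mul_neg_of_pos_of_neg h3 hca
    nlinarith [sq_nonneg (l a * l b * l c)]
  linarith

lemma lap_ge (hu : ContDiff ℝ ∞ u) (hsym : ∀ x, (Hess u x).IsHermitian) {c : ℝ}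
    (hsol : ∀ x, ∑ i, Real.arctan ((hsym x).eigenvalues i) = c)
    {ε : ℝ} (hε : 1 < ε)
    (hcond : ∀ x, ∀ i j : Fin n,
      0 ≤ 3 + (1 - ε) * ((hsym x).eigenvalues i) ^ 2 +
        2 * (hsym x).eigenvalues i * (hsym x).eigenvalues j)
    {L : ℝ} (hL : ∀ x i, ((hsym x).eigenvalues i) ^ 2 ≤ L) :
    ∃ c0 > 0, ∀ x, c0 * D3 u x ≤ lapg u (bV u) x := by
  set M : ℝ := 1 + |L| with hM
  have hM1 : 0 < M := by positivity
  refine ⟨(3 * (ε - 1) / (ε + 1)) / 3 * (M⁻¹ * M⁻¹ * M⁻¹),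
    mul_pos (div_pos (div_pos (by linarith) (by linarith)) (by norm_num)) (by positivity),
    fun x => ?_⟩
  obtain ⟨O, h1, h2, hH⟩ := spec (hsym x)
  have hLap := lap_formula hu hsym hsol h1 h2 hH
  have htr := triple_ge hε (hcond x)
  have hLx := hL x
  set l := (hsym x).eigenvalues with hl
  have hg : ∀ i, 1 + l i ^ 2 ≤ M := fun i => by
    have := hLx i
    have := le_abs_self L
    linarith
  have hpos : 0 < 3 * (ε - 1) / (ε + 1) := div_pos (by linarith) (by linarith)
  have key : (3 * (ε - 1) / (ε + 1)) * (M⁻¹ * M⁻¹ * M⁻¹) * D3 u x ≤ 3 * lapg u (bV u) x := by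
    rw [hLap, ← D3_eq h2]
    simp only [mul_sum]
    refine sum_le_sum fun c _ => sum_le_sum fun a _ => sum_le_sum fun b _ => ?_
    rw [mul_assoc]
    have hMi : 0 ≤ M⁻¹ := by positivity
    have i1 : 0 ≤ (1 + l a ^ 2)⁻¹ := by positivity
    have i2 : 0 ≤ (1 + l b ^ 2)⁻¹ := by positivity
    gcongr
    · exact hpos.le.trans (htr a b c)
    · exact htr a b c
    · exact hg a
    · exact hg b
    · exact hg c
  linarith

end
end SLag4

end

section

open Matrix Finset MeasureTheory
open scoped ContDiff

noncomputable section SLag5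

section
variable {n : ℕ} {u : EuclideanSpace ℝ (Fin n) → ℝ}

lemma hess_bound (hn : 2 ≤ n) (hsym : ∀ x, (Hess u x).IsHermitian) {c : ℝ}
    (hsol : ∀ x, ∑ i, Real.arctan ((hsym x).eigenvalues i) = c)
    {ε : ℝ} (hε : 1 < ε)
    (hcond : ∀ x, ∀ i j : Fin n,
      0 ≤ 3 + (1 - ε) * ((hsym x).eigenvalues i) ^ 2 +
        2 * (hsym x).eigenvalues i * (hsym x).eigenvalues j) :
    ∃ L, ∀ x i, ((hsym x).eigenvalues i) ^ 2 ≤ L := by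
  have hn0 : (0 : ℝ) < n := by exact_mod_cast (by omega : 0 < n)
  have : Nonempty (Fin n) := ⟨⟨0, by omega⟩⟩
  have hc1 : |c| < n * (Real.pi / 2) := by
    rw [← hsol 0, abs_lt]
    constructor
    · have : ∑ i : Fin n, (-(Real.pi / 2)) < ∑ i, Real.arctan ((hsym 0).eigenvalues i) :=
        sum_lt_sum_of_nonempty univ_nonempty fun i _ => Real.neg_pi_div_two_lt_arctan _
      simpa using this
    · have : ∑ i, Real.arctan ((hsym 0).eigenvalues i) < ∑ i : Fin n, (Real.pi / 2) :=
        sum_lt_sum_of_nonempty univ_nonempty fun i _ => Real.arctan_lt_pi_div_two _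
      simpa using this
  set m : ℝ := Real.tan (|c| / n) with hm
  have hm1 : |c| / n < Real.pi / 2 := by rw [div_lt_iff₀ hn0]; linarith
  have hm0 : 0 ≤ |c| / n := by positivity
  have ham : Real.arctan m = |c| / n := Real.arctan_tan (by linarith [Real.pi_pos]) hm1
  have hmn : 0 ≤ m := Real.tan_nonneg_of_nonneg_of_le_pi_div_two hm0 hm1.le
  set T : ℝ := max 1 ((2 * m + 3) / (ε - 1)) with hT
  have hT1 : 1 ≤ T := le_max_left _ _
  have hT2 : 2 * m + 3 ≤ (ε - 1) * T := by
    have : (2 * m + 3) / (ε - 1) ≤ T := le_max_right _ _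
    rw [div_le_iff₀ (by linarith)] at this
    linarith
  refine ⟨T ^ 2, fun x i => ?_⟩
  rw [sq_le_sq, abs_of_nonneg (by linarith : 0 ≤ T)]
  by_contra hlt
  push Not at hlt
  have hs := hsol x
  have hc := hcond x i
  set l := (hsym x).eigenvalues
  have hd : 0 < ε - 1 := by linarith
  rcases le_total 0 (l i) with h0 | h0
  · rw [abs_of_nonneg h0] at hlt
    have : ∀ j, m < l j := fun j => by
      by_contra hj
      push Not at hj
      have h1 := hc j
      have h2 : (2 * m + 3) < (ε - 1) * l i := lt_of_le_of_lt hT2 (by gcongr)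
      have h3 : l i * l j ≤ l i * m := by gcongr
      have h4 : l i * (2 * m + 3) < l i * ((ε - 1) * l i) := by gcongr; linarith
      nlinarith
    have h5 : ∑ j : Fin n, Real.arctan m < ∑ j, Real.arctan (l j) :=
      sum_lt_sum_of_nonempty univ_nonempty fun j _ => Real.arctan_strictMono (this j)
    rw [hs, ham] at h5
    simp only [sum_const, card_univ, Fintype.card_fin, nsmul_eq_mul] at h5
    rw [mul_div_cancel₀ _ hn0.ne'] at h5
    linarith [le_abs_self c]
  · rw [abs_of_nonpos h0] at hlt
    have : ∀ j, l j < - m := fun j => by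
      by_contra hj
      push Not at hj
      have h1 := hc j
      have h2 : (2 * m + 3) < (ε - 1) * (- l i) := lt_of_le_of_lt hT2 (by gcongr)
      have h3 : (-l i) * (-l j) ≤ (-l i) * m := by
        apply mul_le_mul_of_nonneg_left _ (by linarith); linarith
      have h4 : (-l i) * (2 * m + 3) < (-l i) * ((ε - 1) * (-l i)) := by gcongr; linarith
      nlinarith
    have h5 : ∑ j, Real.arctan (l j) < ∑ j : Fin n, Real.arctan (-m) :=
      sum_lt_sum_of_nonempty univ_nonempty fun j _ => Real.arctan_strictMono (this j)
    rw [hs, Real.arctan_neg, ham] at h5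
    simp only [sum_const, card_univ, Fintype.card_fin, nsmul_eq_mul, mul_neg] at h5
    rw [mul_div_cancel₀ _ hn0.ne'] at h5
    linarith [neg_abs_le c]

/-- `V g^{ij}` -/
def AA (u : EuclideanSpace ℝ (Fin n) → ℝ) (i j : Fin n) (x : EuclideanSpace ℝ (Fin n)) : ℝ :=
  Vol u x * (gMat u x)⁻¹ i j

lemma gInv_smooth (hu : ContDiff ℝ ∞ u) (hsym : ∀ x, (Hess u x).IsHermitian) (i j : Fin n) :
    ContDiff ℝ ∞ (fun x => (gMat u x)⁻¹ i j) := by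
  have : (fun x => (gMat u x)⁻¹ i j) = fun x => (Wc u x i j).im := by
    funext x; exact (Wc_im hsym x i j).symm
  rw [this]
  exact Complex.imCLM.contDiff.comp (Wc_smooth hu hsym i j)

lemma AA_smooth (hu : ContDiff ℝ ∞ u) (hsym : ∀ x, (Hess u x).IsHermitian) (i j : Fin n) :
    ContDiff ℝ ∞ (AA u i j) := (Vol_smooth hu hsym).mul (gInv_smooth hu hsym i j)

lemma gInv_symm (hsym : ∀ x, (Hess u x).IsHermitian) (x : EuclideanSpace ℝ (Fin n)) (i j : Fin n) :
    (gMat u x)⁻¹ i j = (gMat u x)⁻¹ j i := by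
  obtain ⟨O, h1, h2, hH⟩ := spec (hsym x)
  rw [gInv_apply h1 h2 hH, gInv_apply h1 h2 hH]
  refine sum_congr rfl fun a _ => ?_
  ring

lemma AA_symm (hsym : ∀ x, (Hess u x).IsHermitian) (x : EuclideanSpace ℝ (Fin n)) (i j : Fin n) :
    AA u i j x = AA u j i x := by
  unfold AA; rw [gInv_symm hsym]

lemma pd_Vol (hu : ContDiff ℝ ∞ u) (hsym : ∀ x, (Hess u x).IsHermitian)
    (x : EuclideanSpace ℝ (Fin n)) (k : Fin n) :
    HasDerivAt (fun t : ℝ => Vol u (x + t • EuclideanSpace.single k 1)) (Vol u x * pd k (bV u) x) 0 := by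
  have h := (pd_line' (bV_smooth hu hsym) x k).exp
  have e : ∀ y, Real.exp (bV u y) = Vol u y := fun y => by
    unfold bV; rw [Real.exp_log]; linarith [Vol_ge hsym y]
  simpa only [e, zero_smul, add_zero] using h

lemma div_free (hu : ContDiff ℝ ∞ u) (hsym : ∀ x, (Hess u x).IsHermitian) {c : ℝ}
    (hsol : ∀ x, ∑ i, Real.arctan ((hsym x).eigenvalues i) = c)
    (x : EuclideanSpace ℝ (Fin n)) (j : Fin n) : ∑ i, pd i (AA u i j) x = 0 := by
  have h : ∀ i, pd i (AA u i j) x = (Vol u x * ((Wc u x * cx (Tk u i x)).trace * Wc u x i j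
      - (Wc u x * cx (Tk u i x) * Wc u x) i j)).im := by
    intro i
    have hW := (Complex.imCLM.hasFDerivAt.comp_hasDerivAt (0 : ℝ) (Wc_line hu hsym x i i j))
    have hW2 : HasDerivAt (fun t : ℝ => (gMat u (x + t • EuclideanSpace.single i 1))⁻¹ i j)
        (-(Wc u x * cx (Tk u i x) * Wc u x) i j).im 0 := by
      refine hW.congr_of_eventuallyEq (Filter.Eventually.of_forall fun t => ?_)
      exact (Wc_im hsym _ i j).symm
    have := (pd_Vol hu hsym x i).fun_mul hW2
    rw [pd_eq ((AA_smooth hu hsym i j).differentiable (by simp) x) this]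
    rw [← pd_bV hu hsym hsol x i]
    simp only [zero_smul, add_zero]
    rw [← Wc_im hsym]
    simp
    ring
  simp only [h]
  rw [← Complex.im_sum, ← mul_sum]
  have : ∑ i, ((Wc u x * cx (Tk u i x)).trace * Wc u x i j
      - (Wc u x * cx (Tk u i x) * Wc u x) i j) = 0 := by
    rw [sum_sub_distrib, sub_eq_zero]
    simp only [Matrix.trace, Matrix.diag_apply, Matrix.mul_apply, sum_mul, Matrix.map_apply]
    calc _ = ∑ b, ∑ a, ∑ i, Wc u x i a * (Tk u b x a i : ℂ) * Wc u x b j := by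
          refine sum_congr rfl fun b _ => ?_
          rw [sum_comm]
      _ = ∑ i, ∑ b, ∑ a, Wc u x i a * (Tk u b x a i : ℂ) * Wc u x b j := by
          conv_lhs => enter [2, b]; rw [sum_comm]
          rw [sum_comm]
      _ = _ := by
          refine sum_congr rfl fun i _ => sum_congr rfl fun b _ => sum_congr rfl fun a _ => ?_
          rw [Tk_symm12 hu, Tk_symm13 hu, Tk_symm12 hu]
  rw [this]; simp

lemma pd_mul {f g : EuclideanSpace ℝ (Fin n) → ℝ} {x : EuclideanSpace ℝ (Fin n)}
    (hf : DifferentiableAt ℝ f x) (hg : DifferentiableAt ℝ g x) (i : Fin n) :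
    pd i (fun y => f y * g y) x = pd i f x * g x + f x * pd i g x := by
  have := (pd_line hf i).fun_mul (pd_line hg i)
  rw [pd_eq (hf.fun_mul hg) this]; simp

lemma pd_cont {f : EuclideanSpace ℝ (Fin n) → ℝ} (hf : ContDiff ℝ 1 f) (i : Fin n) :
    Continuous (pd i f) := (hf.continuous_fderiv (by simp)).clm_apply continuous_const

lemma pd_C1 {f : EuclideanSpace ℝ (Fin n) → ℝ} (hf : ContDiff ℝ 2 f) (i : Fin n) :
    ContDiff ℝ 1 (pd i f) := (hf.fderiv_right (m := 1) (by norm_num)).clm_apply contDiff_const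

lemma pd_supp {f : EuclideanSpace ℝ (Fin n) → ℝ} (hf : HasCompactSupport f) (i : Fin n) :
    HasCompactSupport (pd i f) := hf.fderiv_apply ℝ _

lemma ibp {p q : EuclideanSpace ℝ (Fin n) → ℝ} (hp : ContDiff ℝ 1 p) (hq : ContDiff ℝ 1 q)
    (hs : HasCompactSupport p ∨ HasCompactSupport q) (i : Fin n) :
    ∫ x, p x * pd i q x = -∫ x, pd i p x * q x := by
  have hintegr : ∀ {a b : EuclideanSpace ℝ (Fin n) → ℝ}, Continuous a → Continuous b →
      (HasCompactSupport a ∨ HasCompactSupport b) → Integrable (fun x => a x * b x) := by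
    intro a b ha hb h
    apply (ha.mul hb).integrable_of_hasCompactSupport
    rcases h with h | h
    · exact h.mul_right
    · exact h.mul_left
  apply integral_mul_fderiv_eq_neg_fderiv_mul_of_integrable
  · exact hintegr (pd_cont hp i) hq.continuous (hs.imp (fun h => pd_supp h i) id)
  · exact hintegr hp.continuous (pd_cont hq i) (hs.imp id (fun h => pd_supp h i))
  · exact hintegr hp.continuous hq.continuous hs
  · exact fun x _ => hp.differentiable (by norm_num) x
  · exact fun x _ => hq.differentiable (by norm_num) x

lemma int_cs {a : EuclideanSpace ℝ (Fin n) → ℝ} (ha : Continuous a) (h : HasCompactSupport a) :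
   Integrable a := ha.integrable_of_hasCompactSupport h

lemma weak_form (hu : ContDiff ℝ ∞ u) (hsym : ∀ x, (Hess u x).IsHermitian) {c : ℝ}
    (hsol : ∀ x, ∑ i, Real.arctan ((hsym x).eigenvalues i) = c)
    {p q : EuclideanSpace ℝ (Fin n) → ℝ} (hp : ContDiff ℝ 1 p) (hq : ContDiff ℝ 2 q)
    (hs : HasCompactSupport p ∨ HasCompactSupport q) :
    ∫ x, p x * ∑ i, ∑ j, AA u i j x * pd i (pd j q) x =
      - ∫ x, ∑ i, ∑ j, AA u i j x * pd i p x * pd j q x := by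
  have hA1 : ∀ i j, ContDiff ℝ 1 (AA u i j) := fun i j =>
    (AA_smooth hu hsym i j).of_le (by norm_cast)
  have hq1 : ContDiff ℝ 1 q := hq.of_le (by norm_num)
  have hAp : ∀ i j, ContDiff ℝ 1 (fun x => AA u i j x * p x) := fun i j => (hA1 i j).mul hp
  have hs1 : ∀ i j, HasCompactSupport (fun x => AA u i j x * p x) ∨ HasCompactSupport (pd j q) :=
    fun i j => hs.imp (fun h => h.mul_left) (fun h => pd_supp h j)
  have hintegr : ∀ {a b : EuclideanSpace ℝ (Fin n) → ℝ}, Continuous a → Continuous b →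
      (HasCompactSupport a ∨ HasCompactSupport b) → Integrable (fun x => a x * b x) := by
    intro a b ha hb h
    apply (ha.mul hb).integrable_of_hasCompactSupport
    rcases h with h | h
    · exact h.mul_right
    · exact h.mul_left
  have key : ∀ i j, ∫ x, (AA u i j x * p x) * pd i (pd j q) x =
      - ∫ x, pd i (fun x => AA u i j x * p x) x * pd j q x := fun i j =>
    ibp (hAp i j) (pd_C1 hq j) (hs1 i j) i
  calc ∫ x, p x * ∑ i, ∑ j, AA u i j x * pd i (pd j q) x
      = ∫ x, ∑ i, ∑ j, (AA u i j x * p x) * pd i (pd j q) x := by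
        congr 1; funext x
        simp only [mul_sum]
        refine sum_congr rfl fun i _ => sum_congr rfl fun j _ => ?_
        ring
    _ = ∑ i, ∑ j, ∫ x, (AA u i j x * p x) * pd i (pd j q) x := by
        have hi : ∀ i j, Integrable (fun x => (AA u i j x * p x) * pd i (pd j q) x) := fun i j =>
          hintegr (hAp i j).continuous (pd_cont (pd_C1 hq j) i)
            ((hs1 i j).imp id (fun h => pd_supp h i))
        rw [integral_finsetSum _ fun i _ => integrable_finsetSum _ fun j _ => hi i j]
        refine sum_congr rfl fun i _ => ?_
        rw [integral_finsetSum _ fun j _ => hi i j]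
    _ = ∑ i, ∑ j, - ∫ x, pd i (fun x => AA u i j x * p x) x * pd j q x := by
        simp only [key]
    _ = - ∫ x, ∑ i, ∑ j, pd i (fun x => AA u i j x * p x) x * pd j q x := by
        have hi : ∀ i j, Integrable (fun x => pd i (fun x => AA u i j x * p x) x * pd j q x) :=
          fun i j => hintegr (pd_cont (hAp i j) i) (pd_cont hq1 j)
            ((hs1 i j).imp (fun h => pd_supp h i) id)
        rw [integral_finsetSum _ fun i _ => integrable_finsetSum _ fun j _ => hi i j]
        simp only [sum_neg_distrib]
        congr 1
        refine sum_congr rfl fun i _ => ?_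
        rw [integral_finsetSum _ fun j _ => hi i j]
    _ = _ := by
        congr 2; funext x
        have e : ∀ i j, pd i (fun x => AA u i j x * p x) x * pd j q x =
            pd i (AA u i j) x * (p x * pd j q x) + AA u i j x * pd i p x * pd j q x := by
          intro i j
          rw [pd_mul ((hA1 i j).differentiable (by norm_num) x) (hp.differentiable (by norm_num) x)]
          ring
        simp only [e, sum_add_distrib]
        rw [sum_comm]
        simp only [← sum_mul, div_free hu hsym hsol, zero_mul, sum_const_zero, zero_add]

lemma green (hu : ContDiff ℝ ∞ u) (hsym : ∀ x, (Hess u x).IsHermitian) {c : ℝ}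
    (hsol : ∀ x, ∑ i, Real.arctan ((hsym x).eigenvalues i) = c)
    {p q : EuclideanSpace ℝ (Fin n) → ℝ} (hp : ContDiff ℝ 2 p) (hq : ContDiff ℝ 2 q)
    (hs : HasCompactSupport p) :
    ∫ x, p x * ∑ i, ∑ j, AA u i j x * pd i (pd j q) x =
      ∫ x, q x * ∑ i, ∑ j, AA u i j x * pd i (pd j p) x := by
  rw [weak_form hu hsym hsol (hp.of_le (by norm_num)) hq (Or.inl hs),
    weak_form hu hsym hsol (hq.of_le (by norm_num)) hp (Or.inr hs)]
  congr 2; funext x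
  rw [sum_comm]
  refine sum_congr rfl fun i _ => sum_congr rfl fun j _ => ?_
  rw [AA_symm hsym]; ring

end
end SLag5

end

section

open Matrix Finset MeasureTheory
open scoped ContDiff

noncomputable section SLag6

/-- truncated power -/
def pk (k : ℕ) (t : ℝ) : ℝ := max t 0 ^ k

lemma pk_cont (k : ℕ) : Continuous (pk k) := (continuous_id.max continuous_const).pow k

lemma pk_nonneg (k : ℕ) (t : ℝ) : 0 ≤ pk k t := pow_nonneg (le_max_right _ _) _

lemma pk_zero (k : ℕ) {t : ℝ} (ht : t ≤ 0) : pk (k + 1) t = 0 := by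
  unfold pk; rw [max_eq_right ht]; simp

lemma pk_le_one (k : ℕ) {t : ℝ} (ht : t ≤ 1) : pk k t ≤ 1 :=
  pow_le_one₀ (le_max_right _ _) (max_le ht zero_le_one)

lemma pk_deriv (k : ℕ) (t : ℝ) : HasDerivAt (pk (k + 2)) ((k + 2) * pk (k + 1) t) t := by
  rcases lt_trichotomy t 0 with h | h | h
  · have e : pk (k + 2) =ᶠ[nhds t] fun _ => 0 := by
      filter_upwards [Iio_mem_nhds h] with s hs
      exact pk_zero _ (le_of_lt hs)
    rw [pk_zero _ h.le, mul_zero]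
    exact (hasDerivAt_const t (0 : ℝ)).congr_of_eventuallyEq e
  · subst h
    rw [pk_zero _ le_rfl, mul_zero]
    have hb : ∀ s : ℝ, |pk (k + 2) s| ≤ |s| ^ (k + 2) := fun s => by
      unfold pk
      rw [abs_pow]
      apply pow_le_pow_left₀ (abs_nonneg _)
      rw [abs_of_nonneg (le_max_right _ _)]
      exact max_le (le_abs_self s) (abs_nonneg s)
    rw [hasDerivAt_iff_isLittleO]
    simp only [sub_zero, smul_zero, pk_zero _ (le_refl (0 : ℝ))]
    have h2 : (fun s : ℝ => pk (k + 2) s) =O[nhds 0] fun s : ℝ => s ^ (k + 2) := by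
      refine Asymptotics.IsBigO.of_bound 1 (Filter.Eventually.of_forall fun s => ?_)
      simpa using hb s
    refine h2.trans_isLittleO ?_
    simpa using Asymptotics.isLittleO_pow_pow (𝕜 := ℝ) (m := 1) (n := k + 2) (by omega)
  · have e : pk (k + 2) =ᶠ[nhds t] fun s => s ^ (k + 2) := by
      filter_upwards [Ioi_mem_nhds h] with s hs
      unfold pk; rw [max_eq_left (le_of_lt hs)]
    have := hasDerivAt_pow (k + 2) t
    have e2 : pk (k + 1) t = t ^ (k + 1) := by unfold pk; rw [max_eq_left h.le]
    rw [e2]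
    refine (this.congr_of_eventuallyEq e).congr_deriv ?_
    push_cast; simp

lemma pk3_C1 : ContDiff ℝ 1 (pk 3) := by
  rw [contDiff_one_iff_deriv]
  refine ⟨fun t => (pk_deriv 1 t).differentiableAt, ?_⟩
  have : deriv (pk 3) = fun t => ((1 : ℕ) + 2) * pk 2 t := funext fun t => (pk_deriv 1 t).deriv
  rw [this]
  exact continuous_const.mul (pk_cont 2)

lemma pk4_C2 : ContDiff ℝ 2 (pk 4) := by
  have : (2 : WithTop ℕ∞) = 1 + 1 := by norm_num
  rw [this, contDiff_succ_iff_deriv]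
  refine ⟨fun t => (pk_deriv 2 t).differentiableAt, by simp, ?_⟩
  have : deriv (pk 4) = fun t => ((2 : ℕ) + 2) * pk 3 t := funext fun t => (pk_deriv 2 t).deriv
  rw [this]
  exact contDiff_const.mul pk3_C1

section
variable {n : ℕ} {u : EuclideanSpace ℝ (Fin n) → ℝ}

/-- gradient increment -/
def ww (u : EuclideanSpace ℝ (Fin n) → ℝ) (a : Fin n) (x : EuclideanSpace ℝ (Fin n)) : ℝ :=
  pd a u x - pd a u 0

/-- extrinsic distance squared -/
def ss (u : EuclideanSpace ℝ (Fin n) → ℝ) (x : EuclideanSpace ℝ (Fin n)) : ℝ :=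
  ∑ a, (x a) ^ 2 + ∑ a, ww u a x ^ 2

/-- `w - Hx` -/
def qq (u : EuclideanSpace ℝ (Fin n) → ℝ) (x : EuclideanSpace ℝ (Fin n)) (i : Fin n) : ℝ :=
  ww u i x - ∑ j, Hess u x i j * x j

/-- normal part -/
def Nn (u : EuclideanSpace ℝ (Fin n) → ℝ) (x : EuclideanSpace ℝ (Fin n)) : ℝ :=
  ∑ i, ∑ j, (gMat u x)⁻¹ i j * (qq u x i * qq u x j)

lemma coord_smooth (a : Fin n) : ContDiff ℝ ∞ (fun x : EuclideanSpace ℝ (Fin n) => x a) :=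
  (EuclideanSpace.proj (𝕜 := ℝ) a).contDiff

lemma ww_smooth (hu : ContDiff ℝ ∞ u) (a : Fin n) : ContDiff ℝ ∞ (ww u a) :=
  (pd_smooth a hu).sub contDiff_const

lemma ss_smooth (hu : ContDiff ℝ ∞ u) : ContDiff ℝ ∞ (ss u) :=
  (ContDiff.sum fun a _ => (coord_smooth a).pow 2).add (ContDiff.sum fun a _ => (ww_smooth hu a).pow 2)

lemma ss_ge (x : EuclideanSpace ℝ (Fin n)) : ‖x‖ ^ 2 ≤ ss u x := by
  rw [EuclideanSpace.norm_sq_eq]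
  unfold ss
  simp only [Real.norm_eq_abs, sq_abs]
  have : 0 ≤ ∑ a, ww u a x ^ 2 := sum_nonneg fun a _ => sq_nonneg _
  linarith

lemma ss_nonneg (x : EuclideanSpace ℝ (Fin n)) : 0 ≤ ss u x := (sq_nonneg _).trans (ss_ge x)

lemma coord_line (x : EuclideanSpace ℝ (Fin n)) (i a : Fin n) :
    HasDerivAt (fun t : ℝ => (x + t • EuclideanSpace.single i (1 : ℝ) : EuclideanSpace ℝ (Fin n)) a)
      (if a = i then 1 else 0) 0 := by
  have : (fun t : ℝ => (x + t • EuclideanSpace.single i (1 : ℝ) : EuclideanSpace ℝ (Fin n)) a)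
      = fun t : ℝ => x a + t * (if a = i then 1 else 0) := by
    funext t; simp [Pi.single_apply]
  rw [this]
  simpa using ((hasDerivAt_id (0 : ℝ)).mul_const (if a = i then (1 : ℝ) else 0)).const_add (x a)

lemma ww_line (hu : ContDiff ℝ ∞ u) (x : EuclideanSpace ℝ (Fin n)) (i a : Fin n) :
    HasDerivAt (fun t : ℝ => ww u a (x + t • EuclideanSpace.single i 1)) (Hess u x i a) 0 := by
  rw [Hess_apply hu]
  exact (pd_line' (pd_smooth a hu) x i).sub_const _

lemma pd_ss (hu : ContDiff ℝ ∞ u) (i : Fin n) :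
    pd i (ss u) = fun x => 2 * (x i + ∑ a, ww u a x * Hess u x i a) := by
  funext x
  have h1 := HasDerivAt.fun_sum (u := univ) fun a _ => (coord_line x i a).pow 2
  have h2 := HasDerivAt.fun_sum (u := univ) fun a _ => (ww_line hu x i a).pow 2
  rw [pd_eq ((ss_smooth hu).differentiable (by simp) x) (h1.add h2)]
  simp [mul_sum, mul_add, mul_assoc]

lemma pd2_ss (hu : ContDiff ℝ ∞ u) (i j : Fin n) (x : EuclideanSpace ℝ (Fin n)) :
    pd i (pd j (ss u)) x = 2 * ((if j = i then 1 else 0) +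
      ∑ a, (Hess u x i a * Hess u x j a + ww u a x * Tk u i x j a)) := by
  have h2 := HasDerivAt.fun_sum (u := univ) fun a _ => (ww_line hu x i a).fun_mul (Hess_line hu x i j a)
  have h3 := ((coord_line x i j).add h2).const_mul 2
  rw [pd_eq ((pd_smooth j (ss_smooth hu)).differentiable (by simp) x)
    (h3.congr_of_eventuallyEq (Filter.Eventually.of_forall fun t => by rw [pd_ss hu]; rfl))]
  simp

lemma lap_ss (hu : ContDiff ℝ ∞ u) (hsym : ∀ x, (Hess u x).IsHermitian) {c : ℝ}
    (hsol : ∀ x, ∑ i, Real.arctan ((hsym x).eigenvalues i) = c) (x : EuclideanSpace ℝ (Fin n)) :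
    ∑ i, ∑ j, (gMat u x)⁻¹ i j * pd i (pd j (ss u)) x = 2 * n := by
  have hdet : IsUnit (gMat u x).det := by
    have := det_gMat_ge hsym x
    exact isUnit_iff_ne_zero.2 (by linarith)
  have e : ∀ i j, (gMat u x)⁻¹ i j * pd i (pd j (ss u)) x =
      2 * ((gMat u x)⁻¹ i j * gMat u x j i) +
      ∑ a, 2 * ww u a x * ((gMat u x)⁻¹ i j * Tk u a x i j) := by
    intro i j
    rw [pd2_ss hu]
    unfold gMat
    have e1 : ∀ a, Tk u i x j a = Tk u a x i j := fun a => by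
      rw [Tk_symm12 hu, Tk_symm13 hu]
    have e2 : (1 + Hess u x * Hess u x) j i =
        (if j = i then 1 else 0) + ∑ a, Hess u x i a * Hess u x j a := by
      rw [Matrix.add_apply, Matrix.one_apply, Matrix.mul_apply]
      congr 1
      refine sum_congr rfl fun a _ => ?_
      rw [Hess_symm hu x a i]; ring
    rw [e2]
    simp only [e1, sum_add_distrib, mul_add, mul_sum]
    rw [add_assoc]
    congr 1
    · ring
    congr 1
    · refine sum_congr rfl fun a _ => ?_
      ring
    · refine sum_congr rfl fun a _ => ?_
      ring
  simp only [e, sum_add_distrib]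
  have t1 : ∑ i, ∑ j, 2 * ((gMat u x)⁻¹ i j * gMat u x j i) = 2 * n := by
    have := congrArg Matrix.trace (Matrix.nonsing_inv_mul (gMat u x) hdet)
    simp only [Matrix.trace, Matrix.diag_apply, Matrix.mul_apply] at this
    simp only [← mul_sum, this]
    simp
  have t2 : ∑ i, ∑ j, ∑ a, 2 * ww u a x * ((gMat u x)⁻¹ i j * Tk u a x i j) = 0 := by
    conv_lhs => enter [2, i]; rw [sum_comm]
    rw [sum_comm]
    refine sum_eq_zero fun a _ => ?_
    simp only [← mul_sum]
    rw [gtrace_zero hu hsym hsol, mul_zero]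
  rw [t1, t2, add_zero]

lemma quad_frame {O : Matrix (Fin n) (Fin n) ℝ} {l : Fin n → ℝ} {x : EuclideanSpace ℝ (Fin n)}
    (h1 : Oᵀ * O = 1) (h2 : O * Oᵀ = 1) (hH : Hess u x = O * diagonal l * Oᵀ) (v : Fin n → ℝ) :
    ∑ i, ∑ j, (gMat u x)⁻¹ i j * (v i * v j) = ∑ a, (1 + l a ^ 2)⁻¹ * (∑ i, O i a * v i) ^ 2 := by
  simp_rw [gInv_apply h1 h2 hH]
  rw [contract (O := O)]
  refine sum_congr rfl fun a _ => ?_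
  congr 1
  rw [sq, sum_mul_sum]
  refine sum_congr rfl fun i _ => sum_congr rfl fun j _ => ?_
  ring

lemma Nn_nonneg (hsym : ∀ x, (Hess u x).IsHermitian) (x : EuclideanSpace ℝ (Fin n)) :
    0 ≤ Nn u x := by
  obtain ⟨O, h1, h2, hH⟩ := spec (hsym x)
  unfold Nn
  rw [quad_frame h1 h2 hH]
  exact sum_nonneg fun a _ => by positivity

lemma Nn_eq_zero (hsym : ∀ x, (Hess u x).IsHermitian) (x : EuclideanSpace ℝ (Fin n))
    (h : Nn u x = 0) (i : Fin n) : qq u x i = 0 := by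
  obtain ⟨O, h1, h2, hH⟩ := spec (hsym x)
  unfold Nn at h
  rw [quad_frame h1 h2 hH, sum_eq_zero_iff_of_nonneg (fun a _ => by positivity)] at h
  have h3 : ∑ i, qq u x i ^ 2 = 0 := by
    rw [← orth_sq h2]
    refine sum_eq_zero fun a _ => ?_
    have := h a (mem_univ a)
    rcases mul_eq_zero.1 this with h | h
    · exfalso
      have : 0 < (1 + (hsym x).eigenvalues a ^ 2)⁻¹ := by positivity
      linarith
    · exact h
  rw [sum_eq_zero_iff_of_nonneg (fun a _ => sq_nonneg _)] at h3
  exact pow_eq_zero_iff (two_ne_zero) |>.1 (h3 i (mem_univ i))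

lemma frame_H {O : Matrix (Fin n) (Fin n) ℝ} {l : Fin n → ℝ} {x : EuclideanSpace ℝ (Fin n)}
    (h1 : Oᵀ * O = 1) (hH : Hess u x = O * diagonal l * Oᵀ) (v : Fin n → ℝ)
    (a : Fin n) : ∑ i, O i a * ∑ j, Hess u x i j * v j = l a * ∑ i, O i a * v i := by
  have e : Oᵀ *ᵥ (Hess u x *ᵥ v) = diagonal l *ᵥ (Oᵀ *ᵥ v) := by
    rw [hH, Matrix.mulVec_mulVec, Matrix.mulVec_mulVec]
    congr 1
    calc Oᵀ * (O * diagonal l * Oᵀ) = (Oᵀ * O) * diagonal l * Oᵀ := by simp only [Matrix.mul_assoc]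
      _ = _ := by rw [h1, Matrix.one_mul]
  have := congrFun e a
  rw [Matrix.mulVec_diagonal] at this
  simpa only [Matrix.mulVec, dotProduct, Matrix.transpose_apply] using this

lemma grad_ss (hu : ContDiff ℝ ∞ u) (hsym : ∀ x, (Hess u x).IsHermitian)
    (x : EuclideanSpace ℝ (Fin n)) :
    ∑ i, ∑ j, (gMat u x)⁻¹ i j * (pd i (ss u) x * pd j (ss u) x) = 4 * (ss u x - Nn u x) := by
  obtain ⟨O, h1, h2, hH⟩ := spec (hsym x)
  unfold Nn
  rw [quad_frame h1 h2 hH, quad_frame h1 h2 hH]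
  set l := (hsym x).eigenvalues
  unfold ss
  rw [← orth_sq h2 (fun a => x a), ← orth_sq h2 (fun a => ww u a x), ← sum_add_distrib,
    ← sum_sub_distrib, mul_sum]
  refine sum_congr rfl fun a _ => ?_
  have e1 : ∑ i, O i a * pd i (fun x => ∑ a, (x a) ^ 2 + ∑ a, ww u a x ^ 2) x =
      2 * (∑ i, O i a * x i + l a * ∑ i, O i a * ww u i x) := by
    rw [← frame_H h1 hH]
    change ∑ i, O i a * pd i (ss u) x = _
    simp only [pd_ss hu, mul_add, mul_sum, sum_add_distrib]
    congr 1
    · refine sum_congr rfl fun i _ => ?_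
      ring
    · refine sum_congr rfl fun i _ => sum_congr rfl fun j _ => ?_
      ring
  have e2 : ∑ i, O i a * qq u x i =
      ∑ i, O i a * ww u i x - l a * ∑ i, O i a * x i := by
    rw [← frame_H h1 hH]
    simp only [qq, mul_sub, sum_sub_distrib]
  rw [e1, e2]
  have : (1 + l a ^ 2) ≠ 0 := by positivity
  field_simp
  ring

lemma pd_comp {F : ℝ → ℝ} {s : EuclideanSpace ℝ (Fin n) → ℝ} {x : EuclideanSpace ℝ (Fin n)} {F' : ℝ}
    (hs : DifferentiableAt ℝ s x) (hF : HasDerivAt F F' (s x)) (i : Fin n) :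
    pd i (fun y => F (s y)) x = F' * pd i s x := by
  have h1 := pd_line hs i
  have : HasDerivAt F F' (s (x + (0 : ℝ) • EuclideanSpace.single i 1)) := by simpa using hF
  exact pd_eq (hF.differentiableAt.comp x hs) (this.comp 0 h1)

/-- cut-off -/
def psi (u : EuclideanSpace ℝ (Fin n) → ℝ) (t : ℝ) (x : EuclideanSpace ℝ (Fin n)) : ℝ :=
  pk 4 (1 - t * ss u x)

lemma arg_smooth (hu : ContDiff ℝ ∞ u) (t : ℝ) : ContDiff ℝ ∞ (fun x => 1 - t * ss u x) :=
  contDiff_const.sub (contDiff_const.mul (ss_smooth hu))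

lemma psi_C2 (hu : ContDiff ℝ ∞ u) (t : ℝ) : ContDiff ℝ 2 (psi u t) :=
  pk4_C2.comp ((arg_smooth hu t).of_le (by norm_cast))

lemma pd_arg (hu : ContDiff ℝ ∞ u) (t : ℝ) (x : EuclideanSpace ℝ (Fin n)) (i : Fin n) :
    pd i (fun x => 1 - t * ss u x) x = - t * pd i (ss u) x := by
  have h := ((pd_line' (ss_smooth hu) x i).const_mul t).const_sub 1
  rw [pd_eq ((arg_smooth hu t).differentiable (by simp) x) h]; ring

lemma pd_psi (hu : ContDiff ℝ ∞ u) (t : ℝ) (j : Fin n) :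
    pd j (psi u t) = fun x => (-4 * t * pk 3 (1 - t * ss u x)) * pd j (ss u) x := by
  funext x
  have := pd_comp ((arg_smooth hu t).differentiable (by simp) x) (pk_deriv 2 _) j
  unfold psi
  rw [this, pd_arg hu]
  push_cast; ring

lemma pd2_psi (hu : ContDiff ℝ ∞ u) (t : ℝ) (i j : Fin n) (x : EuclideanSpace ℝ (Fin n)) :
    pd i (pd j (psi u t)) x = 12 * t ^ 2 * pk 2 (1 - t * ss u x) * (pd i (ss u) x * pd j (ss u) x)
      + (-4 * t * pk 3 (1 - t * ss u x)) * pd i (pd j (ss u)) x := by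
  rw [pd_psi hu]
  have hd : DifferentiableAt ℝ (fun y => pk 3 (1 - t * ss u y)) x :=
    ((pk3_C1.differentiable (by norm_num)) _).comp x ((arg_smooth hu t).differentiable (by simp) x)
  rw [pd_mul (hd.const_mul _) ((pd_smooth j (ss_smooth hu)).differentiable (by simp) x)]
  have : pd i (fun y => -4 * t * pk 3 (1 - t * ss u y)) x
      = -4 * t * pd i (fun y => pk 3 (1 - t * ss u y)) x := by
    rw [pd_eq (hd.const_mul _) ((pd_line hd i).const_mul _)]
  rw [this, pd_comp ((arg_smooth hu t).differentiable (by simp) x) (pk_deriv 1 _) i, pd_arg hu]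
  push_cast; ring

lemma lap_psi (hu : ContDiff ℝ ∞ u) (hsym : ∀ x, (Hess u x).IsHermitian) {c : ℝ}
    (hsol : ∀ x, ∑ i, Real.arctan ((hsym x).eigenvalues i) = c) (t : ℝ)
    (x : EuclideanSpace ℝ (Fin n)) :
    ∑ i, ∑ j, AA u i j x * pd i (pd j (psi u t)) x =
      Vol u x * (48 * t ^ 2 * pk 2 (1 - t * ss u x) * (ss u x - Nn u x)
        - 8 * n * t * pk 3 (1 - t * ss u x)) := by
  have e : ∀ i j, AA u i j x * pd i (pd j (psi u t)) x =
      Vol u x * (12 * t ^ 2 * pk 2 (1 - t * ss u x)) *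
        ((gMat u x)⁻¹ i j * (pd i (ss u) x * pd j (ss u) x))
      + Vol u x * (-4 * t * pk 3 (1 - t * ss u x)) * ((gMat u x)⁻¹ i j * pd i (pd j (ss u)) x) := by
    intro i j
    rw [pd2_psi hu]; unfold AA; ring
  simp only [e, sum_add_distrib, ← mul_sum]
  rw [grad_ss hu hsym, lap_ss hu hsym hsol]
  ring

end
end SLag6

end

section

open Matrix Finset MeasureTheory
open scoped ContDiff

noncomputable section SLag7

section
variable {n : ℕ} {u : EuclideanSpace ℝ (Fin n) → ℝ}

lemma pk_out {t : ℝ} {x : EuclideanSpace ℝ (Fin n)} (k : ℕ) (h : 1 ≤ t * ss u x) :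
    pk (k + 1) (1 - t * ss u x) = 0 := pk_zero k (by linarith)

lemma out_ball {t r : ℝ} (ht : 0 < t) (hr : 0 ≤ r) (htr : 1 ≤ t * r ^ 2) {x : EuclideanSpace ℝ (Fin n)}
    (hx : x ∉ Metric.closedBall (0 : EuclideanSpace ℝ (Fin n)) r) : 1 ≤ t * ss u x := by
  rw [mem_closedBall_zero_iff, not_le] at hx
  calc 1 ≤ t * r ^ 2 := htr
    _ ≤ t * ‖x‖ ^ 2 := by gcongr
    _ ≤ _ := by gcongr; exact ss_ge x

lemma cs_pk {t : ℝ} (ht : 0 < t) (k : ℕ) (F : EuclideanSpace ℝ (Fin n) → ℝ) :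
    HasCompactSupport (fun x => F x * pk (k + 1) (1 - t * ss u x)) := by
  refine HasCompactSupport.intro (isCompact_closedBall (0 : EuclideanSpace ℝ (Fin n)) (Real.sqrt t⁻¹))
    fun x hx => ?_
  rw [pk_out k (out_ball ht (Real.sqrt_nonneg _) _ hx), mul_zero]
  rw [Real.sq_sqrt (by positivity), mul_inv_cancel₀ ht.ne']

lemma psi_cs {t : ℝ} (ht : 0 < t) : HasCompactSupport (psi u t) := by
  have := cs_pk (u := u) ht 3 (fun _ => 1)
  simp only [one_mul] at this
  exact this

lemma int_pk (hu : ContDiff ℝ ∞ u) {t : ℝ} (ht : 0 < t) (k : ℕ) {F : EuclideanSpace ℝ (Fin n) → ℝ}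
    (hF : Continuous F) : Integrable (fun x => F x * pk (k + 1) (1 - t * ss u x)) :=
  int_cs (hF.mul ((pk_cont _).comp (arg_smooth hu t).continuous)) (cs_pk ht k F)

/-- the weighted mass -/
def JJ (u f : EuclideanSpace ℝ (Fin n) → ℝ) (t : ℝ) : ℝ :=
  ∫ x, (f x * Vol u x) * pk 3 (1 - t * ss u x)

/-- the scaled weighted mass -/
def II (u f : EuclideanSpace ℝ (Fin n) → ℝ) (t : ℝ) : ℝ := t ^ ((n : ℝ) / 2) * JJ u f t

lemma JJ_deriv (hu : ContDiff ℝ ∞ u) (hsym : ∀ x, (Hess u x).IsHermitian)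
    {f : EuclideanSpace ℝ (Fin n) → ℝ} (hf : Continuous f) {t : ℝ} (ht : 0 < t) :
    HasDerivAt (JJ u f) (∫ x, (f x * Vol u x * (-3 * ss u x)) * pk 2 (1 - t * ss u x)) t := by
  have hV := (Vol_smooth hu hsym).continuous
  have hS := (ss_smooth hu).continuous
  set K := Metric.closedBall (0 : EuclideanSpace ℝ (Fin n)) (Real.sqrt (t / 2)⁻¹) with hK
  have hcb : Continuous fun x => |f x * Vol u x * (-3 * ss u x)| := by fun_prop
  refine (hasDerivAt_integral_of_dominated_loc_of_deriv_le (μ := volume)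
    (F := fun t x => (f x * Vol u x) * pk 3 (1 - t * ss u x))
    (F' := fun t x => (f x * Vol u x * (-3 * ss u x)) * pk 2 (1 - t * ss u x))
    (s := Set.Ioi (t / 2)) (bound := K.indicator fun x => |f x * Vol u x * (-3 * ss u x)|)
    (Ioi_mem_nhds (by linarith)) ?_ ?_ ?_ ?_ ?_ ?_).2
  · refine Filter.Eventually.of_forall fun r => ?_
    have : Continuous fun x => pk 3 (1 - r * ss u x) := (pk_cont 3).comp (arg_smooth hu r).continuous
    exact ((hf.mul hV).mul this).aestronglyMeasurable
  · exact int_pk hu ht 2 (hf.mul hV)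
  · exact (int_pk hu ht 1 (by fun_prop)).aestronglyMeasurable
  · refine Filter.Eventually.of_forall fun x r hr => ?_
    have hr0 : 0 < r := lt_trans (by linarith) hr
    by_cases hx : x ∈ K
    · rw [Set.indicator_of_mem hx, Real.norm_eq_abs, abs_mul]
      refine mul_le_of_le_one_right (abs_nonneg _) ?_
      rw [abs_of_nonneg (pk_nonneg _ _)]
      apply pk_le_one
      have := mul_nonneg hr0.le (ss_nonneg (u := u) x)
      linarith
    · rw [Set.indicator_of_notMem hx, pk_out 1, mul_zero, norm_zero]
      refine (out_ball (u := u) (t := t / 2) (by linarith) (Real.sqrt_nonneg _) ?_ hx).trans ?_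
      · rw [Real.sq_sqrt (by positivity), mul_inv_cancel₀ (by positivity)]
      · exact mul_le_mul_of_nonneg_right (le_of_lt hr) (ss_nonneg x)
  · rw [integrable_indicator_iff measurableSet_closedBall]
    exact hcb.continuousOn.integrableOn_compact (isCompact_closedBall _ _)
  · refine Filter.Eventually.of_forall fun x r _ => ?_
    have h1 : HasDerivAt (fun r : ℝ => 1 - r * ss u x) (-(1 * ss u x)) r :=
      ((hasDerivAt_id r).mul_const (ss u x)).const_sub 1
    refine (((pk_deriv 1 _).comp r h1).const_mul (f x * Vol u x)).congr_deriv ?_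
    push_cast; ring

lemma II_deriv (hu : ContDiff ℝ ∞ u) (hsym : ∀ x, (Hess u x).IsHermitian) {c : ℝ}
    (hsol : ∀ x, ∑ i, Real.arctan ((hsym x).eigenvalues i) = c)
    {f : EuclideanSpace ℝ (Fin n) → ℝ} (hf : ContDiff ℝ ∞ f) {t : ℝ} (ht : 0 < t) :
    HasDerivAt (II u f) (-(1 / 16) * t ^ ((n : ℝ) / 2 - 2) *
      ((∫ x, (Vol u x * lapg u f x) * psi u t x)
        + 48 * t ^ 2 * ∫ x, (f x * Vol u x * Nn u x) * pk 2 (1 - t * ss u x))) t := by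
  have hV := (Vol_smooth hu hsym).continuous
  have hS := (ss_smooth hu).continuous
  have hfc := hf.continuous
  have hN : Continuous (Nn u) := by
    unfold Nn
    refine continuous_finsetSum _ fun i _ => continuous_finsetSum _ fun j _ => ?_
    have hq : ∀ i, Continuous fun x => qq u x i := fun i => by
      unfold qq
      exact (ww_smooth hu i).continuous.sub (continuous_finsetSum _ fun j _ =>
        (Hess_smooth hu i j).continuous.mul (coord_smooth j).continuous)
    exact (gInv_smooth hu hsym i j).continuous.mul ((hq i).mul (hq j))
  have h1 := (Real.hasDerivAt_rpow_const (x := t) (p := (n : ℝ) / 2) (Or.inl ht.ne')).fun_mul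
    (JJ_deriv hu hsym hfc ht)
  refine h1.congr_deriv ?_
  have hg := green hu hsym hsol (psi_C2 hu t) (hf.of_le (by norm_cast)) (psi_cs ht)
  have e1 : ∫ x, psi u t x * ∑ i, ∑ j, AA u i j x * pd i (pd j f) x =
      ∫ x, (Vol u x * lapg u f x) * psi u t x := by
    congr 1; funext x
    rw [lapg_pd hf]
    unfold AA
    simp only [mul_sum, sum_mul]
    refine sum_congr rfl fun i _ => sum_congr rfl fun j _ => ?_
    ring
  have i1 : Integrable fun x => (f x * Vol u x * (-3 * ss u x)) * pk 2 (1 - t * ss u x) :=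
    int_pk hu ht 1 (by fun_prop)
  have i2 : Integrable fun x => (f x * Vol u x * Nn u x) * pk 2 (1 - t * ss u x) :=
    int_pk hu ht 1 (by fun_prop)
  have i3 : Integrable fun x => (f x * Vol u x) * pk 3 (1 - t * ss u x) :=
    int_pk hu ht 2 (by fun_prop)
  have e2 : ∫ x, f x * ∑ i, ∑ j, AA u i j x * pd i (pd j (psi u t)) x =
      -16 * t ^ 2 * (∫ x, (f x * Vol u x * (-3 * ss u x)) * pk 2 (1 - t * ss u x))
      - 48 * t ^ 2 * (∫ x, (f x * Vol u x * Nn u x) * pk 2 (1 - t * ss u x))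
      - 8 * n * t * JJ u f t := by
    unfold JJ
    rw [← integral_const_mul, ← integral_const_mul, ← integral_const_mul, ← integral_sub,
      ← integral_sub]
    · congr 1; funext x
      rw [lap_psi hu hsym hsol]; ring
    · exact (i1.const_mul _).sub (i2.const_mul _)
    · exact i3.const_mul _
    · exact i1.const_mul _
    · exact i2.const_mul _
  rw [e1, e2] at hg
  rw [hg]
  have r1 : t ^ ((n : ℝ) / 2 - 1) = t ^ ((n : ℝ) / 2 - 2) * t := by
    rw [← Real.rpow_add_one ht.ne']; congr 1; ring
  have r2 : t ^ ((n : ℝ) / 2) = t ^ ((n : ℝ) / 2 - 2) * t ^ 2 := by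
    rw [← Real.rpow_natCast t 2, ← Real.rpow_add ht]; congr 1; push_cast; ring
  rw [r1, r2]
  ring

end
end SLag7

end

section

open Matrix Finset MeasureTheory
open scoped ContDiff

noncomputable section SLag8

section
variable {n : ℕ} {u : EuclideanSpace ℝ (Fin n) → ℝ}

lemma Hess_bd (hsym : ∀ x, (Hess u x).IsHermitian) {L : ℝ}
    (hL : ∀ x i, ((hsym x).eigenvalues i) ^ 2 ≤ L) (x : EuclideanSpace ℝ (Fin n)) (i j : Fin n) :
    |Hess u x i j| ≤ 1 + |L| := by
  obtain ⟨O, h1, h2, hH⟩ := spec (hsym x)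
  have e : ∀ a, ∑ i, O i a * Hess u x i j = (hsym x).eigenvalues a * O j a := by
    intro a
    have := frame_H h1 hH (fun k => if k = j then 1 else 0) a
    simpa using this
  have h3 := orth_sq h2 (fun i => Hess u x i j)
  simp only [e] at h3
  have h4 : ∑ a, O j a ^ 2 = 1 := by
    have := congrFun (congrFun h2 j) j
    simpa [Matrix.mul_apply, sq] using this
  have h5 : ∑ a, ((hsym x).eigenvalues a * O j a) ^ 2 ≤ L := by
    calc _ ≤ ∑ a, L * O j a ^ 2 := by
          refine sum_le_sum fun a _ => ?_
          rw [mul_pow]; exact mul_le_mul_of_nonneg_right (hL x a) (sq_nonneg _)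
      _ = L := by rw [← mul_sum, h4, mul_one]
  have h6 : Hess u x i j ^ 2 ≤ ∑ i, Hess u x i j ^ 2 :=
    single_le_sum (f := fun i => Hess u x i j ^ 2) (fun i _ => sq_nonneg _) (mem_univ i)
  refine abs_le_of_sq_le_sq ?_ (by positivity)
  nlinarith [le_abs_self L, abs_nonneg L]

lemma line_deriv {f : EuclideanSpace ℝ (Fin n) → ℝ} (hf : ContDiff ℝ ∞ f)
    (z v : EuclideanSpace ℝ (Fin n)) (τ : ℝ) :
    HasDerivAt (fun τ : ℝ => f (z + τ • v)) (∑ k, v k * pd k f (z + τ • v)) τ := by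
  have h1 : HasDerivAt (fun τ : ℝ => z + τ • v) v τ := by
    simpa using ((hasDerivAt_id τ).smul_const v).const_add z
  have h2 := ((hf.differentiable (by simp) (z + τ • v)).hasFDerivAt).comp_hasDerivAt τ h1
  refine h2.congr_deriv ?_
  have : v = ∑ k, v k • EuclideanSpace.single k (1 : ℝ) := by
    ext i; simp [Pi.single_apply]
  calc _ = fderiv ℝ f (z + τ • v) (∑ k, v k • EuclideanSpace.single k (1 : ℝ)) := by rw [← this]
    _ = _ := by rw [map_sum]; simp [pd]

lemma line_ftc {f : EuclideanSpace ℝ (Fin n) → ℝ} (hf : ContDiff ℝ ∞ f)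
    (z v : EuclideanSpace ℝ (Fin n)) :
    f (z + v) - f z = ∫ τ in (0 : ℝ)..1, ∑ k, v k * pd k f (z + τ • v) := by
  have h := intervalIntegral.integral_eq_sub_of_hasDerivAt (a := 0) (b := 1)
    (fun τ _ => line_deriv hf z v τ) ?_
  · rw [h]; simp
  · refine Continuous.intervalIntegrable ?_ _ _
    refine continuous_finsetSum _ fun k _ => continuous_const.mul ?_
    exact (pd_smooth k hf).continuous.comp (by fun_prop)

lemma ww_ftc (hu : ContDiff ℝ ∞ u) (x : EuclideanSpace ℝ (Fin n)) (a : Fin n) :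
    ww u a x = ∫ τ in (0 : ℝ)..1, ∑ k, x k * Hess u (τ • x) k a := by
  have := line_ftc (pd_smooth a hu) 0 x
  simp only [zero_add] at this
  unfold ww
  rw [this]
  simp only [Hess_apply hu]

lemma coord_le (x : EuclideanSpace ℝ (Fin n)) (k : Fin n) : |x k| ≤ ‖x‖ := by
  simpa using PiLp.norm_apply_le x k

lemma ww_bd (hu : ContDiff ℝ ∞ u) {M : ℝ} (hM : ∀ x i j, |Hess u x i j| ≤ M)
    (x : EuclideanSpace ℝ (Fin n)) (a : Fin n) : |ww u a x| ≤ n * M * ‖x‖ := by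
  rw [ww_ftc hu]
  have := intervalIntegral.norm_integral_le_of_norm_le_const (a := 0) (b := 1) (C := n * M * ‖x‖)
    (f := fun τ : ℝ => ∑ k, x k * Hess u (τ • x) k a) ?_
  · simpa using this
  · intro τ _
    rw [Real.norm_eq_abs]
    refine (abs_sum_le_sum_abs _ _).trans ?_
    calc _ ≤ ∑ k : Fin n, ‖x‖ * M := by
          refine sum_le_sum fun k _ => ?_
          rw [abs_mul]
          exact mul_le_mul (coord_le x k) (hM _ _ _) (abs_nonneg _) (norm_nonneg _)
      _ = _ := by simp; ring

lemma ss_le (hu : ContDiff ℝ ∞ u) {M : ℝ} (hM : ∀ x i j, |Hess u x i j| ≤ M)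
    (x : EuclideanSpace ℝ (Fin n)) : ss u x ≤ (1 + n * (n * M) ^ 2) * ‖x‖ ^ 2 := by
  unfold ss
  have h1 : ‖x‖ ^ 2 = ∑ a, (x a) ^ 2 := by
    rw [EuclideanSpace.norm_sq_eq]; simp
  have h2 : ∑ a, ww u a x ^ 2 ≤ ∑ a : Fin n, (n * M * ‖x‖) ^ 2 := by
    refine sum_le_sum fun a _ => ?_
    exact sq_le_sq' (by linarith [(abs_le.1 (ww_bd hu hM x a)).1]) (abs_le.1 (ww_bd hu hM x a)).2
  simp only [sum_const, card_univ, Fintype.card_fin, nsmul_eq_mul] at h2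
  rw [← h1]; linarith

lemma Vol_le (hsym : ∀ x, (Hess u x).IsHermitian) {L : ℝ}
    (hL : ∀ x i, ((hsym x).eigenvalues i) ^ 2 ≤ L) (x : EuclideanSpace ℝ (Fin n)) :
    Vol u x ^ 2 ≤ (1 + |L|) ^ n := by
  obtain ⟨O, h1, h2, hH⟩ := spec (hsym x)
  unfold Vol
  rw [Real.sq_sqrt (zero_le_one.trans (det_gMat_ge hsym x)), det_gMat h1 h2 hH]
  calc _ ≤ ∏ i : Fin n, (1 + |L|) := by
        refine prod_le_prod (fun i _ => by positivity) fun i _ => ?_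
        linarith [hL x i, le_abs_self L]
    _ = _ := by simp

lemma bV_nonneg (hsym : ∀ x, (Hess u x).IsHermitian) (x : EuclideanSpace ℝ (Fin n)) :
    0 ≤ bV u x := Real.log_nonneg (Vol_ge hsym x)

lemma bV_le (hsym : ∀ x, (Hess u x).IsHermitian) {L : ℝ}
    (hL : ∀ x i, ((hsym x).eigenvalues i) ^ 2 ≤ L) (x : EuclideanSpace ℝ (Fin n)) :
    bV u x * Vol u x ≤ (1 + |L|) ^ n := by
  have h0 := Vol_ge hsym x
  have h1 : bV u x ≤ Vol u x := Real.log_le_self (by linarith)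
  have := Vol_le hsym hL x
  nlinarith

/-- change of variables -/
lemma scale_int (F : EuclideanSpace ℝ (Fin n) → ℝ) {R : ℝ} (hR : 0 < R) :
    ∫ x, F x = R ^ n * ∫ y, F (R • y) := by
  rw [Measure.integral_comp_smul]
  simp only [finrank_euclideanSpace, Fintype.card_fin, smul_eq_mul]
  rw [abs_of_pos (by positivity), ← mul_assoc, mul_inv_cancel₀ (by positivity), one_mul]

lemma rpow_scale {t : ℝ} (ht : 0 < t) : t ^ ((n : ℝ) / 2) * (Real.sqrt t⁻¹) ^ n = 1 := by
  rw [Real.sqrt_eq_rpow, ← Real.rpow_natCast, ← Real.rpow_mul (by positivity), Real.inv_rpow ht.le,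
    show (1 / 2 * (n : ℝ)) = (n : ℝ) / 2 by ring, mul_inv_cancel₀]
  positivity

lemma II_scale (f : EuclideanSpace ℝ (Fin n) → ℝ) {t : ℝ} (ht : 0 < t) :
    II u f t = ∫ y, (f (Real.sqrt t⁻¹ • y) * Vol u (Real.sqrt t⁻¹ • y)) *
      pk 3 (1 - t * ss u (Real.sqrt t⁻¹ • y)) := by
  unfold II JJ
  rw [scale_int _ (Real.sqrt_pos.2 (inv_pos.2 ht)), ← mul_assoc, rpow_scale ht, one_mul]

lemma II_bV_le (hu : ContDiff ℝ ∞ u) (hsym : ∀ x, (Hess u x).IsHermitian) {L : ℝ}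
    (hL : ∀ x i, ((hsym x).eigenvalues i) ^ 2 ≤ L) : ∃ C, ∀ t > 0, II u (bV u) t ≤ C := by
  refine ⟨(1 + |L|) ^ n * volume.real (Metric.closedBall (0 : EuclideanSpace ℝ (Fin n)) 1),
    fun t ht => ?_⟩
  rw [II_scale _ ht]
  set R := Real.sqrt t⁻¹ with hR
  have hR0 : 0 < R := Real.sqrt_pos.2 (inv_pos.2 ht)
  have htR : t * R ^ 2 = 1 := by
    rw [hR, Real.sq_sqrt (by positivity), mul_inv_cancel₀ ht.ne']
  calc _ ≤ ∫ y, (Metric.closedBall (0 : EuclideanSpace ℝ (Fin n)) 1).indicator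
        (fun _ => (1 + |L|) ^ n) y := by
        refine integral_mono ?_ ?_ fun y => ?_
        · have := (int_pk hu ht 2 (F := fun x => bV u x * Vol u x)
            ((bV_smooth hu hsym).continuous.mul (Vol_smooth hu hsym).continuous))
          exact this.comp_smul hR0.ne'
        · rw [integrable_indicator_iff measurableSet_closedBall]
          exact integrableOn_const (isCompact_closedBall _ _).measure_lt_top.ne
        · by_cases hy : y ∈ Metric.closedBall (0 : EuclideanSpace ℝ (Fin n)) 1
          · simp only [Set.indicator_of_mem hy]
            have h1 := pk_le_one 3 (t := 1 - t * ss u (R • y)) (by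
              have := mul_nonneg ht.le (ss_nonneg (u := u) (R • y)); linarith)
            have h2 := pk_nonneg 3 (1 - t * ss u (R • y))
            have h3 := bV_le hsym hL (R • y)
            have h4 : 0 ≤ bV u (R • y) * Vol u (R • y) :=
              mul_nonneg (bV_nonneg hsym _) (by linarith [Vol_ge hsym (R • y)])
            exact (mul_le_of_le_one_right h4 h1).trans h3
          · simp only [Set.indicator_of_notMem hy]
            rw [pk_out 2, mul_zero]
            refine out_ball ht hR0.le htR.ge ?_
            rw [mem_closedBall_zero_iff] at hy ⊢
            rw [norm_smul, Real.norm_of_nonneg hR0.le]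
            nlinarith
    _ = _ := by
        rw [integral_indicator measurableSet_closedBall, setIntegral_const, smul_eq_mul, mul_comm]

end
end SLag8

end

section

open Matrix Finset MeasureTheory
open scoped ContDiff

noncomputable section SLag9

section
variable {n : ℕ} {u : EuclideanSpace ℝ (Fin n) → ℝ}

lemma Nn_cont (hu : ContDiff ℝ ∞ u) (hsym : ∀ x, (Hess u x).IsHermitian) : Continuous (Nn u) := by
  unfold Nn
  refine continuous_finsetSum _ fun i _ => continuous_finsetSum _ fun j _ => ?_
  have hq : ∀ i, Continuous fun x => qq u x i := fun i => by
    unfold qq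
    exact (ww_smooth hu i).continuous.sub (continuous_finsetSum _ fun j _ =>
      (Hess_smooth hu i j).continuous.mul (coord_smooth j).continuous)
  exact (gInv_smooth hu hsym i j).continuous.mul ((hq i).mul (hq j))

lemma lapg_const (a : ℝ) (x : EuclideanSpace ℝ (Fin n)) : lapg u (fun _ => a) x = 0 := by
  rw [lapg_pd contDiff_const]
  have : ∀ j : Fin n, pd j (fun _ : EuclideanSpace ℝ (Fin n) => a) = fun _ => 0 := by
    intro j; funext y; simp [pd]
  simp only [this]
  simp [pd]

lemma lapg_cont (hu : ContDiff ℝ ∞ u) (hsym : ∀ x, (Hess u x).IsHermitian)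
    {f : EuclideanSpace ℝ (Fin n) → ℝ} (hf : ContDiff ℝ ∞ f) : Continuous (lapg u f) := by
  have : lapg u f = fun x => ∑ i, ∑ j, (gMat u x)⁻¹ i j * pd i (pd j f) x :=
    funext fun x => lapg_pd hf x
  rw [this]
  refine continuous_finsetSum _ fun i _ => continuous_finsetSum _ fun j _ => ?_
  exact (gInv_smooth hu hsym i j).continuous.mul (pd_smooth i (pd_smooth j hf)).continuous

lemma Tk_cont (hu : ContDiff ℝ ∞ u) (k i j : Fin n) : Continuous fun x => Tk u k x i j :=
  (pd_smooth k (pd_smooth i (pd_smooth j hu))).continuous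

lemma D3_cont (hu : ContDiff ℝ ∞ u) : Continuous (D3 u) := by
  unfold D3
  refine continuous_finsetSum _ fun k _ => continuous_finsetSum _ fun i _ =>
    continuous_finsetSum _ fun j _ => (Tk_cont hu k i j).pow 2

lemma D3_nonneg (x : EuclideanSpace ℝ (Fin n)) : 0 ≤ D3 u x :=
  sum_nonneg fun _ _ => sum_nonneg fun _ _ => sum_nonneg fun _ _ => sq_nonneg _

lemma Nterm_nonneg (hsym : ∀ x, (Hess u x).IsHermitian)
    {f : EuclideanSpace ℝ (Fin n) → ℝ} (hf : ∀ x, 0 ≤ f x) (t : ℝ) :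
    0 ≤ ∫ x, (f x * Vol u x * Nn u x) * pk 2 (1 - t * ss u x) :=
  integral_nonneg fun x => mul_nonneg (mul_nonneg (mul_nonneg (hf x)
    (zero_le_one.trans (Vol_ge hsym x))) (Nn_nonneg hsym x)) (pk_nonneg _ _)

lemma II_deriv_one (hu : ContDiff ℝ ∞ u) (hsym : ∀ x, (Hess u x).IsHermitian) {c : ℝ}
    (hsol : ∀ x, ∑ i, Real.arctan ((hsym x).eigenvalues i) = c) {t : ℝ} (ht : 0 < t) :
    HasDerivAt (II u (fun _ => 1)) (-3 * t ^ ((n : ℝ) / 2 - 2) * t ^ 2 *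
      ∫ x, (1 * Vol u x * Nn u x) * pk 2 (1 - t * ss u x)) t := by
  refine (II_deriv hu hsym hsol (contDiff_const (c := (1 : ℝ))) ht).congr_deriv ?_
  simp only [lapg_const, mul_zero, zero_mul, integral_zero, zero_add]
  ring

lemma II_anti (hu : ContDiff ℝ ∞ u) (hsym : ∀ x, (Hess u x).IsHermitian) {c : ℝ}
    (hsol : ∀ x, ∑ i, Real.arctan ((hsym x).eigenvalues i) = c) :
    AntitoneOn (II u (fun _ => 1)) (Set.Ioi 0) := by
  refine antitoneOn_of_deriv_nonpos (convex_Ioi 0)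
    (fun t ht => (II_deriv_one hu hsym hsol ht).continuousAt.continuousWithinAt) ?_ ?_
  · rw [interior_Ioi]
    exact fun t ht => (II_deriv_one hu hsym hsol ht).differentiableAt.differentiableWithinAt
  · rw [interior_Ioi]
    intro t ht
    rw [(II_deriv_one hu hsym hsol ht).deriv]
    have ht' : 0 < t := ht
    have h1 := Nterm_nonneg hsym (f := fun _ => (1 : ℝ)) (fun _ => zero_le_one) t
    have h2 : 0 ≤ t ^ ((n : ℝ) / 2 - 2) * t ^ 2 := by positivity
    nlinarith [mul_nonneg h2 h1]

lemma D3_int_ball (hu : ContDiff ℝ ∞ u) (R r : ℝ) : IntegrableOn (fun y => D3 u (R • y))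
    (Metric.closedBall (0 : EuclideanSpace ℝ (Fin n)) r) :=
  ((D3_cont hu).comp (by fun_prop)).continuousOn.integrableOn_compact (isCompact_closedBall _ _)

/-- lower bound of the dissipation -/
lemma diss_ge (hu : ContDiff ℝ ∞ u) (hsym : ∀ x, (Hess u x).IsHermitian)
    {K ρ c0 : ℝ} (hK : ∀ x, ss u x ≤ K * ‖x‖ ^ 2) (hρ : 0 < ρ) (hKρ : K * ρ ^ 2 ≤ 1 / 2)
    (hc : 0 < c0) (hlap : ∀ x, c0 * D3 u x ≤ lapg u (bV u) x) {t R : ℝ} (hR : 0 < R)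
    (ht : t * R ^ 2 = ρ ^ 2) :
    c0 / 16 * (R ^ n * ∫ y in Metric.closedBall (0 : EuclideanSpace ℝ (Fin n)) 1, D3 u (R • y)) ≤
      ∫ x, (Vol u x * lapg u (bV u) x) * psi u t x := by
  have ht0 : 0 < t := by
    by_contra h; push Not at h; nlinarith [sq_nonneg R, sq_pos_of_pos hρ, mul_nonneg (neg_nonneg.2 h) (sq_nonneg R)]
  rw [scale_int _ hR, mul_left_comm]
  refine mul_le_mul_of_nonneg_left ?_ (by positivity)
  rw [← integral_indicator measurableSet_closedBall, ← integral_const_mul]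
  refine integral_mono ?_ ?_ fun y => ?_
  · refine Integrable.const_mul ?_ _
    rw [integrable_indicator_iff measurableSet_closedBall]
    exact D3_int_ball hu R 1
  · have := (int_pk hu ht0 3 (F := fun x => Vol u x * lapg u (bV u) x)
      ((Vol_smooth hu hsym).continuous.mul (lapg_cont hu hsym (bV_smooth hu hsym))))
    exact this.comp_smul hR.ne'
  · have hD := D3_nonneg (u := u) (R • y)
    have hl := hlap (R • y)
    have hV := Vol_ge hsym (R • y)
    have hp := pk_nonneg 4 (1 - t * ss u (R • y))
    have hl0 : 0 ≤ lapg u (bV u) (R • y) := (mul_nonneg hc.le hD).trans hl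
    by_cases hy : y ∈ Metric.closedBall (0 : EuclideanSpace ℝ (Fin n)) 1
    · simp only [Set.indicator_of_mem hy]
      have hy' : ‖y‖ ≤ 1 := by simpa using hy
      have h1 : (1 / 2 : ℝ) ≤ 1 - t * ss u (R • y) := by
        have h2 := hK (R • y)
        rw [norm_smul, Real.norm_of_nonneg hR.le] at h2
        have h3 : ‖y‖ ^ 2 ≤ 1 := by nlinarith [norm_nonneg y]
        have h4 : t * ss u (R • y) ≤ K * ρ ^ 2 * ‖y‖ ^ 2 := by
          rw [← ht]; nlinarith
        have h5 : K * ρ ^ 2 * ‖y‖ ^ 2 ≤ 1 / 2 * ‖y‖ ^ 2 := by gcongr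
        linarith
      have h2 : (1 / 16 : ℝ) ≤ psi u t (R • y) := by
        unfold psi pk
        rw [max_eq_left (by linarith)]
        calc (1 / 16 : ℝ) = (1 / 2) ^ 4 := by norm_num
          _ ≤ _ := by gcongr
      have h3 : c0 * D3 u (R • y) ≤ Vol u (R • y) * lapg u (bV u) (R • y) :=
        hl.trans (le_mul_of_one_le_left hl0 hV)
      calc c0 / 16 * D3 u (R • y) = c0 * D3 u (R • y) * (1 / 16) := by ring
        _ ≤ _ := mul_le_mul h3 h2 (by norm_num) (by positivity)
    · simp only [Set.indicator_of_notMem hy, mul_zero]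
      exact mul_nonneg (mul_nonneg (by linarith) hl0) hp

lemma decay (hu : ContDiff ℝ ∞ u) (hsym : ∀ x, (Hess u x).IsHermitian) {c : ℝ}
    (hsol : ∀ x, ∑ i, Real.arctan ((hsym x).eigenvalues i) = c)
    {L c0 : ℝ} (hL : ∀ x i, ((hsym x).eigenvalues i) ^ 2 ≤ L)
    (hc : 0 < c0) (hlap : ∀ x, c0 * D3 u x ≤ lapg u (bV u) x)
    {η : ℝ} (hη : 0 < η) (R0 : ℝ) :
    ∃ R > R0, 0 < R ∧
      R ^ 2 * ∫ y in Metric.closedBall (0 : EuclideanSpace ℝ (Fin n)) 1, D3 u (R • y) < η := by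
  by_contra hcon
  push Not at hcon
  have hM := Hess_bd hsym hL
  set K : ℝ := 1 + n * (n * (1 + |L|)) ^ 2 with hKd
  have hK := ss_le hu hM
  have hK0 : 0 < K := by positivity
  set ρ : ℝ := Real.sqrt (1 / (2 * K)) with hρd
  have hρ : 0 < ρ := Real.sqrt_pos.2 (by positivity)
  have hρ2 : ρ ^ 2 = 1 / (2 * K) := Real.sq_sqrt (by positivity)
  have hKρ : K * ρ ^ 2 ≤ 1 / 2 := by rw [hρ2]; field_simp; norm_num
  obtain ⟨C, hC⟩ := II_bV_le hu hsym hL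
  set R1 : ℝ := |R0| + 1 with hR1
  have hR1p : 0 < R1 := by positivity
  set t0 : ℝ := ρ ^ 2 / R1 ^ 2 with ht0
  have ht0p : 0 < t0 := by positivity
  set κ : ℝ := c0 / 256 * ρ ^ n * η / ρ ^ 2 with hκ
  have hκp : 0 < κ := by positivity
  -- derivative bound
  have hder : ∀ t ∈ Set.Ioc 0 t0, ∃ d, HasDerivAt (fun t => II u (bV u) t + κ * Real.log t) d t ∧ d ≤ 0 := by
    intro t ht
    have htp := ht.1
    have h1 := II_deriv hu hsym hsol (bV_smooth hu hsym) htp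
    have h2 := (Real.hasDerivAt_log htp.ne').const_mul κ
    refine ⟨_, h1.add h2, ?_⟩
    set R : ℝ := ρ * Real.sqrt t⁻¹ with hR
    have hs : 0 < Real.sqrt t⁻¹ := Real.sqrt_pos.2 (inv_pos.2 htp)
    have hRp : 0 < R := by positivity
    have htR : t * R ^ 2 = ρ ^ 2 := by
      rw [hR, mul_pow, Real.sq_sqrt (inv_pos.2 htp).le, mul_left_comm, mul_inv_cancel₀ htp.ne', mul_one]
    have hRR : R1 ≤ R := by
      refine le_of_sq_le_sq ?_ hRp.le
      have := ht.2
      rw [ht0, le_div_iff₀ (by positivity), ← htR] at this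
      exact le_of_mul_le_mul_left this htp
    have h3 := hcon R (by linarith [le_abs_self R0]) hRp
    have h4 := diss_ge hu hsym hK hρ hKρ hc hlap hRp htR
    have h5 := Nterm_nonneg hsym (bV_nonneg hsym) t
    have h6 : R ^ n * t ^ ((n : ℝ) / 2 - 2) * t = ρ ^ n / t := by
      rw [hR, mul_pow, show t ^ ((n : ℝ) / 2 - 2) = t ^ ((n : ℝ) / 2) / t ^ 2 by
        rw [← Real.rpow_natCast t 2, ← Real.rpow_sub htp]; norm_num]
      have := rpow_scale (n := n) htp
      generalize Real.sqrt t⁻¹ = S at this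
      generalize t ^ ((n : ℝ) / 2) = T at this
      field_simp
      linear_combination this
    set D := ∫ y in Metric.closedBall (0 : EuclideanSpace ℝ (Fin n)) 1, D3 u (R • y) with hD
    set A := ∫ x, (Vol u x * lapg u (bV u) x) * psi u t x
    set B := ∫ x, (bV u x * Vol u x * Nn u x) * pk 2 (1 - t * ss u x)
    have ht2 : 0 < t ^ ((n : ℝ) / 2 - 2) := by positivity
    have h7 : η * t / ρ ^ 2 ≤ D := by
      rw [div_le_iff₀ (by positivity), ← htR]; nlinarith
    have h8 : κ * t⁻¹ ≤ 1 / 16 * t ^ ((n : ℝ) / 2 - 2) * A := by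
      calc κ * t⁻¹ = c0 / 256 * (ρ ^ n / t) * (η / ρ ^ 2) := by rw [hκ]; field_simp
        _ = 1 / 16 * t ^ ((n : ℝ) / 2 - 2) * (c0 / 16 * (R ^ n * (η * t / ρ ^ 2))) := by
          rw [← h6]; ring
        _ ≤ 1 / 16 * t ^ ((n : ℝ) / 2 - 2) * (c0 / 16 * (R ^ n * D)) := by gcongr
        _ ≤ _ := by gcongr
    have h9 : 0 ≤ 1 / 16 * t ^ ((n : ℝ) / 2 - 2) * (48 * t ^ 2 * B) := by positivity
    linarith
  have hanti : AntitoneOn (fun t => II u (bV u) t + κ * Real.log t) (Set.Ioc 0 t0) := by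
    refine antitoneOn_of_deriv_nonpos (convex_Ioc 0 t0)
      (fun t ht => ?_) ?_ ?_
    · obtain ⟨d, h, _⟩ := hder t ht
      exact h.continuousAt.continuousWithinAt
    · intro t ht
      obtain ⟨d, h, _⟩ := hder t (interior_subset ht)
      exact h.differentiableAt.differentiableWithinAt
    · intro t ht
      obtain ⟨d, h, h'⟩ := hder t (interior_subset ht)
      rw [h.deriv]; exact h'
  set A0 := II u (bV u) t0 + κ * Real.log t0 with hA0
  have hall : ∀ t ∈ Set.Ioc 0 t0, A0 ≤ C + κ * Real.log t := fun t ht =>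
    (hanti ht (Set.right_mem_Ioc.2 ht0p) ht.2).trans (by linarith [hC t ht.1])
  have h1 : Filter.Tendsto (fun t => C + κ * Real.log t) (nhdsWithin 0 (Set.Ioi 0)) Filter.atBot :=
    Filter.tendsto_atBot_add_const_left _ _ (Real.tendsto_log_nhdsGT_zero.const_mul_atBot hκp)
  have h2 := h1.eventually (Filter.eventually_lt_atBot A0)
  have h3 : ∀ᶠ t in nhdsWithin (0 : ℝ) (Set.Ioi 0), t ∈ Set.Ioc 0 t0 :=
    Ioc_mem_nhdsGT ht0p
  obtain ⟨t, ht, ht'⟩ := (h2.and h3).exists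
  linarith [hall t ht']

end
end SLag9

end

section

open Matrix Finset MeasureTheory
open scoped ContDiff ENNReal

noncomputable section SLag10

section
variable {n : ℕ} {u : EuclideanSpace ℝ (Fin n) → ℝ}

lemma lint_affine {g : EuclideanSpace ℝ (Fin n) → ℝ≥0∞} (hg : Measurable g)
    (a : EuclideanSpace ℝ (Fin n)) {τ : ℝ} (hτ : 1 / 2 ≤ τ) :
    ∫⁻ y, g (a + τ • y) ≤ 2 ^ n * ∫⁻ y, g y := by
  have h0 : τ ≠ 0 := by positivity
  have h1 : ∫⁻ y, g (a + τ • y) = ∫⁻ y, (fun z => g (a + z)) y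
      ∂(Measure.map (fun y : EuclideanSpace ℝ (Fin n) => τ • y) volume) := by
    exact (lintegral_map (f := fun z => g (a + z)) (hg.comp (measurable_const_add a))
      (measurable_const_smul τ)).symm
  rw [h1]
  have h2 := Measure.map_addHaar_smul (volume : Measure (EuclideanSpace ℝ (Fin n))) h0
  change Measure.map (fun y => τ • y) volume = _ at h2
  rw [h2, lintegral_smul_measure, lintegral_add_left_eq_self g a]
  simp only [finrank_euclideanSpace, Fintype.card_fin, smul_eq_mul]
  gcongr
  rw [abs_of_pos (by positivity), ← inv_pow]
  calc ENNReal.ofReal (τ⁻¹ ^ n) ≤ ENNReal.ofReal (2 ^ n) := by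
        apply ENNReal.ofReal_le_ofReal
        gcongr
        rw [inv_le_comm₀ (by positivity) (by positivity)]; linarith
    _ = 2 ^ n := by rw [ENNReal.ofReal_pow (by norm_num)]; simp

abbrev BB (n : ℕ) : Set (EuclideanSpace ℝ (Fin n)) := Metric.closedBall 0 1

lemma poinc_half {G : EuclideanSpace ℝ (Fin n) → ℝ≥0∞} (hG : Measurable G) {τ : ℝ}
    (h1 : 1 / 2 ≤ τ) (h2 : τ ≤ 1) :
    ∫⁻ z in BB n, ∫⁻ y in BB n, G (z + τ • (y - z)) ≤ 2 ^ n * volume (BB n) * ∫⁻ y in BB n, G y := by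
  have key : ∀ z ∈ BB n, ∫⁻ y in BB n, G (z + τ • (y - z)) ≤ 2 ^ n * ∫⁻ y in BB n, G y := by
    intro z hz
    rw [← lintegral_indicator measurableSet_closedBall, ← lintegral_indicator measurableSet_closedBall]
    refine le_trans (lintegral_mono fun y => ?_)
      (lint_affine (hG.indicator measurableSet_closedBall) ((1 - τ) • z) h1)
    by_cases hy : y ∈ BB n
    · have e : z + τ • (y - z) = (1 - τ) • z + τ • y := by module
      have hm : (1 - τ) • z + τ • y ∈ BB n :=
        convex_closedBall (0 : EuclideanSpace ℝ (Fin n)) 1 hz hy (by linarith) (by linarith) (by ring)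
      rw [Set.indicator_of_mem hy, Set.indicator_of_mem hm, e]
    · rw [Set.indicator_of_notMem hy]; exact zero_le
  calc _ ≤ ∫⁻ z in BB n, 2 ^ n * ∫⁻ y in BB n, G y :=
        setLIntegral_mono' measurableSet_closedBall key
    _ = _ := by rw [setLIntegral_const]; ring

lemma poinc_all {G : EuclideanSpace ℝ (Fin n) → ℝ≥0∞} (hG : Measurable G) {τ : ℝ}
    (h1 : 0 ≤ τ) (h2 : τ ≤ 1) :
    ∫⁻ z in BB n, ∫⁻ y in BB n, G (z + τ • (y - z)) ≤ 2 ^ n * volume (BB n) * ∫⁻ y in BB n, G y := by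
  by_cases h : 1 / 2 ≤ τ
  · exact poinc_half hG h h2
  · have e := poinc_half (n := n) hG (τ := 1 - τ) (by linarith) (by linarith)
    rw [lintegral_lintegral_swap]
    · refine le_trans (le_of_eq ?_) e
      refine lintegral_congr fun y => lintegral_congr fun z => ?_
      congr 1; module
    · refine (hG.comp ?_).aemeasurable
      fun_prop

lemma poinc {G : EuclideanSpace ℝ (Fin n) → ℝ≥0∞} (hG : Measurable G) :
    ∫⁻ z in BB n, ∫⁻ y in BB n, ∫⁻ τ in Set.Ioc (0 : ℝ) 1, G (z + τ • (y - z)) ≤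
      2 ^ n * volume (BB n) * ∫⁻ y in BB n, G y := by
  have e1 : ∀ z, ∫⁻ y in BB n, ∫⁻ τ in Set.Ioc (0 : ℝ) 1, G (z + τ • (y - z)) =
      ∫⁻ τ in Set.Ioc (0 : ℝ) 1, ∫⁻ y in BB n, G (z + τ • (y - z)) := by
    intro z
    rw [lintegral_lintegral_swap]
    refine (hG.comp ?_).aemeasurable
    fun_prop
  simp only [e1]
  rw [lintegral_lintegral_swap]
  · calc _ ≤ ∫⁻ τ in Set.Ioc (0 : ℝ) 1, 2 ^ n * volume (BB n) * ∫⁻ y in BB n, G y :=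
        setLIntegral_mono' measurableSet_Ioc fun τ hτ => poinc_all hG hτ.1.le hτ.2
      _ = _ := by rw [setLIntegral_const]; simp
  · refine Measurable.aemeasurable ?_
    refine Measurable.lintegral_prod_right' (f := fun p : (EuclideanSpace ℝ (Fin n) × ℝ) × EuclideanSpace ℝ (Fin n) => G (p.1.1 + p.1.2 • (p.2 - p.1.1))) ?_
    refine hG.comp ?_
    fun_prop

end
end SLag10

end

section

open Matrix Finset MeasureTheory
open scoped ContDiff ENNReal

noncomputable section SLag11

section
variable {n : ℕ} {u : EuclideanSpace ℝ (Fin n) → ℝ}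

/-- majorant of the scaled third derivatives -/
def TT (u : EuclideanSpace ℝ (Fin n) → ℝ) (R : ℝ) (x : EuclideanSpace ℝ (Fin n)) : ℝ :=
  2 * R * ∑ k, ∑ i, ∑ j, |Tk u k (R • x) i j|

lemma TT_cont (hu : ContDiff ℝ ∞ u) (R : ℝ) : Continuous (TT u R) := by
  unfold TT
  refine continuous_const.mul (continuous_finsetSum _ fun k _ => continuous_finsetSum _ fun i _ =>
    continuous_finsetSum _ fun j _ => ?_)
  exact ((Tk_cont hu k i j).comp (by fun_prop : Continuous fun x : EuclideanSpace ℝ (Fin n) => R • x)).abs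

lemma osc_le (hu : ContDiff ℝ ∞ u) {R : ℝ} (hR : 0 < R) {y z : EuclideanSpace ℝ (Fin n)}
    (hy : y ∈ BB n) (hz : z ∈ BB n) (i j : Fin n) :
    ‖Hess u (R • y) i j - Hess u (R • z) i j‖ₑ ≤
      ∫⁻ τ in Set.Ioc (0 : ℝ) 1, ENNReal.ofReal (TT u R (z + τ • (y - z))) := by
  have h := line_ftc (Hess_smooth hu i j) (R • z) (R • (y - z))
  have e1 : R • z + R • (y - z) = R • y := by module
  have e2 : ∀ k, pd k (fun x => Hess u x i j) = fun x => Tk u k x i j := fun k => by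
    have e : (fun y => Hess u y i j) = pd i (pd j u) := funext fun y => Hess_apply hu y i j
    rw [e]; rfl
  simp only [e1, e2] at h
  rw [h, intervalIntegral.integral_of_le zero_le_one]
  refine (enorm_integral_le_lintegral_enorm _).trans (lintegral_mono fun τ => ?_)
  have e3 : R • z + τ • R • (y - z) = R • (z + τ • (y - z)) := by module
  simp only [e3]
  rw [Real.enorm_eq_ofReal_abs]
  refine ENNReal.ofReal_le_ofReal ?_
  unfold TT
  set w := z + τ • (y - z)
  refine (abs_sum_le_sum_abs _ _).trans ?_
  rw [mul_sum]
  refine sum_le_sum fun k _ => ?_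
  rw [abs_mul]
  have hyz : ‖y - z‖ ≤ 2 := by
    have h1 : ‖y‖ ≤ 1 := by simpa using hy
    have h2 : ‖z‖ ≤ 1 := by simpa using hz
    linarith [norm_sub_le y z]
  refine mul_le_mul ?_ ?_ (abs_nonneg _) (by positivity)
  · refine (coord_le _ k).trans ?_
    rw [norm_smul, Real.norm_of_nonneg hR.le]; nlinarith
  · calc |Tk u k (R • w) i j| ≤ ∑ j, |Tk u k (R • w) i j| :=
          single_le_sum (f := fun j => |Tk u k (R • w) i j|) (fun _ _ => abs_nonneg _) (mem_univ j)
      _ ≤ _ := single_le_sum (f := fun i => ∑ j, |Tk u k (R • w) i j|)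
          (fun _ _ => sum_nonneg fun _ _ => abs_nonneg _) (mem_univ i)

lemma TT_le {R δ : ℝ} (hδ : 0 < δ) (x : EuclideanSpace ℝ (Fin n)) :
    TT u R x ≤ (n : ℝ) ^ 3 * δ + R ^ 2 / δ * D3 u (R • x) := by
  have h : ∀ T : ℝ, 2 * R * |T| ≤ δ + R ^ 2 / δ * T ^ 2 := by
    intro T
    have h1 : 0 ≤ (δ - R * |T|) ^ 2 / δ := by positivity
    have h2 : (δ - R * |T|) ^ 2 / δ = δ - 2 * R * |T| + R ^ 2 / δ * T ^ 2 := by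
      rw [← sq_abs T]; field_simp; ring
    linarith
  unfold TT D3
  simp only [mul_sum]
  calc _ ≤ ∑ k, ∑ i, ∑ j, (δ + R ^ 2 / δ * Tk u k (R • x) i j ^ 2) :=
        sum_le_sum fun k _ => sum_le_sum fun i _ => sum_le_sum fun j _ => h _
    _ = _ := by simp only [sum_add_distrib]; simp; ring

lemma TT_int (hu : ContDiff ℝ ∞ u) {R δ : ℝ} (hδ : 0 < δ)
    (h : R ^ 2 * ∫ y in Metric.closedBall (0 : EuclideanSpace ℝ (Fin n)) 1, D3 u (R • y) < δ ^ 2) :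
    ∫⁻ x in BB n, ENNReal.ofReal (TT u R x) ≤
      ENNReal.ofReal (((n : ℝ) ^ 3 * volume.real (BB n) + 1) * δ) := by
  have i1 : IntegrableOn (fun x => (n : ℝ) ^ 3 * δ + R ^ 2 / δ * D3 u (R • x)) (BB n) :=
    (integrableOn_const (isCompact_closedBall _ _).measure_lt_top.ne).add
      ((D3_int_ball hu R 1).const_mul _)
  calc _ ≤ ∫⁻ x in BB n, ENNReal.ofReal ((n : ℝ) ^ 3 * δ + R ^ 2 / δ * D3 u (R • x)) :=
        lintegral_mono fun x => ENNReal.ofReal_le_ofReal (TT_le hδ x)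
    _ = ENNReal.ofReal (∫ x in BB n, ((n : ℝ) ^ 3 * δ + R ^ 2 / δ * D3 u (R • x))) := by
        rw [ofReal_integral_eq_lintegral_ofReal i1]
        exact Filter.Eventually.of_forall fun x => by
          have := D3_nonneg (u := u) (R • x)
          simp only [Pi.zero_apply]; positivity
    _ ≤ _ := by
        refine ENNReal.ofReal_le_ofReal ?_
        have ic : Integrable (fun _ : EuclideanSpace ℝ (Fin n) => (n : ℝ) ^ 3 * δ)
            (volume.restrict (BB n)) :=
          integrableOn_const (s := BB n) (isCompact_closedBall _ _).measure_lt_top.ne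
        have id : Integrable (fun x : EuclideanSpace ℝ (Fin n) => R ^ 2 / δ * D3 u (R • x))
            (volume.restrict (BB n)) := (D3_int_ball hu R 1).const_mul _
        rw [integral_add ic id, setIntegral_const, integral_const_mul, smul_eq_mul]
        have : R ^ 2 / δ * ∫ y in BB n, D3 u (R • y) ≤ δ := by
          rw [div_mul_eq_mul_div, div_le_iff₀ hδ]; nlinarith
        nlinarith

lemma osc_int (hu : ContDiff ℝ ∞ u) {R δ : ℝ} (hR : 0 < R) (hδ : 0 < δ)
    (h : R ^ 2 * ∫ y in Metric.closedBall (0 : EuclideanSpace ℝ (Fin n)) 1, D3 u (R • y) < δ ^ 2) :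
    ∃ z, ∀ i j, ∫⁻ y in BB n, ‖Hess u (R • y) i j - Hess u z i j‖ₑ ≤
      2 ^ n * ENNReal.ofReal (((n : ℝ) ^ 3 * volume.real (BB n) + 1) * δ) := by
  have hGm : Measurable fun x => ENNReal.ofReal (TT u R x) :=
    ENNReal.measurable_ofReal.comp (TT_cont hu R).measurable
  have hp := (poinc (n := n) hGm).trans (mul_le_mul_right (TT_int hu hδ h) _)
  set F : EuclideanSpace ℝ (Fin n) → ℝ≥0∞ := fun z => ∫⁻ y in BB n, ∫⁻ τ in Set.Ioc (0 : ℝ) 1,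
    ENNReal.ofReal (TT u R (z + τ • (y - z)))
  have hv0 : volume (BB n) ≠ 0 := (Metric.measure_closedBall_pos volume _ one_pos).ne'
  have hv1 : volume (BB n) ≠ ⊤ := (isCompact_closedBall _ _).measure_lt_top.ne
  have hF : Measurable F := by
    refine Measurable.lintegral_prod_right'
      (f := fun p : EuclideanSpace ℝ (Fin n) × EuclideanSpace ℝ (Fin n) =>
        ∫⁻ τ in Set.Ioc (0 : ℝ) 1, ENNReal.ofReal (TT u R (p.1 + τ • (p.2 - p.1)))) ?_
    refine Measurable.lintegral_prod_right'
      (f := fun p : (EuclideanSpace ℝ (Fin n) × EuclideanSpace ℝ (Fin n)) × ℝ =>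
        ENNReal.ofReal (TT u R (p.1.1 + p.2 • (p.1.2 - p.1.1)))) ?_
    refine hGm.comp ?_
    fun_prop
  obtain ⟨z, hz, hzF⟩ := exists_le_setLAverage hv0 hv1 hF.aemeasurable
  refine ⟨R • z, fun i j => ?_⟩
  calc _ ≤ F z := setLIntegral_mono' measurableSet_closedBall fun y hy => osc_le hu hR hy hz i j
    _ ≤ _ := hzF
    _ ≤ _ := by
      rw [setLAverage_eq]
      refine ENNReal.div_le_of_le_mul (hp.trans (le_of_eq ?_))
      ring

/-- blow-down sequence -/
lemma blowdown (hu : ContDiff ℝ ∞ u) {M : ℝ}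
    (hM : ∀ x i j, |Hess u x i j| ≤ M)
    (hdec : ∀ η > 0, ∀ R0 : ℝ, ∃ R > R0, 0 < R ∧
      R ^ 2 * ∫ y in Metric.closedBall (0 : EuclideanSpace ℝ (Fin n)) 1, D3 u (R • y) < η) :
    ∃ (R : ℕ → ℝ) (P : Matrix (Fin n) (Fin n) ℝ), (∀ k, 0 < R k) ∧
      Filter.Tendsto R Filter.atTop Filter.atTop ∧ P.IsHermitian ∧
      ∀ᵐ y ∂(volume.restrict (BB n)), ∀ i j,
        Filter.Tendsto (fun k => Hess u (R k • y) i j) Filter.atTop (nhds (P i j)) := by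
  set C : ℝ := (n : ℝ) ^ 3 * volume.real (BB n) + 1 with hC
  have h1 : ∀ k : ℕ, ∃ R : ℝ, (k : ℝ) < R ∧ 0 < R ∧ ∃ z, ∀ i j,
      ∫⁻ y in BB n, ‖Hess u (R • y) i j - Hess u z i j‖ₑ ≤
      2 ^ n * ENNReal.ofReal (C * (1 / ((k : ℝ) + 1))) := by
    intro k
    have hδ : (0 : ℝ) < 1 / ((k : ℝ) + 1) := by positivity
    obtain ⟨R, hR, hR0, h⟩ := hdec ((1 / ((k : ℝ) + 1)) ^ 2) (by positivity) k
    exact ⟨R, hR, hR0, osc_int hu hR0 hδ h⟩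
  choose R hRk hR0 z hz using h1
  have hRt : Filter.Tendsto R Filter.atTop Filter.atTop :=
    Filter.tendsto_atTop_mono (fun k => (hRk k).le) tendsto_natCast_atTop_atTop
  set Pk : ℕ → Fin n → Fin n → ℝ := fun k i j => Hess u (z k) i j with hPk
  have hbd : ∀ k, Pk k ∈ Metric.closedBall (0 : Fin n → Fin n → ℝ) (max M 0) := by
    intro k
    rw [mem_closedBall_zero_iff, pi_norm_le_iff_of_nonneg (le_max_right _ _)]
    intro i
    rw [pi_norm_le_iff_of_nonneg (le_max_right _ _)]
    intro j
    exact (hM _ i j).trans (le_max_left _ _)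
  obtain ⟨P, -, φ, hφ, hP⟩ := (isCompact_closedBall _ _).tendsto_subseq hbd
  -- convergence in measure
  set f : ℕ → EuclideanSpace ℝ (Fin n) → Fin n → Fin n → ℝ :=
    fun k y i j => Hess u (R (φ k) • y) i j - Pk (φ k) i j with hf
  have hfc : ∀ k, Continuous (f k) := fun k => by
    refine continuous_pi fun i => continuous_pi fun j => ?_
    exact ((Hess_smooth hu i j).continuous.comp
      (by fun_prop : Continuous fun y : EuclideanSpace ℝ (Fin n) => R (φ k) • y)).sub continuous_const
  have hlim : Filter.Tendsto (fun k => eLpNorm (f k - fun _ => 0) 1 (volume.restrict (BB n)))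
      Filter.atTop (nhds 0) := by
    have hb : ∀ k, eLpNorm (f k - fun _ => 0) 1 (volume.restrict (BB n)) ≤
        (n * n : ℕ) * (2 ^ n * ENNReal.ofReal (C * (1 / ((φ k : ℝ) + 1)))) := by
      intro k
      rw [eLpNorm_one_eq_lintegral_enorm]
      calc _ ≤ ∫⁻ y in BB n, ∑ i, ∑ j, ‖Hess u (R (φ k) • y) i j - Hess u (z (φ k)) i j‖ₑ := by
            refine lintegral_mono fun y => ?_
            have : ‖f k y‖ ≤ ∑ i, ∑ j, |Hess u (R (φ k) • y) i j - Hess u (z (φ k)) i j| := by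
              have hnn : ∀ i, 0 ≤ ∑ j, |Hess u (R (φ k) • y) i j - Hess u (z (φ k)) i j| :=
                fun i => sum_nonneg fun _ _ => abs_nonneg _
              rw [pi_norm_le_iff_of_nonneg (sum_nonneg fun i _ => hnn i)]
              intro i
              rw [pi_norm_le_iff_of_nonneg (sum_nonneg fun i _ => hnn i)]
              intro j
              exact (single_le_sum (f := fun j => |Hess u (R (φ k) • y) i j - Hess u (z (φ k)) i j|)
                (fun _ _ => abs_nonneg _) (mem_univ j)).trans
                (single_le_sum (f := fun i => ∑ j, |Hess u (R (φ k) • y) i j - Hess u (z (φ k)) i j|)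
                (fun i _ => hnn i) (mem_univ i))
            simp only [Pi.sub_apply, sub_zero]
            rw [← ofReal_norm]
            refine (ENNReal.ofReal_le_ofReal this).trans (le_of_eq ?_)
            simp only [Real.enorm_eq_ofReal_abs]
            rw [ENNReal.ofReal_sum_of_nonneg fun i _ => sum_nonneg fun _ _ => abs_nonneg _]
            refine sum_congr rfl fun i _ => ?_
            rw [ENNReal.ofReal_sum_of_nonneg fun i _ => abs_nonneg _]
        _ = ∑ i, ∑ j, ∫⁻ y in BB n, ‖Hess u (R (φ k) • y) i j - Hess u (z (φ k)) i j‖ₑ := by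
            have hm : ∀ i j, Measurable fun y : EuclideanSpace ℝ (Fin n) =>
                ‖Hess u (R (φ k) • y) i j - Hess u (z (φ k)) i j‖ₑ := fun i j =>
              (((Hess_smooth hu i j).continuous.comp
                (by fun_prop : Continuous fun y : EuclideanSpace ℝ (Fin n) => R (φ k) • y)).sub
                continuous_const).enorm.measurable
            rw [lintegral_finsetSum _ fun i _ => Finset.measurable_sum _ fun j _ => hm i j]
            refine sum_congr rfl fun i _ => ?_
            rw [lintegral_finsetSum _ fun j _ => hm i j]
        _ ≤ ∑ i : Fin n, ∑ j : Fin n, 2 ^ n * ENNReal.ofReal (C * (1 / ((φ k : ℝ) + 1))) :=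
            sum_le_sum fun i _ => sum_le_sum fun j _ => hz (φ k) i j
        _ = _ := by simp; ring
    refine tendsto_of_tendsto_of_tendsto_of_le_of_le tendsto_const_nhds ?_ (fun _ => zero_le) hb
    have t1 : Filter.Tendsto (fun k => C * (1 / ((φ k : ℝ) + 1))) Filter.atTop (nhds 0) := by
      have := (tendsto_one_div_add_atTop_nhds_zero_nat (𝕜 := ℝ)).comp hφ.tendsto_atTop
      simpa using this.const_mul C
    have t2 := ENNReal.tendsto_ofReal t1
    have t3 := ENNReal.Tendsto.const_mul (a := ((n * n : ℕ) : ℝ≥0∞) * 2 ^ n) t2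
      (Or.inr (by finiteness))
    simpa [mul_assoc] using t3
  have hmeas := tendstoInMeasure_of_tendsto_eLpNorm one_ne_zero
    (fun k => (hfc k).aestronglyMeasurable) aestronglyMeasurable_const hlim
  obtain ⟨ns, hns, hae⟩ := hmeas.exists_seq_tendsto_ae
  have hPlim : ∀ i j, Filter.Tendsto (fun k => Pk (φ (ns k)) i j) Filter.atTop (nhds (P i j)) := by
    intro i j
    have := hP.comp hns.tendsto_atTop
    exact (tendsto_pi_nhds.1 ((tendsto_pi_nhds.1 this) i)) j
  refine ⟨fun k => R (φ (ns k)), Matrix.of P, fun k => hR0 _,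
    hRt.comp (hφ.tendsto_atTop.comp hns.tendsto_atTop), ?_, ?_⟩
  · ext i j
    simp only [Matrix.conjTranspose_apply, Matrix.of_apply, star_trivial]
    refine tendsto_nhds_unique (hPlim j i) ((hPlim i j).congr fun k => ?_)
    exact Hess_symm hu _ _ _
  · filter_upwards [hae] with y hy i j
    have h2 := (tendsto_pi_nhds.1 ((tendsto_pi_nhds.1 hy) i)) j
    have h3 := h2.add (hPlim i j)
    simpa [hf] using h3

end
end SLag11

end

section

open Matrix Finset MeasureTheory
open scoped ContDiff ENNReal

noncomputable section SLag12

section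
variable {n : ℕ} {u : EuclideanSpace ℝ (Fin n) → ℝ}

/-- squared length of the graph vector of the linear map `P` -/
def sP (P : Matrix (Fin n) (Fin n) ℝ) (y : EuclideanSpace ℝ (Fin n)) : ℝ :=
  ∑ a, (y a) ^ 2 + ∑ a, (∑ k, y k * P k a) ^ 2

/-- the flat weighted mass -/
def kap (n : ℕ) : ℝ := ∫ z : EuclideanSpace ℝ (Fin n), pk 3 (1 - ‖z‖ ^ 2)

lemma lin_change (P : Matrix (Fin n) (Fin n) ℝ) (hP : P.IsHermitian) :
    ∫ y, Real.sqrt ((1 + P * P).det) * pk 3 (1 - sP P y) = kap n := by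
  have hPt : Pᵀ = P := by
    have := hP.eq
    rwa [Matrix.conjTranspose_eq_transpose_of_trivial] at this
  have hpd : (1 + P * P).PosDef := by
    have h1 : (Pᴴ * P).PosSemidef := posSemidef_conjTranspose_mul_self P
    rw [hP.eq] at h1
    exact Matrix.PosDef.one.add_posSemidef h1
  obtain ⟨B, hB⟩ : ∃ B : Matrix (Fin n) (Fin n) ℝ, 1 + P * P = Bᵀ * B := by
    obtain ⟨O, h1, h2, h3⟩ := spec hP
    refine ⟨diagonal (fun i => Real.sqrt (1 + hP.eigenvalues i ^ 2)) * Oᵀ, ?_⟩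
    have e1 : P * P = O * diagonal (fun i => hP.eigenvalues i ^ 2) * Oᵀ := by
      conv_lhs => rw [h3]
      have : O * diagonal hP.eigenvalues * Oᵀ * (O * diagonal hP.eigenvalues * Oᵀ) =
        O * diagonal hP.eigenvalues * (Oᵀ * O) * diagonal hP.eigenvalues * Oᵀ := by
        simp only [Matrix.mul_assoc]
      rw [this, h1, Matrix.mul_one, Matrix.mul_assoc O, diagonal_mul_diagonal]
      simp [sq]
    have e2 : diagonal (fun i => Real.sqrt (1 + hP.eigenvalues i ^ 2)) *
        diagonal (fun i => Real.sqrt (1 + hP.eigenvalues i ^ 2)) =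
        1 + diagonal (fun i => hP.eigenvalues i ^ 2) := by
      rw [diagonal_mul_diagonal, ← diagonal_one, diagonal_add]
      congr 1
      funext i
      exact Real.mul_self_sqrt (by positivity)
    rw [Matrix.transpose_mul, Matrix.transpose_transpose, diagonal_transpose, Matrix.mul_assoc,
      ← Matrix.mul_assoc (diagonal _) (diagonal _), e2, e1, Matrix.add_mul, Matrix.mul_add,
      Matrix.one_mul, h2, Matrix.mul_assoc]
  have hdet : (1 + P * P).det = B.det ^ 2 := by
    rw [hB, det_mul, det_transpose, sq]
  have hd0 : B.det ≠ 0 := by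
    intro h
    have := hpd.det_pos
    rw [hdet, h] at this; simp at this
  set T := Matrix.toEuclideanLin B with hT
  have hTdet : LinearMap.det T = B.det := by
    rw [hT, Matrix.toEuclideanLin_eq_toLin, LinearMap.det_toLin]
  have hnorm : ∀ y, sP P y = ‖T y‖ ^ 2 := by
    intro y
    rw [EuclideanSpace.norm_sq_eq]
    simp only [Real.norm_eq_abs, sq_abs]
    have e : ∀ a, (T y) a = (B *ᵥ y.ofLp) a := fun a => rfl
    simp only [e]
    have e1 : ∑ a, (B *ᵥ y.ofLp) a ^ 2 = (B *ᵥ y.ofLp) ⬝ᵥ (B *ᵥ y.ofLp) := by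
      simp [dotProduct, sq]
    have e2 : ∑ a, (∑ k, y k * P k a) ^ 2 = (P *ᵥ y.ofLp) ⬝ᵥ (P *ᵥ y.ofLp) := by
      have : ∀ a, ∑ k, y k * P k a = (P *ᵥ y.ofLp) a := by
        intro a
        conv_rhs => rw [← hPt]
        rw [Matrix.mulVec_transpose]
        rfl
      simp only [this]
      simp [dotProduct, sq]
    have e3 : ∑ a, (y a) ^ 2 = y.ofLp ⬝ᵥ y.ofLp := by simp [dotProduct, sq]
    unfold sP
    rw [e1, e2, e3]
    have e4 : (B *ᵥ y.ofLp) ⬝ᵥ (B *ᵥ y.ofLp) = y.ofLp ⬝ᵥ ((Bᵀ * B) *ᵥ y.ofLp) := by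
      rw [← Matrix.mulVec_mulVec, Matrix.dotProduct_mulVec y.ofLp, Matrix.vecMul_transpose]
    have e5 : (P *ᵥ y.ofLp) ⬝ᵥ (P *ᵥ y.ofLp) = y.ofLp ⬝ᵥ ((P * P) *ᵥ y.ofLp) := by
      conv_rhs => rw [← Matrix.mulVec_mulVec, Matrix.dotProduct_mulVec y.ofLp, ← hPt,
        Matrix.vecMul_transpose, hPt]
    rw [e4, e5, ← hB, Matrix.add_mulVec, dotProduct_add, Matrix.one_mulVec]
  have hmap := Measure.map_linearMap_addHaar_eq_smul_addHaar
    (volume : Measure (EuclideanSpace ℝ (Fin n))) (f := T) (by rw [hTdet]; exact hd0)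
  have hc : Continuous fun z : EuclideanSpace ℝ (Fin n) => pk 3 (1 - ‖z‖ ^ 2) :=
    (pk_cont 3).comp (by fun_prop)
  have hTc : Continuous T := LinearMap.continuous_of_finiteDimensional T
  have hintegr : ∫ y, pk 3 (1 - ‖T y‖ ^ 2) = |B.det|⁻¹ * kap n := by
    have := integral_map (μ := volume) (φ := T) hTc.aemeasurable
      (f := fun z : EuclideanSpace ℝ (Fin n) => pk 3 (1 - ‖z‖ ^ 2)) hc.aestronglyMeasurable
    rw [← this, hmap, integral_smul_measure, hTdet, abs_inv, ENNReal.toReal_ofReal (by positivity)]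
    rfl
  rw [integral_const_mul]
  simp only [hnorm]
  rw [hintegr, hdet, Real.sqrt_sq_eq_abs, ← mul_assoc, mul_inv_cancel₀ (abs_ne_zero.2 hd0), one_mul]

lemma ae_ray {Q : EuclideanSpace ℝ (Fin n) → Prop} (hQ : ∀ᵐ y, Q y) :
    ∀ᵐ y : EuclideanSpace ℝ (Fin n), ∀ᵐ σ ∂(volume.restrict (Set.Ioc (0 : ℝ) 1)), Q (σ • y) := by
  obtain ⟨N, hN, hNm, hN0⟩ := exists_measurable_superset_of_null hQ
  have h1 : ∀ᵐ σ ∂(volume.restrict (Set.Ioc (0 : ℝ) 1)), ∀ᵐ y : EuclideanSpace ℝ (Fin n), σ • y ∉ N := by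
    filter_upwards [ae_restrict_mem measurableSet_Ioc] with σ hσ
    have := Measure.addHaar_preimage_smul (volume : Measure (EuclideanSpace ℝ (Fin n))) hσ.1.ne' N
    rw [hN0, mul_zero] at this
    rw [ae_iff]
    simpa [Set.preimage] using this
  have h2 := (Measure.ae_ae_comm (μ := volume.restrict (Set.Ioc (0 : ℝ) 1))
    (ν := (volume : Measure (EuclideanSpace ℝ (Fin n)))) (p := fun σ y => σ • y ∉ N) ?_).1 h1
  · filter_upwards [h2] with y hy
    filter_upwards [hy] with σ hσ
    by_contra hc
    exact hσ (hN hc)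
  · have : Measurable fun p : ℝ × EuclideanSpace ℝ (Fin n) => p.1 • p.2 := by fun_prop
    exact this hNm.compl

lemma ww_lim (hu : ContDiff ℝ ∞ u) {M : ℝ} (hM : ∀ x i j, |Hess u x i j| ≤ M)
    {R : ℕ → ℝ} (hR : ∀ k, 0 < R k) {P : Matrix (Fin n) (Fin n) ℝ} {y : EuclideanSpace ℝ (Fin n)}
    (h : ∀ᵐ σ ∂(volume.restrict (Set.Ioc (0 : ℝ) 1)), ∀ i j,
      Filter.Tendsto (fun k => Hess u (R k • σ • y) i j) Filter.atTop (nhds (P i j))) (a : Fin n) :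
    Filter.Tendsto (fun k => (R k)⁻¹ * ww u a (R k • y)) Filter.atTop (nhds (∑ k, y k * P k a)) := by
  have e : ∀ k, (R k)⁻¹ * ww u a (R k • y) =
      ∫ τ in (0 : ℝ)..1, ∑ i, y i * Hess u (R k • τ • y) i a := by
    intro k
    rw [ww_ftc hu, ← intervalIntegral.integral_const_mul]
    refine intervalIntegral.integral_congr fun τ _ => ?_
    simp only [mul_sum]
    refine sum_congr rfl fun i _ => ?_
    rw [smul_comm (R k) τ y]
    simp only [PiLp.smul_apply, smul_eq_mul]
    have := (hR k).ne'
    field_simp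
  simp only [e]
  have e2 : ∑ k, y k * P k a = ∫ τ in (0 : ℝ)..1, ∑ i, y i * P i a := by simp
  rw [e2]
  refine intervalIntegral.tendsto_integral_filter_of_dominated_convergence
    (fun _ => ∑ i, |y i| * M) ?_ ?_ ?_ ?_
  · refine Filter.Eventually.of_forall fun k => Continuous.aestronglyMeasurable ?_
    refine continuous_finsetSum _ fun i _ => continuous_const.mul ?_
    exact (Hess_smooth hu i a).continuous.comp (by fun_prop)
  · refine Filter.Eventually.of_forall fun k => Filter.Eventually.of_forall fun τ _ => ?_
    rw [Real.norm_eq_abs]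
    refine (abs_sum_le_sum_abs _ _).trans (sum_le_sum fun i _ => ?_)
    rw [abs_mul]
    exact mul_le_mul_of_nonneg_left (hM _ _ _) (abs_nonneg _)
  · exact intervalIntegrable_const
  · rw [Set.uIoc_of_le zero_le_one]
    rw [ae_restrict_iff' measurableSet_Ioc] at h
    filter_upwards [h] with σ hσ hσm
    exact tendsto_finsetSum _ fun i _ => (hσ hσm i a).const_mul _

lemma II_lim (hu : ContDiff ℝ ∞ u) (hsym : ∀ x, (Hess u x).IsHermitian) {L : ℝ}
    (hL : ∀ x i, ((hsym x).eigenvalues i) ^ 2 ≤ L)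
    {R : ℕ → ℝ} (hR : ∀ k, 0 < R k) {P : Matrix (Fin n) (Fin n) ℝ} (hP : P.IsHermitian)
    (h : ∀ᵐ y ∂(volume.restrict (BB n)), ∀ i j,
        Filter.Tendsto (fun k => Hess u (R k • y) i j) Filter.atTop (nhds (P i j))) :
    Filter.Tendsto (fun k => II u (fun _ => 1) ((R k ^ 2)⁻¹)) Filter.atTop (nhds (kap n)) := by
  have hM := Hess_bd hsym hL
  have e : ∀ k, II u (fun _ => 1) ((R k ^ 2)⁻¹) =
      ∫ y, Vol u (R k • y) * pk 3 (1 - (R k ^ 2)⁻¹ * ss u (R k • y)) := by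
    intro k
    rw [II_scale _ (by have := hR k; positivity), inv_inv, Real.sqrt_sq (hR k).le]
    simp only [one_mul]
  simp only [e]
  rw [← lin_change P hP]
  have hout : ∀ k y, y ∉ BB n → pk 3 (1 - (R k ^ 2)⁻¹ * ss u (R k • y)) = 0 := by
    intro k y hy
    have hk := hR k
    refine pk_out 2 (out_ball (r := R k) (by positivity) hk.le ?_ ?_)
    · rw [inv_mul_cancel₀ (by positivity)]
    · rw [mem_closedBall_zero_iff] at hy ⊢
      rw [norm_smul, Real.norm_of_nonneg hk.le]
      nlinarith
  rw [ae_restrict_iff' measurableSet_closedBall] at h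
  refine tendsto_integral_of_dominated_convergence
    ((BB n).indicator fun _ => (1 + |L|) ^ n) ?_ ?_ ?_ ?_
  · intro k
    refine Continuous.aestronglyMeasurable ?_
    have hc : Continuous fun y : EuclideanSpace ℝ (Fin n) => R k • y := by fun_prop
    exact ((Vol_smooth hu hsym).continuous.comp hc).mul ((pk_cont 3).comp
      (continuous_const.sub (continuous_const.mul ((ss_smooth hu).continuous.comp hc))))
  · rw [integrable_indicator_iff measurableSet_closedBall]
    exact integrableOn_const (isCompact_closedBall _ _).measure_lt_top.ne
  · intro k
    refine Filter.Eventually.of_forall fun y => ?_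
    by_cases hy : y ∈ BB n
    · rw [Set.indicator_of_mem hy, Real.norm_eq_abs, abs_mul, abs_of_nonneg (pk_nonneg _ _)]
      have h1 := pk_le_one 3 (t := 1 - (R k ^ 2)⁻¹ * ss u (R k • y)) (by
        have hk := hR k
        have := mul_nonneg (by positivity : 0 ≤ (R k ^ 2)⁻¹) (ss_nonneg (u := u) (R k • y))
        linarith)
      have h2 := Vol_ge hsym (R k • y)
      have h3 := Vol_le hsym hL (R k • y)
      rw [abs_of_nonneg (by linarith)]
      exact (mul_le_of_le_one_right (by linarith) h1).trans (by nlinarith)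
    · rw [Set.indicator_of_notMem hy, hout k y hy, mul_zero, norm_zero]
  · filter_upwards [h, ae_ray h] with y hy hray
    by_cases hyB : y ∈ BB n
    · have hw := fun a => ww_lim hu hM hR (P := P) (y := y) (by
        filter_upwards [hray, ae_restrict_mem measurableSet_Ioc] with σ hσ hσm
        refine hσ ?_
        rw [mem_closedBall_zero_iff] at hyB ⊢
        rw [norm_smul, Real.norm_of_nonneg hσm.1.le]
        nlinarith [hσm.1, hσm.2, norm_nonneg y]) a
      have hVl : Filter.Tendsto (fun k => Vol u (R k • y)) Filter.atTop
          (nhds (Real.sqrt ((1 + P * P).det))) := by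
        have hH : Filter.Tendsto (fun k => Hess u (R k • y)) Filter.atTop (nhds P) :=
          tendsto_pi_nhds.2 fun i => tendsto_pi_nhds.2 fun j => hy hyB i j
        have hc : Continuous fun A : Matrix (Fin n) (Fin n) ℝ => Real.sqrt ((1 + A * A).det) :=
          Real.continuous_sqrt.comp (Continuous.matrix_det (by fun_prop))
        exact (hc.tendsto P).comp hH
      have hsl : Filter.Tendsto (fun k => (R k ^ 2)⁻¹ * ss u (R k • y)) Filter.atTop
          (nhds (sP P y)) := by
        have e2 : ∀ k, (R k ^ 2)⁻¹ * ss u (R k • y) =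
            ∑ a, (y a) ^ 2 + ∑ a, ((R k)⁻¹ * ww u a (R k • y)) ^ 2 := by
          intro k
          have hk := (hR k).ne'
          unfold ss
          rw [mul_add, mul_sum, mul_sum]
          congr 1
          · refine sum_congr rfl fun a _ => ?_
            simp only [PiLp.smul_apply, smul_eq_mul]
            field_simp
          · refine sum_congr rfl fun a _ => ?_
            field_simp
        simp only [e2]
        exact tendsto_const_nhds.add (tendsto_finsetSum _ fun a _ => (hw a).pow 2)
      exact hVl.mul (((pk_cont 3).tendsto _).comp (tendsto_const_nhds.sub hsl))
    · simp only [hout _ y hyB, mul_zero]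
      have : pk 3 (1 - sP P y) = 0 := by
        refine pk_zero 2 ?_
        have h1 : ‖y‖ ^ 2 = ∑ a, (y a) ^ 2 := by
          rw [EuclideanSpace.norm_sq_eq]; simp
        have h2 : 0 ≤ ∑ a, (∑ k, y k * P k a) ^ 2 := sum_nonneg fun _ _ => sq_nonneg _
        rw [mem_closedBall_zero_iff, not_le] at hyB
        unfold sP
        nlinarith
      rw [this, mul_zero]
      exact tendsto_const_nhds

end
end SLag12

end

section

open Matrix Finset MeasureTheory
open scoped ContDiff ENNReal

noncomputable section SLag13

section
variable {n : ℕ} {u : EuclideanSpace ℝ (Fin n) → ℝ}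

lemma seq_zero_lim (hu : ContDiff ℝ ∞ u) (y : EuclideanSpace ℝ (Fin n)) (i j : Fin n) :
    Filter.Tendsto (fun k : ℕ => Hess u ((1 / ((k : ℝ) + 1)) • y) i j) Filter.atTop
      (nhds (Hess u 0 i j)) := by
  have h1 : Filter.Tendsto (fun k : ℕ => (1 / ((k : ℝ) + 1)) • y) Filter.atTop (nhds 0) := by
    simpa using (tendsto_one_div_add_atTop_nhds_zero_nat (𝕜 := ℝ)).smul_const y
  exact ((Hess_smooth hu i j).continuous.tendsto 0).comp h1

lemma II_const (hu : ContDiff ℝ ∞ u) (hsym : ∀ x, (Hess u x).IsHermitian) {c : ℝ}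
    (hsol : ∀ x, ∑ i, Real.arctan ((hsym x).eigenvalues i) = c) {L c0 : ℝ}
    (hL : ∀ x i, ((hsym x).eigenvalues i) ^ 2 ≤ L)
    (hc : 0 < c0) (hlap : ∀ x, c0 * D3 u x ≤ lapg u (bV u) x) {t : ℝ} (ht : 0 < t) :
    II u (fun _ => 1) t = kap n := by
  have hanti := II_anti hu hsym hsol
  obtain ⟨R, P, hR, hRt, hP, hconv⟩ := blowdown hu (Hess_bd hsym hL)
    (fun η hη R0 => decay hu hsym hsol hL hc hlap hη R0)
  have l1 := II_lim hu hsym hL hR hP hconv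
  have hR' : ∀ k : ℕ, 0 < 1 / ((k : ℝ) + 1) := fun k => by positivity
  have l2 := II_lim hu hsym hL hR' (hsym 0)
    (Filter.Eventually.of_forall fun y i j => seq_zero_lim hu y i j)
  have t1 : Filter.Tendsto (fun k => (R k ^ 2)⁻¹) Filter.atTop (nhds 0) :=
    ((Filter.tendsto_pow_atTop two_ne_zero).comp hRt).inv_tendsto_atTop
  have t2 : Filter.Tendsto (fun k : ℕ => ((1 / ((k : ℝ) + 1)) ^ 2)⁻¹) Filter.atTop Filter.atTop := by
    have : (fun k : ℕ => ((1 / ((k : ℝ) + 1)) ^ 2)⁻¹) = fun k : ℕ => ((k : ℝ) + 1) ^ 2 := by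
      funext k; simp
    rw [this]
    exact (Filter.tendsto_pow_atTop two_ne_zero).comp
      (Filter.tendsto_atTop_add_const_right _ _ tendsto_natCast_atTop_atTop)
  refine le_antisymm ?_ ?_
  · refine ge_of_tendsto l1 ?_
    filter_upwards [t1.eventually (gt_mem_nhds ht)] with k hk
    have := hR k
    exact hanti (show 0 < (R k ^ 2)⁻¹ by positivity) ht hk.le
  · refine le_of_tendsto l2 ?_
    filter_upwards [t2.eventually_ge_atTop t] with k hk
    exact hanti ht (lt_of_lt_of_le ht hk) hk

lemma Nn_zero (hu : ContDiff ℝ ∞ u) (hsym : ∀ x, (Hess u x).IsHermitian) {c : ℝ}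
    (hsol : ∀ x, ∑ i, Real.arctan ((hsym x).eigenvalues i) = c)
    (hconst : ∀ t > 0, II u (fun _ => 1) t = kap n) (x : EuclideanSpace ℝ (Fin n)) :
    Nn u x = 0 := by
  set t : ℝ := (1 + ss u x)⁻¹ with ht
  have hs := ss_nonneg (u := u) x
  have ht0 : 0 < t := by positivity
  have hpos : 0 < 1 - t * ss u x := by
    rw [ht, ← div_eq_inv_mul, sub_pos, div_lt_one (by positivity)]; linarith
  have hd := II_deriv_one hu hsym hsol ht0
  have hd2 : HasDerivAt (II u (fun _ => 1)) 0 t := by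
    refine (hasDerivAt_const t (kap n)).congr_of_eventuallyEq ?_
    filter_upwards [lt_mem_nhds ht0] with s hs using hconst s hs
  have hz := hd.unique hd2
  have hne : -3 * t ^ ((n : ℝ) / 2 - 2) * t ^ 2 ≠ 0 := by
    have := Real.rpow_pos_of_pos ht0 ((n : ℝ) / 2 - 2)
    have : 0 < 3 * t ^ ((n : ℝ) / 2 - 2) * t ^ 2 := by positivity
    linarith
  have hi := (mul_eq_zero.1 hz).resolve_left hne
  have hF : Continuous fun x => 1 * Vol u x * Nn u x :=
    (continuous_const.mul (Vol_smooth hu hsym).continuous).mul (Nn_cont hu hsym)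
  have hG : Continuous fun x => (1 * Vol u x * Nn u x) * pk 2 (1 - t * ss u x) :=
    hF.mul ((pk_cont _).comp (arg_smooth hu t).continuous)
  have hV : ∀ x, 0 < Vol u x := fun x => lt_of_lt_of_le one_pos (Vol_ge hsym x)
  have h0 := (integral_eq_zero_iff_of_nonneg (fun x => by
    have := hV x
    have := Nn_nonneg hsym x
    have := pk_nonneg 2 (1 - t * ss u x)
    simp only [Pi.zero_apply]
    positivity) (int_pk hu ht0 1 hF)).1 hi
  have h1 := congrFun ((hG.ae_eq_iff_eq volume continuous_zero).1 h0) x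
  have h2 : pk 2 (1 - t * ss u x) ≠ 0 := by
    unfold pk
    rw [max_eq_left hpos.le]
    positivity
  simp only [Pi.zero_apply, one_mul] at h1
  exact (mul_eq_zero.1 ((mul_eq_zero.1 h1).resolve_right h2)).resolve_left (hV x).ne'

lemma ww_cone (hu : ContDiff ℝ ∞ u) (hsym : ∀ x, (Hess u x).IsHermitian) {M : ℝ}
    (hM : ∀ x i j, |Hess u x i j| ≤ M)
    (hq : ∀ x i, qq u x i = 0) (x : EuclideanSpace ℝ (Fin n)) (a : Fin n) :
    ww u a x = ∑ k, x k * Hess u 0 k a := by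
  have hd : ∀ s ∈ Set.Ioi (0 : ℝ), HasDerivAt (fun s : ℝ => s⁻¹ * ww u a (s • x)) 0 s := by
    intro s hs
    have hs0 : s ≠ 0 := ne_of_gt hs
    have h1 := line_deriv (ww_smooth hu a) 0 x s
    simp only [zero_add] at h1
    refine ((hasDerivAt_inv hs0).mul h1).congr_deriv ?_
    have h2 := hq (s • x) a
    unfold qq at h2
    have h3 : ∀ k, pd k (ww u a) (s • x) = Hess u (s • x) a k := by
      intro k
      rw [pd_eq ((ww_smooth hu a).differentiable (by simp) _) (ww_line hu (s • x) k a)]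
      exact Hess_symm hu _ _ _
    simp only [h3]
    have h4 : ww u a (s • x) = s * ∑ k, x k * Hess u (s • x) a k := by
      rw [sub_eq_zero.1 h2, mul_sum]
      refine sum_congr rfl fun k _ => ?_
      simp only [PiLp.smul_apply, smul_eq_mul]; ring
    rw [h4]
    field_simp
    ring
  have hc : ∀ s ∈ Set.Ioi (0 : ℝ), s⁻¹ * ww u a (s • x) = ww u a x := by
    intro s hs
    have := isOpen_Ioi.is_const_of_deriv_eq_zero (isPreconnected_Ioi (a := (0 : ℝ)))
      (fun s hs => (hd s hs).differentiableAt.differentiableWithinAt)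
      (fun s hs => (hd s hs).deriv) hs (Set.mem_Ioi.2 one_pos)
    simpa using this
  have hR' : ∀ k : ℕ, 0 < 1 / ((k : ℝ) + 1) := fun k => by positivity
  have hl := ww_lim hu hM hR' (P := Hess u 0) (y := x)
    (Filter.Eventually.of_forall fun σ i j => seq_zero_lim hu (σ • x) i j) a
  simp only [hc _ (hR' _)] at hl
  exact tendsto_nhds_unique tendsto_const_nhds hl

lemma Hess_const (hu : ContDiff ℝ ∞ u)
    (hw : ∀ x a, ww u a x = ∑ k, x k * Hess u 0 k a) (x : EuclideanSpace ℝ (Fin n)) :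
    Hess u x = Hess u 0 := by
  ext i a
  have h1 := ww_line hu x i a
  simp only [hw] at h1
  have h2 : HasDerivAt (fun t : ℝ => ∑ k,
      (x + t • EuclideanSpace.single i (1 : ℝ) : EuclideanSpace ℝ (Fin n)) k * Hess u 0 k a)
      (∑ k, (if k = i then 1 else 0) * Hess u 0 k a) 0 :=
    HasDerivAt.fun_sum fun k _ => (coord_line x i k).mul_const _
  have := h1.unique h2
  simpa using this

lemma case_large (hn : 2 ≤ n) (hu : ContDiff ℝ ∞ u) (hsym : ∀ x, (Hess u x).IsHermitian) {c : ℝ}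
    (hsol : ∀ x, ∑ i, Real.arctan ((hsym x).eigenvalues i) = c)
    (ε : ℝ) (hε : 1 < ε)
    (hcond : ∀ x, ∀ i j : Fin n,
      0 ≤ 3 + (1 - ε) * ((hsym x).eigenvalues i) ^ 2 +
        2 * (hsym x).eigenvalues i * (hsym x).eigenvalues j) (x : EuclideanSpace ℝ (Fin n)) :
    (ε / n) * gradSq u (bV u) x ≤ lapg u (bV u) x := by
  obtain ⟨L, hL⟩ := hess_bound hn hsym hsol hε hcond
  obtain ⟨c0, hc0, hlap⟩ := lap_ge hu hsym hsol hε hcond hL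
  have h1 := fun t (ht : t > 0) => II_const hu hsym hsol hL hc0 hlap ht
  have h2 := fun x i => Nn_eq_zero hsym x (Nn_zero hu hsym hsol h1 x) i
  have h3 := Hess_const hu (ww_cone hu hsym (Hess_bd hsym hL) h2)
  have h4 : bV u = fun _ => bV u 0 := by
    funext y
    simp only [bV, Vol, gMat, h3 y]
  rw [h4, lapg_const]
  simp [gradSq]

end

end SLag13

end

/-- The Jacobi inequality `Δ_g ln V ≥ (ε/n) |∇_g ln V|²_g` (Lemma 2.1). -/
theorem stmt_1 {n : ℕ} (hn : 2 ≤ n) (u : EuclideanSpace ℝ (Fin n) → ℝ) (c : ℝ)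
    (hu : ContDiff ℝ (⊤ : ℕ∞) u)
    (hsym : ∀ x, (Hess u x).IsHermitian)
    (hsol : ∀ x, ∑ i, Real.arctan ((hsym x).eigenvalues i) = c)
    (ε : ℝ) (hε : 0 < ε)
    (hcond : ∀ x, ∀ i j : Fin n,
      0 ≤ 3 + (1 - ε) * ((hsym x).eigenvalues i) ^ 2 +
        2 * (hsym x).eigenvalues i * (hsym x).eigenvalues j) :
    ∀ x : EuclideanSpace ℝ (Fin n),
      (ε / n) * gradSq u (fun y => Real.log (Vol u y)) x ≤
        lapg u (fun y => Real.log (Vol u y)) x := by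
  intro x
  rcases le_or_gt ε 1 with h | h
  · exact case_small hn hu hsym hsol ε hε h hcond x
  · exact case_large hn hu hsym hsol ε h hcond x
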